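/- Suppose m ≠ n, T is Σ1-ill, m ≥ 1 and n ≥ 0. Then there exists a Σ1 provability predicate PR_T(x) of T such that: (1) for any modal formula A and any arithmetical interpretation f based on PR_T(x), if N⁺A_{m,n} ⊢ A then T ⊢ f(A); and (2) there exists an arithmetical interpretation f based on PR_T(x) such that for every modal formula A, N⁺A_{m,n} ⊢ A if and only if T ⊢ f(A). -/

import Mathlib

namespace PLN

/-! ### Modal formulas and the logics N⁺A_{m,n} -/

/-- Formulas of modal propositional logic. -/
inductive MFml : Type
  | var : ℕ → MFml
  | bot : MFml
  | neg : MFml → MFml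
  | and : MFml → MFml → MFml
  | or : MFml → MFml → MFml
  | imp : MFml → MFml → MFml
  | box : MFml → MFml
  deriving DecidableEq

/-- `boxIter n A` is `□ⁿ A`, where `□⁰ A = A` and `□^(k+1) A = □ (□ᵏ A)`. -/
def boxIter : ℕ → MFml → MFml
  | 0, A => A
  | k + 1, A => .box (boxIter k A)

/-- Evaluation of a modal formula under a valuation of its "propositional atoms"
(propositional variables, and boxed formulas); used to define propositional tautologies
in the modal language. -/
def MFml.evalTC (v : MFml → Prop) : MFml → Prop
  | .bot => False
  | .neg A => ¬ A.evalTC v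
  | .and A B => A.evalTC v ∧ B.evalTC v
  | .or A B => A.evalTC v ∨ B.evalTC v
  | .imp A B => A.evalTC v → B.evalTC v
  | A => v A

/-- Propositional tautologies in the modal language. -/
def MTaut (A : MFml) : Prop := ∀ v, A.evalTC v

/-- Provability in the logic `N⁺A_{m,n}`: the pure logic of necessitation `N`
(propositional tautologies, modus ponens, necessitation) together with the axiom scheme
`□ⁿA → □ᵐA` and the rule `Ros□` (from `¬□A` infer `¬□□A`). -/
inductive NAProves (m n : ℕ) : MFml → Prop
  | taut {A} : MTaut A → NAProves m n A
  | acc (A) : NAProves m n (.imp (boxIter n A) (boxIter m A))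
  | mp {A B} : NAProves m n (.imp A B) → NAProves m n A → NAProves m n B
  | nec {A} : NAProves m n A → NAProves m n (.box A)
  | ros {A} : NAProves m n (.neg (.box A)) → NAProves m n (.neg (.box (.box A)))

/-- `IsSub B A` : `B` is a subformula of `A`. -/
inductive IsSub : MFml → MFml → Prop
  | refl (A) : IsSub A A
  | neg {B A} : IsSub B A → IsSub B (.neg A)
  | andL {B A C} : IsSub B A → IsSub B (.and A C)
  | andR {B A C} : IsSub B C → IsSub B (.and A C)
  | orL {B A C} : IsSub B A → IsSub B (.or A C)
  | orR {B A C} : IsSub B C → IsSub B (.or A C)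
  | impL {B A C} : IsSub B A → IsSub B (.imp A C)
  | impR {B A C} : IsSub B C → IsSub B (.imp A C)
  | box {B A} : IsSub B A → IsSub B (.box A)

/-! ### N-frames and N-models -/

/-- An N-model on a set `W` of worlds: an N-frame (a binary relation `≺_B` on `W`
for each modal formula `B`) together with a valuation of propositional variables. -/
structure NModel (W : Type) where
  rel : MFml → W → W → Prop
  val : W → ℕ → Prop

/-- The forcing relation of an N-model:
`x ⊩ □B` iff every `y` with `x ≺_B y` satisfies `y ⊩ B`. -/
def NModel.Forces {W : Type} (M : NModel W) : W → MFml → Prop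
  | x, .var p => M.val x p
  | _, .bot => False
  | x, .neg A => ¬ NModel.Forces M x A
  | x, .and A B => NModel.Forces M x A ∧ NModel.Forces M x B
  | x, .or A B => NModel.Forces M x A ∨ NModel.Forces M x B
  | x, .imp A B => NModel.Forces M x A → NModel.Forces M x B
  | x, .box A => ∀ y, M.rel A x y → NModel.Forces M y A

/-- The relations `≺_B^k` : `x ≺_B^0 y` iff `x = y`, and
`x ≺_B^(k+1) y` iff `∃ w, x ≺_{□ᵏB} w` and `w ≺_B^k y`. -/
def NModel.relIter {W : Type} (M : NModel W) (B : MFml) : ℕ → W → W → Prop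
  | 0, x, y => x = y
  | k + 1, x, y => ∃ w, M.rel (boxIter k B) x w ∧ NModel.relIter M B k w y

/-- `(m,n)`-accessibility of (the frame of) an N-model. -/
def NModel.Accessible {W : Type} (M : NModel W) (m n : ℕ) : Prop :=
  ∀ (B : MFml) (x y : W), NModel.relIter M B m x y → NModel.relIter M B n x y

/-! ### The language of first-order arithmetic -/

/-- Terms of the language of arithmetic, with de Bruijn variables. -/
inductive ATerm : Type
  | var : ℕ → ATerm
  | zero : ATerm
  | succ : ATerm → ATerm
  | add : ATerm → ATerm → ATerm
  | mul : ATerm → ATerm → ATerm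
  deriving DecidableEq

/-- Formulas of the language of arithmetic (with `≤` primitive), de Bruijn variables. -/
inductive AFml : Type
  | eq : ATerm → ATerm → AFml
  | le : ATerm → ATerm → AFml
  | neg : AFml → AFml
  | and : AFml → AFml → AFml
  | or : AFml → AFml → AFml
  | imp : AFml → AFml → AFml
  | all : AFml → AFml
  | ex : AFml → AFml
  deriving DecidableEq

/-- Lift (shift up by one) the variables `≥ c` of a term. -/
def ATerm.lift (c : ℕ) : ATerm → ATerm
  | .var n => .var (if n < c then n else n + 1)
  | .zero => .zero
  | .succ t => .succ (t.lift c)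
  | .add t s => .add (t.lift c) (s.lift c)
  | .mul t s => .mul (t.lift c) (s.lift c)

/-- Simultaneous substitution in terms. -/
def ATerm.substAll (σ : ℕ → ATerm) : ATerm → ATerm
  | .var n => σ n
  | .zero => .zero
  | .succ t => .succ (t.substAll σ)
  | .add t s => .add (t.substAll σ) (s.substAll σ)
  | .mul t s => .mul (t.substAll σ) (s.substAll σ)

/-- Pushing a substitution under a binder. -/
def liftSub (σ : ℕ → ATerm) : ℕ → ATerm
  | 0 => .var 0
  | n + 1 => (σ n).lift 0

/-- Lift (shift up by one) the free variables `≥ c` of a formula. -/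
def AFml.lift (c : ℕ) : AFml → AFml
  | .eq t s => .eq (t.lift c) (s.lift c)
  | .le t s => .le (t.lift c) (s.lift c)
  | .neg φ => .neg (φ.lift c)
  | .and φ ψ => .and (φ.lift c) (ψ.lift c)
  | .or φ ψ => .or (φ.lift c) (ψ.lift c)
  | .imp φ ψ => .imp (φ.lift c) (ψ.lift c)
  | .all φ => .all (φ.lift (c + 1))
  | .ex φ => .ex (φ.lift (c + 1))

/-- Simultaneous (capture-avoiding) substitution in formulas. -/
def AFml.substAll (σ : ℕ → ATerm) : AFml → AFml
  | .eq t s => .eq (t.substAll σ) (s.substAll σ)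
  | .le t s => .le (t.substAll σ) (s.substAll σ)
  | .neg φ => .neg (φ.substAll σ)
  | .and φ ψ => .and (φ.substAll σ) (ψ.substAll σ)
  | .or φ ψ => .or (φ.substAll σ) (ψ.substAll σ)
  | .imp φ ψ => .imp (φ.substAll σ) (ψ.substAll σ)
  | .all φ => .all (φ.substAll (liftSub σ))
  | .ex φ => .ex (φ.substAll (liftSub σ))

def subst0Env (t : ATerm) : ℕ → ATerm
  | 0 => t
  | n + 1 => .var n

def subst2Env (t s : ATerm) : ℕ → ATerm
  | 0 => t
  | 1 => s
  | n + 2 => .var n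

/-- Substitute the term `t` for the free variable `0` (decrementing other variables). -/
def AFml.subst0 (φ : AFml) (t : ATerm) : AFml := φ.substAll (subst0Env t)

/-- Substitute the terms `t`, `s` for the free variables `0`, `1` simultaneously. -/
def AFml.subst2 (φ : AFml) (t s : ATerm) : AFml := φ.substAll (subst2Env t s)

/-- Substitute `S(var 0)` for `var 0`, leaving all other free variables unchanged. -/
def succSubst (φ : AFml) : AFml :=
  φ.substAll fun n => if n = 0 then .succ (.var 0) else .var n

/-- All variables of a term are `< c`. -/
def ATerm.FreeLt (c : ℕ) : ATerm → Prop
  | .var n => n < c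
  | .zero => True
  | .succ t => t.FreeLt c
  | .add t s => t.FreeLt c ∧ s.FreeLt c
  | .mul t s => t.FreeLt c ∧ s.FreeLt c

/-- All free variables of a formula are `< c`; `FreeLt 0 φ` says that `φ` is a sentence. -/
def AFml.FreeLt (c : ℕ) : AFml → Prop
  | .eq t s => t.FreeLt c ∧ s.FreeLt c
  | .le t s => t.FreeLt c ∧ s.FreeLt c
  | .neg φ => φ.FreeLt c
  | .and φ ψ => φ.FreeLt c ∧ ψ.FreeLt c
  | .or φ ψ => φ.FreeLt c ∧ ψ.FreeLt c
  | .imp φ ψ => φ.FreeLt c ∧ ψ.FreeLt c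
  | .all φ => φ.FreeLt (c + 1)
  | .ex φ => φ.FreeLt (c + 1)

/-- The numeral `n̄`. -/
def numeral : ℕ → ATerm
  | 0 => .zero
  | n + 1 => .succ (numeral n)

/-- A Gödel numbering of terms. -/
def ATerm.code : ATerm → ℕ
  | .var n => Nat.pair 0 n
  | .zero => Nat.pair 1 0
  | .succ t => Nat.pair 2 t.code
  | .add t s => Nat.pair 3 (Nat.pair t.code s.code)
  | .mul t s => Nat.pair 4 (Nat.pair t.code s.code)

/-- A Gödel numbering of formulas. -/
def AFml.code : AFml → ℕ
  | .eq t s => Nat.pair 0 (Nat.pair t.code s.code)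
  | .le t s => Nat.pair 1 (Nat.pair t.code s.code)
  | .neg φ => Nat.pair 2 φ.code
  | .and φ ψ => Nat.pair 3 (Nat.pair φ.code ψ.code)
  | .or φ ψ => Nat.pair 4 (Nat.pair φ.code ψ.code)
  | .imp φ ψ => Nat.pair 5 (Nat.pair φ.code ψ.code)
  | .all φ => Nat.pair 6 φ.code
  | .ex φ => Nat.pair 7 φ.code

/-- `⌜φ⌝`, the numeral of the Gödel number of `φ`. -/
def gnum (φ : AFml) : ATerm := numeral φ.code

/-- For a formula `P(x)` (with free variable `var 0`), `P.appNum φ` is `P(⌜φ⌝)`. -/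
def AFml.appNum (P φ : AFml) : AFml := P.subst0 (gnum φ)

/-- Iterated application of a predicate: `iterPred P k φ = P(⌜P(⌜⋯P(⌜φ⌝)⋯⌝)⌝)` (`k` times). -/
def iterPred (P : AFml) : ℕ → AFml → AFml
  | 0, φ => φ
  | k + 1, φ => P.appNum (iterPred P k φ)

/-! ### Satisfaction in the standard model -/

def ATerm.val (ρ : ℕ → ℕ) : ATerm → ℕ
  | .var n => ρ n
  | .zero => 0
  | .succ t => t.val ρ + 1
  | .add t s => t.val ρ + s.val ρ
  | .mul t s => t.val ρ * s.val ρ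

def consEnv (a : ℕ) (ρ : ℕ → ℕ) : ℕ → ℕ
  | 0 => a
  | n + 1 => ρ n

/-- Satisfaction in the standard model `ℕ` under an environment `ρ`. -/
def AFml.Sat (ρ : ℕ → ℕ) : AFml → Prop
  | .eq t s => t.val ρ = s.val ρ
  | .le t s => t.val ρ ≤ s.val ρ
  | .neg φ => ¬ φ.Sat ρ
  | .and φ ψ => φ.Sat ρ ∧ ψ.Sat ρ
  | .or φ ψ => φ.Sat ρ ∨ ψ.Sat ρ
  | .imp φ ψ => φ.Sat ρ → ψ.Sat ρ
  | .all φ => ∀ a, φ.Sat (consEnv a ρ)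
  | .ex φ => ∃ a, φ.Sat (consEnv a ρ)

/-- `ℕ ⊨ φ`. -/
def TrueN (φ : AFml) : Prop := φ.Sat fun _ => 0

/-! ### The arithmetical hierarchy: Δ₀, Σ₁, Π₁ -/

/-- `Δ₀` formulas: every quantifier is bounded. -/
inductive IsDelta0 : AFml → Prop
  | eq (t s : ATerm) : IsDelta0 (.eq t s)
  | le (t s : ATerm) : IsDelta0 (.le t s)
  | neg {φ} : IsDelta0 φ → IsDelta0 (.neg φ)
  | and {φ ψ} : IsDelta0 φ → IsDelta0 ψ → IsDelta0 (.and φ ψ)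
  | or {φ ψ} : IsDelta0 φ → IsDelta0 ψ → IsDelta0 (.or φ ψ)
  | imp {φ ψ} : IsDelta0 φ → IsDelta0 ψ → IsDelta0 (.imp φ ψ)
  | ball {φ : AFml} (t : ATerm) : IsDelta0 φ → IsDelta0 (.all (.imp (.le (.var 0) (ATerm.lift 0 t)) φ))
  | bex {φ : AFml} (t : ATerm) : IsDelta0 φ → IsDelta0 (.ex (.and (.le (.var 0) (ATerm.lift 0 t)) φ))

mutual
  /-- `Σ₁` formulas. -/
  inductive IsSigma1 : AFml → Prop
    | delta0 {φ} : IsDelta0 φ → IsSigma1 φ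
    | and {φ ψ} : IsSigma1 φ → IsSigma1 ψ → IsSigma1 (.and φ ψ)
    | or {φ ψ} : IsSigma1 φ → IsSigma1 ψ → IsSigma1 (.or φ ψ)
    | ex {φ} : IsSigma1 φ → IsSigma1 (.ex φ)
    | negPi {φ} : IsPi1 φ → IsSigma1 (.neg φ)
    | impPiSigma {φ ψ} : IsPi1 φ → IsSigma1 ψ → IsSigma1 (.imp φ ψ)
  /-- `Π₁` formulas. -/
  inductive IsPi1 : AFml → Prop
    | delta0 {φ} : IsDelta0 φ → IsPi1 φ
    | and {φ ψ} : IsPi1 φ → IsPi1 ψ → IsPi1 (.and φ ψ)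
    | or {φ ψ} : IsPi1 φ → IsPi1 ψ → IsPi1 (.or φ ψ)
    | all {φ} : IsPi1 φ → IsPi1 (.all φ)
    | negSigma {φ} : IsSigma1 φ → IsPi1 (.neg φ)
    | impSigmaPi {φ ψ} : IsSigma1 φ → IsPi1 ψ → IsPi1 (.imp φ ψ)
end

/-! ### A Hilbert-style proof system for first-order arithmetic -/

/-- Evaluation of an arithmetical formula under a valuation of its "propositionally atomic"
subformulas (atomic or quantified formulas); used for propositional tautologies and
tautological consequence. -/
def AFml.evalProp (v : AFml → Prop) : AFml → Prop
  | .neg φ => ¬ φ.evalProp v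
  | .and φ ψ => φ.evalProp v ∧ ψ.evalProp v
  | .or φ ψ => φ.evalProp v ∨ ψ.evalProp v
  | .imp φ ψ => φ.evalProp v → ψ.evalProp v
  | φ => v φ

/-- Propositional tautologies in the language of arithmetic. -/
def ATaut (φ : AFml) : Prop := ∀ v, φ.evalProp v

/-- `φ` is a tautological consequence of the set `X` of formulas. -/
def TC (X : Set AFml) (φ : AFml) : Prop :=
  ∀ v : AFml → Prop, (∀ ψ ∈ X, ψ.evalProp v) → φ.evalProp v

def iffF (φ ψ : AFml) : AFml := .and (.imp φ ψ) (.imp ψ φ)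

/-- Hilbert-style provability from the set of axioms `Γ` in classical first-order
logic with equality. -/
inductive Proves (Γ : Set AFml) : AFml → Prop
  | ax {φ} : φ ∈ Γ → Proves Γ φ
  | taut {φ} : ATaut φ → Proves Γ φ
  | mp {φ ψ} : Proves Γ (.imp φ ψ) → Proves Γ φ → Proves Γ ψ
  | allE (φ : AFml) (t : ATerm) : Proves Γ (.imp (.all φ) (φ.subst0 t))
  | exI (φ : AFml) (t : ATerm) : Proves Γ (.imp (φ.subst0 t) (.ex φ))
  | allImp (φ ψ : AFml) : Proves Γ (.imp (.all (.imp φ ψ)) (.imp (.all φ) (.all ψ)))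
  | vacAll (φ : AFml) : Proves Γ (.imp φ (.all (AFml.lift 0 φ)))
  | exDef (φ : AFml) : Proves Γ (iffF (.ex φ) (.neg (.all (.neg φ))))
  | gen {φ} : Proves Γ φ → Proves Γ (.all φ)
  | eqRefl (t : ATerm) : Proves Γ (.eq t t)
  | eqSubst (φ : AFml) (t s : ATerm) : Proves Γ (.imp (.eq t s) (.imp (φ.subst0 t) (φ.subst0 s)))

/-! ### Peano arithmetic -/

/-- The axioms of Peano arithmetic. -/
inductive PAax : AFml → Prop
  | succNeZero : PAax (.all (.neg (.eq (.succ (.var 0)) .zero)))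
  | succInj :
      PAax (.all (.all (.imp (.eq (.succ (.var 1)) (.succ (.var 0))) (.eq (.var 1) (.var 0)))))
  | addZero : PAax (.all (.eq (.add (.var 0) .zero) (.var 0)))
  | addSucc :
      PAax (.all (.all (.eq (.add (.var 1) (.succ (.var 0))) (.succ (.add (.var 1) (.var 0))))))
  | mulZero : PAax (.all (.eq (.mul (.var 0) .zero) .zero))
  | mulSucc :
      PAax (.all (.all (.eq (.mul (.var 1) (.succ (.var 0)))
        (.add (.mul (.var 1) (.var 0)) (.var 1)))))
  | leDef :
      PAax (.all (.all (iffF (.le (.var 1) (.var 0))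
        (.ex (.eq (.add (.var 0) (.var 2)) (.var 1))))))
  | ind (φ : AFml) :
      PAax (.imp (.and (φ.subst0 .zero) (.all (.imp φ (succSubst φ)))) (.all φ))

/-- Peano arithmetic, as a set of axioms. -/
def PA : Set AFml := {φ | PAax φ}

/-- The sentence `0 = 1`. -/
def botFml : AFml := .eq .zero (.succ .zero)

/-- `t < s`, as the formula `S(t) ≤ s`. -/
def ltF (t s : ATerm) : AFml := .le (.succ t) s

/-- `Δ₁(PA)` formulas: `Σ₁` formulas which are `PA`-provably equivalent to a `Π₁` formula. -/
def IsDelta1PA (φ : AFml) : Prop :=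
  IsSigma1 φ ∧ ∃ ψ, IsPi1 ψ ∧ Proves PA (iffF φ ψ)

/-! ### Theories, provability predicates, arithmetical interpretations -/

/-- `Tax` is primitive recursively axiomatized (via the Gödel numbering). -/
def PrAxiomatized (Tax : Set AFml) : Prop :=
  ∃ p : ℕ → Bool, Primrec p ∧ ∀ φ : AFml, φ ∈ Tax ↔ p φ.code = true

/-- `Σ₁`-soundness: every `T`-provable `Σ₁` sentence is true in `ℕ`. -/
def Sigma1Sound (Tax : Set AFml) : Prop :=
  ∀ φ : AFml, IsSigma1 φ → φ.FreeLt 0 → Proves Tax φ → TrueN φ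

/-- `P` is a provability predicate of `T`: a formula `P(x)` with at most the free
variable `x` such that for every formula `φ`, `T ⊢ φ` iff `PA ⊢ P(⌜φ⌝)`. -/
def IsProvPred (Tax : Set AFml) (P : AFml) : Prop :=
  P.FreeLt 1 ∧ ∀ φ : AFml, Proves Tax φ ↔ Proves PA (P.appNum φ)

/-- `f` is an arithmetical interpretation based on the predicate `P`. -/
def IsInterp (P : AFml) (f : MFml → AFml) : Prop :=
  (∀ i, (f (.var i)).FreeLt 0) ∧
  f .bot = botFml ∧
  (∀ A, f (.neg A) = .neg (f A)) ∧
  (∀ A B, f (.and A B) = .and (f A) (f B)) ∧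
  (∀ A B, f (.or A B) = .or (f A) (f B)) ∧
  (∀ A B, f (.imp A B) = .imp (f A) (f B)) ∧
  (∀ A, f (.box A) = P.appNum (f A))

/-- The provability logic of the predicate `P` (relative to the theory `Tax`). -/
def PL (Tax : Set AFml) (P : AFml) : Set MFml :=
  {A | ∀ f : MFml → AFml, IsInterp P f → Proves Tax (f A)}

/-- The formulas with a `T`-proof of code `≤ s` (relative to a proof enumeration `prf`). -/
def PTset (prf : ℕ → Option AFml) (s : ℕ) : Set AFml :=
  {φ | ∃ y ≤ s, prf y = some φ}


/-! ## Substitution -/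

def shiftFrom (c : ℕ) : ℕ → ATerm := fun n => .var (if n < c then n else n + 1)

theorem ATerm.lift_eq (c : ℕ) (t : ATerm) : t.lift c = t.substAll (shiftFrom c) := by
  induction t <;> simp_all [ATerm.lift, ATerm.substAll, shiftFrom]

theorem liftSub_shiftFrom (c : ℕ) : liftSub (shiftFrom c) = shiftFrom (c + 1) := by
  funext n
  cases n with
  | zero => simp [liftSub, shiftFrom]
  | succ n =>
    simp only [liftSub, shiftFrom, ATerm.lift]
    split_ifs <;> first | omega | simp_all

theorem AFml.lift_eq (φ : AFml) : ∀ c : ℕ, φ.lift c = φ.substAll (shiftFrom c) := by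
  induction φ <;> intro c <;>
    simp_all [AFml.lift, AFml.substAll, ATerm.lift_eq, liftSub_shiftFrom]

theorem ATerm.lift_liftSub (τ : ℕ → ATerm) (t : ATerm) :
    (t.lift 0).substAll (liftSub τ) = (t.substAll τ).lift 0 := by
  induction t <;> simp_all [ATerm.lift, ATerm.substAll, liftSub]

theorem ATerm.substAll_comp (σ τ : ℕ → ATerm) (t : ATerm) :
    (t.substAll σ).substAll τ = t.substAll (fun n => (σ n).substAll τ) := by
  induction t <;> simp_all [ATerm.substAll]

theorem liftSub_comp (σ τ : ℕ → ATerm) :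
    (fun n => (liftSub σ n).substAll (liftSub τ)) = liftSub (fun n => (σ n).substAll τ) := by
  funext n
  cases n with
  | zero => simp [liftSub, ATerm.substAll]
  | succ n => simp [liftSub, ATerm.lift_liftSub]

theorem AFml.substAll_comp (φ : AFml) : ∀ σ τ : ℕ → ATerm,
    (φ.substAll σ).substAll τ = φ.substAll (fun n => (σ n).substAll τ) := by
  induction φ <;> intro σ τ <;>
    simp_all [AFml.substAll, ATerm.substAll_comp, liftSub_comp]

theorem ATerm.substAll_var (t : ATerm) : t.substAll ATerm.var = t := by
  induction t <;> simp_all [ATerm.substAll]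

theorem liftSub_var : liftSub ATerm.var = ATerm.var := by
  funext n; cases n <;> simp [liftSub, ATerm.lift]

theorem AFml.substAll_var (φ : AFml) : φ.substAll ATerm.var = φ := by
  induction φ <;> simp_all [AFml.substAll, ATerm.substAll_var, liftSub_var]

theorem ATerm.substAll_congr {c : ℕ} {σ τ : ℕ → ATerm} (h : ∀ n < c, σ n = τ n) (t : ATerm)
    (ht : t.FreeLt c) : t.substAll σ = t.substAll τ := by
  induction t <;> simp_all [ATerm.substAll, ATerm.FreeLt]

theorem liftSub_congr {c : ℕ} {σ τ : ℕ → ATerm} (h : ∀ n < c, σ n = τ n) :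
    ∀ n < c + 1, liftSub σ n = liftSub τ n := by
  intro n hn
  cases n with
  | zero => rfl
  | succ n => simp [liftSub, h n (by omega)]

theorem AFml.substAll_congr (φ : AFml) : ∀ {c : ℕ} {σ τ : ℕ → ATerm}, (∀ n < c, σ n = τ n) →
    φ.FreeLt c → φ.substAll σ = φ.substAll τ := by
  induction φ with
  | eq t s => intro c σ τ h hf; simp [AFml.substAll, ATerm.substAll_congr h _ hf.1, ATerm.substAll_congr h _ hf.2]
  | le t s => intro c σ τ h hf; simp [AFml.substAll, ATerm.substAll_congr h _ hf.1, ATerm.substAll_congr h _ hf.2]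
  | neg φ ih => intro c σ τ h hf; simp [AFml.substAll, ih h hf]
  | and φ ψ ih1 ih2 => intro c σ τ h hf; simp [AFml.substAll, ih1 h hf.1, ih2 h hf.2]
  | or φ ψ ih1 ih2 => intro c σ τ h hf; simp [AFml.substAll, ih1 h hf.1, ih2 h hf.2]
  | imp φ ψ ih1 ih2 => intro c σ τ h hf; simp [AFml.substAll, ih1 h hf.1, ih2 h hf.2]
  | all φ ih => intro c σ τ h hf; simp [AFml.substAll, ih (liftSub_congr h) hf]
  | ex φ ih => intro c σ τ h hf; simp [AFml.substAll, ih (liftSub_congr h) hf]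

theorem AFml.substAll_sentence {φ : AFml} (h : φ.FreeLt 0) (σ : ℕ → ATerm) :
    φ.substAll σ = φ := by
  rw [φ.substAll_congr (c := 0) (τ := ATerm.var) (by simp) h, AFml.substAll_var]

theorem ATerm.FreeLt_mono {c d : ℕ} (h : c ≤ d) (t : ATerm) (ht : t.FreeLt c) : t.FreeLt d := by
  induction t with
  | var n => exact lt_of_lt_of_le ht h
  | zero => trivial
  | succ t ih => exact ih ht
  | add t s ih1 ih2 => exact ⟨ih1 ht.1, ih2 ht.2⟩
  | mul t s ih1 ih2 => exact ⟨ih1 ht.1, ih2 ht.2⟩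

theorem AFml.FreeLt_mono (φ : AFml) : ∀ {c d : ℕ}, c ≤ d → φ.FreeLt c → φ.FreeLt d := by
  induction φ with
  | eq t s => intro c d h hf; exact ⟨ATerm.FreeLt_mono h _ hf.1, ATerm.FreeLt_mono h _ hf.2⟩
  | le t s => intro c d h hf; exact ⟨ATerm.FreeLt_mono h _ hf.1, ATerm.FreeLt_mono h _ hf.2⟩
  | neg φ ih => intro c d h hf; exact ih h hf
  | and φ ψ ih1 ih2 => intro c d h hf; exact ⟨ih1 h hf.1, ih2 h hf.2⟩
  | or φ ψ ih1 ih2 => intro c d h hf; exact ⟨ih1 h hf.1, ih2 h hf.2⟩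
  | imp φ ψ ih1 ih2 => intro c d h hf; exact ⟨ih1 h hf.1, ih2 h hf.2⟩
  | all φ ih => intro c d h hf; exact ih (Nat.succ_le_succ h) hf
  | ex φ ih => intro c d h hf; exact ih (Nat.succ_le_succ h) hf

theorem ATerm.exists_FreeLt (t : ATerm) : ∃ c, t.FreeLt c := by
  induction t with
  | var n => exact ⟨n + 1, Nat.lt_succ_self n⟩
  | zero => exact ⟨0, trivial⟩
  | succ t ih => exact ih
  | add t s ih1 ih2 =>
    obtain ⟨a, ha⟩ := ih1; obtain ⟨b, hb⟩ := ih2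
    exact ⟨max a b, ATerm.FreeLt_mono (le_max_left _ _) _ ha, ATerm.FreeLt_mono (le_max_right _ _) _ hb⟩
  | mul t s ih1 ih2 =>
    obtain ⟨a, ha⟩ := ih1; obtain ⟨b, hb⟩ := ih2
    exact ⟨max a b, ATerm.FreeLt_mono (le_max_left _ _) _ ha, ATerm.FreeLt_mono (le_max_right _ _) _ hb⟩

theorem AFml.exists_FreeLt (φ : AFml) : ∃ c, φ.FreeLt c := by
  have two : ∀ φ ψ : AFml, (∃ c, φ.FreeLt c) → (∃ c, ψ.FreeLt c) → ∃ c, φ.FreeLt c ∧ ψ.FreeLt c := by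
    rintro φ ψ ⟨a, ha⟩ ⟨b, hb⟩
    exact ⟨max a b, AFml.FreeLt_mono _ (le_max_left _ _) ha, AFml.FreeLt_mono _ (le_max_right _ _) hb⟩
  have twoT : ∀ t s : ATerm, ∃ c, t.FreeLt c ∧ s.FreeLt c := by
    intro t s
    obtain ⟨a, ha⟩ := t.exists_FreeLt; obtain ⟨b, hb⟩ := s.exists_FreeLt
    exact ⟨max a b, ATerm.FreeLt_mono (le_max_left _ _) _ ha, ATerm.FreeLt_mono (le_max_right _ _) _ hb⟩
  induction φ with
  | eq t s => exact twoT t s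
  | le t s => exact twoT t s
  | neg φ ih => exact ih
  | and φ ψ ih1 ih2 => exact two _ _ ih1 ih2
  | or φ ψ ih1 ih2 => exact two _ _ ih1 ih2
  | imp φ ψ ih1 ih2 => exact two _ _ ih1 ih2
  | all φ ih => obtain ⟨c, hc⟩ := ih; exact ⟨c, AFml.FreeLt_mono φ (Nat.le_succ c) hc⟩
  | ex φ ih => obtain ⟨c, hc⟩ := ih; exact ⟨c, AFml.FreeLt_mono φ (Nat.le_succ c) hc⟩

theorem ATerm.FreeLt_substAll {c d : ℕ} {σ : ℕ → ATerm} (h : ∀ n < c, (σ n).FreeLt d) (t : ATerm)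
    (ht : t.FreeLt c) : (t.substAll σ).FreeLt d := by
  induction t with
  | var n => exact h n ht
  | zero => trivial
  | succ t ih => exact ih ht
  | add t s ih1 ih2 => exact ⟨ih1 ht.1, ih2 ht.2⟩
  | mul t s ih1 ih2 => exact ⟨ih1 ht.1, ih2 ht.2⟩

theorem liftSub_FreeLt {c d : ℕ} {σ : ℕ → ATerm} (h : ∀ n < c, (σ n).FreeLt d) :
    ∀ n < c + 1, (liftSub σ n).FreeLt (d + 1) := by
  intro n hn
  cases n with
  | zero => exact Nat.succ_pos d
  | succ n =>
    simp only [liftSub, ATerm.lift_eq]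
    refine ATerm.FreeLt_substAll (c := d) ?_ _ (h n (by omega))
    intro k hk
    simpa [shiftFrom, ATerm.FreeLt] using hk

theorem AFml.FreeLt_substAll (φ : AFml) : ∀ {c d : ℕ} {σ : ℕ → ATerm}, (∀ n < c, (σ n).FreeLt d) →
    φ.FreeLt c → (φ.substAll σ).FreeLt d := by
  induction φ with
  | eq t s => intro c d σ h hf; exact ⟨ATerm.FreeLt_substAll h _ hf.1, ATerm.FreeLt_substAll h _ hf.2⟩
  | le t s => intro c d σ h hf; exact ⟨ATerm.FreeLt_substAll h _ hf.1, ATerm.FreeLt_substAll h _ hf.2⟩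
  | neg φ ih => intro c d σ h hf; exact ih h hf
  | and φ ψ ih1 ih2 => intro c d σ h hf; exact ⟨ih1 h hf.1, ih2 h hf.2⟩
  | or φ ψ ih1 ih2 => intro c d σ h hf; exact ⟨ih1 h hf.1, ih2 h hf.2⟩
  | imp φ ψ ih1 ih2 => intro c d σ h hf; exact ⟨ih1 h hf.1, ih2 h hf.2⟩
  | all φ ih => intro c d σ h hf; exact ih (liftSub_FreeLt h) hf
  | ex φ ih => intro c d σ h hf; exact ih (liftSub_FreeLt h) hf

/-- substitution cons -/
def scons (t : ATerm) (σ : ℕ → ATerm) : ℕ → ATerm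
  | 0 => t
  | n + 1 => σ n

theorem ATerm.lift_scons (t u : ATerm) (τ : ℕ → ATerm) :
    (t.lift 0).substAll (scons u τ) = t.substAll τ := by
  induction t <;> simp_all [ATerm.lift, ATerm.substAll, scons]

theorem liftSub_subst0 (σ : ℕ → ATerm) (t : ATerm) (φ : AFml) :
    (φ.substAll (liftSub σ)).subst0 t = φ.substAll (scons t σ) := by
  unfold AFml.subst0
  rw [AFml.substAll_comp]
  congr 1
  funext n
  cases n with
  | zero => simp [liftSub, scons, ATerm.substAll, subst0Env]
  | succ n =>
    have : subst0Env t = scons t ATerm.var := by funext k; cases k <;> rfl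
    simp [liftSub, this, ATerm.lift_scons, ATerm.substAll_var]
    rfl

theorem subst0_substAll (σ : ℕ → ATerm) (t : ATerm) (φ : AFml) :
    (φ.subst0 t).substAll σ = φ.substAll (scons (t.substAll σ) σ) := by
  unfold AFml.subst0
  rw [AFml.substAll_comp]
  congr 1
  funext n
  cases n <;> rfl

theorem lift_liftSub (σ : ℕ → ATerm) (φ : AFml) :
    (φ.lift 0).substAll (liftSub σ) = (φ.substAll σ).lift 0 := by
  rw [AFml.lift_eq, AFml.lift_eq, AFml.substAll_comp, AFml.substAll_comp]
  congr 1
  funext n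
  simp [shiftFrom, ATerm.substAll, liftSub, ATerm.lift_eq]

/-! ## Derived provability -/

theorem evalProp_substAll (v : AFml → Prop) (σ : ℕ → ATerm) (φ : AFml) :
    (φ.substAll σ).evalProp v = φ.evalProp (fun ψ => (ψ.substAll σ).evalProp v) := by
  induction φ <;> simp_all [AFml.substAll, AFml.evalProp]

theorem Proves.tc1 {Γ : Set AFml} {φ ψ : AFml} (h : Proves Γ φ)
    (t : ∀ v, φ.evalProp v → ψ.evalProp v) : Proves Γ ψ :=
  .mp (.taut (φ := .imp φ ψ) t) h

theorem Proves.tc2 {Γ : Set AFml} {φ ψ χ : AFml} (h : Proves Γ φ) (h' : Proves Γ ψ)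
    (t : ∀ v, φ.evalProp v → ψ.evalProp v → χ.evalProp v) : Proves Γ χ :=
  .mp (.mp (.taut (φ := .imp φ (.imp ψ χ)) t) h) h'

def allN : ℕ → AFml → AFml
  | 0, φ => φ
  | k + 1, φ => .all (allN k φ)

theorem allN_FreeLt (φ : AFml) (k : ℕ) : ∀ c, φ.FreeLt (c + k) → (allN k φ).FreeLt c := by
  induction k with
  | zero => intro c h; exact h
  | succ k ih => intro c h; exact ih (c + 1) (by rw [show c + 1 + k = c + (k + 1) by omega]; exact h)

theorem Proves.allN {Γ : Set AFml} {φ : AFml} (h : Proves Γ φ) (k : ℕ) : Proves Γ (allN k φ) := by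
  induction k with
  | zero => exact h
  | succ k ih => exact .gen ih

theorem Proves.instN {Γ : Set AFml} {φ : AFml} (σ : ℕ → ATerm) (k : ℕ)
    (h : Proves Γ ((PLN.allN k φ).substAll (fun n => σ (n + k)))) : Proves Γ (φ.substAll σ) := by
  induction k with
  | zero => exact h
  | succ k ih =>
    apply ih
    have h2 := Proves.mp (Proves.allE _ (σ k)) h
    rw [liftSub_subst0] at h2
    convert h2 using 2
    funext n
    cases n with
    | zero => simp [scons]
    | succ n => simp [scons]; congr 1; omega

theorem Proves.ax_subst {Γ : Set AFml} {φ : AFml} (h : Proves Γ φ) (σ : ℕ → ATerm) :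
    Proves Γ (φ.substAll σ) := by
  obtain ⟨c, hc⟩ := φ.exists_FreeLt
  apply Proves.instN σ c
  rw [AFml.substAll_sentence (allN_FreeLt φ c 0 (by simpa using hc))]
  exact h.allN c


/-! ## Structures and soundness -/

structure PStr (M : Type) where
  zero : M
  succ : M → M
  add : M → M → M
  mul : M → M → M
  le : M → M → Prop

def mcons {M : Type} (a : M) (ρ : ℕ → M) : ℕ → M
  | 0 => a
  | n + 1 => ρ n

def ATerm.ev {M : Type} (S : PStr M) (ρ : ℕ → M) : ATerm → M
  | .var n => ρ n
  | .zero => S.zero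
  | .succ t => S.succ (t.ev S ρ)
  | .add t s => S.add (t.ev S ρ) (s.ev S ρ)
  | .mul t s => S.mul (t.ev S ρ) (s.ev S ρ)

def AFml.Ev {M : Type} (S : PStr M) (ρ : ℕ → M) : AFml → Prop
  | .eq t s => t.ev S ρ = s.ev S ρ
  | .le t s => S.le (t.ev S ρ) (s.ev S ρ)
  | .neg φ => ¬ φ.Ev S ρ
  | .and φ ψ => φ.Ev S ρ ∧ ψ.Ev S ρ
  | .or φ ψ => φ.Ev S ρ ∨ ψ.Ev S ρ
  | .imp φ ψ => φ.Ev S ρ → ψ.Ev S ρ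
  | .all φ => ∀ a, φ.Ev S (mcons a ρ)
  | .ex φ => ∃ a, φ.Ev S (mcons a ρ)

def natStr : PStr ℕ := ⟨0, Nat.succ, (· + ·), (· * ·), (· ≤ ·)⟩

theorem ATerm.ev_nat (ρ : ℕ → ℕ) (t : ATerm) : t.ev natStr ρ = t.val ρ := by
  induction t <;> simp_all [ATerm.ev, ATerm.val, natStr]

theorem mcons_nat (a : ℕ) (ρ : ℕ → ℕ) : mcons a ρ = consEnv a ρ := by
  funext n; cases n <;> rfl

theorem AFml.Ev_nat (φ : AFml) : ∀ ρ : ℕ → ℕ, φ.Ev natStr ρ ↔ φ.Sat ρ := by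
  induction φ <;> intro ρ <;> simp_all [AFml.Ev, AFml.Sat, ATerm.ev_nat, mcons_nat]
  rfl

section
variable {M : Type} (S : PStr M)

theorem ATerm.ev_substAll (σ : ℕ → ATerm) (ρ : ℕ → M) (t : ATerm) :
    (t.substAll σ).ev S ρ = t.ev S (fun n => (σ n).ev S ρ) := by
  induction t <;> simp_all [ATerm.ev, ATerm.substAll]

theorem ATerm.ev_lift (a : M) (ρ : ℕ → M) (t : ATerm) :
    (t.lift 0).ev S (mcons a ρ) = t.ev S ρ := by
  induction t <;> simp_all [ATerm.ev, ATerm.lift, mcons]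

theorem ev_liftSub (a : M) (σ : ℕ → ATerm) (ρ : ℕ → M) :
    (fun n => (liftSub σ n).ev S (mcons a ρ)) = mcons a (fun n => (σ n).ev S ρ) := by
  funext n
  cases n with
  | zero => rfl
  | succ n => simp [liftSub, ATerm.ev_lift, mcons]

theorem AFml.Ev_substAll (φ : AFml) : ∀ (σ : ℕ → ATerm) (ρ : ℕ → M),
    (φ.substAll σ).Ev S ρ ↔ φ.Ev S (fun n => (σ n).ev S ρ) := by
  induction φ <;> intro σ ρ <;>
    simp_all [AFml.Ev, AFml.substAll, ATerm.ev_substAll, ev_liftSub]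

theorem AFml.Ev_subst0 (φ : AFml) (t : ATerm) (ρ : ℕ → M) :
    (φ.subst0 t).Ev S ρ ↔ φ.Ev S (mcons (t.ev S ρ) ρ) := by
  unfold AFml.subst0
  rw [AFml.Ev_substAll]
  have : (fun n => (subst0Env t n).ev S ρ) = mcons (t.ev S ρ) ρ := by
    funext n; cases n <;> rfl
  rw [this]

theorem AFml.Ev_lift (φ : AFml) (a : M) (ρ : ℕ → M) :
    (φ.lift 0).Ev S (mcons a ρ) ↔ φ.Ev S ρ := by
  rw [AFml.lift_eq, AFml.Ev_substAll]
  rfl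

theorem ATerm.ev_congr {c : ℕ} {ρ ρ' : ℕ → M} (h : ∀ n < c, ρ n = ρ' n) (t : ATerm)
    (ht : t.FreeLt c) : t.ev S ρ = t.ev S ρ' := by
  induction t <;> simp_all [ATerm.ev, ATerm.FreeLt]

theorem mcons_congr {c : ℕ} {ρ ρ' : ℕ → M} (h : ∀ n < c, ρ n = ρ' n) (a : M) :
    ∀ n < c + 1, mcons a ρ n = mcons a ρ' n := by
  intro n hn
  cases n with
  | zero => rfl
  | succ n => exact h n (by omega)

theorem AFml.Ev_congr (φ : AFml) : ∀ {c : ℕ} {ρ ρ' : ℕ → M}, (∀ n < c, ρ n = ρ' n) →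
    φ.FreeLt c → (φ.Ev S ρ ↔ φ.Ev S ρ') := by
  induction φ with
  | eq t s => intro c ρ ρ' h hf; simp [AFml.Ev, ATerm.ev_congr S h _ hf.1, ATerm.ev_congr S h _ hf.2]
  | le t s => intro c ρ ρ' h hf; simp [AFml.Ev, ATerm.ev_congr S h _ hf.1, ATerm.ev_congr S h _ hf.2]
  | neg φ ih => intro c ρ ρ' h hf; simp [AFml.Ev, ih h hf]
  | and φ ψ ih1 ih2 => intro c ρ ρ' h hf; simp [AFml.Ev, ih1 h hf.1, ih2 h hf.2]
  | or φ ψ ih1 ih2 => intro c ρ ρ' h hf; simp [AFml.Ev, ih1 h hf.1, ih2 h hf.2]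
  | imp φ ψ ih1 ih2 => intro c ρ ρ' h hf; simp [AFml.Ev, ih1 h hf.1, ih2 h hf.2]
  | all φ ih => intro c ρ ρ' h hf; exact forall_congr' fun a => ih (mcons_congr h a) hf
  | ex φ ih => intro c ρ ρ' h hf; exact exists_congr fun a => ih (mcons_congr h a) hf

theorem AFml.Ev_sentence {φ : AFml} (h : φ.FreeLt 0) (ρ ρ' : ℕ → M) :
    φ.Ev S ρ ↔ φ.Ev S ρ' := φ.Ev_congr S (c := 0) (by simp) h

theorem evalProp_Ev (ρ : ℕ → M) (φ : AFml) :
    φ.evalProp (fun ψ => ψ.Ev S ρ) ↔ φ.Ev S ρ := by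
  induction φ <;> simp_all [AFml.evalProp, AFml.Ev]

/-- `S` is a model of the set of (universally closed) axioms `Γ`. -/
def Models (Γ : Set AFml) : Prop := ∀ φ ∈ Γ, ∀ ρ : ℕ → M, φ.Ev S ρ

variable {S}

theorem Models.sound {Γ : Set AFml} (hS : Models S Γ) {φ : AFml} (h : Proves Γ φ) :
    ∀ ρ : ℕ → M, φ.Ev S ρ := by
  induction h with
  | ax h => exact hS _ h
  | taut h => intro ρ; exact (evalProp_Ev S ρ _).1 (h _)
  | mp _ _ ih1 ih2 => intro ρ; exact ih1 ρ (ih2 ρ)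
  | allE φ t => intro ρ h; exact (φ.Ev_subst0 S t ρ).2 (h _)
  | exI φ t => intro ρ h; exact ⟨_, (φ.Ev_subst0 S t ρ).1 h⟩
  | allImp φ ψ => intro ρ h h' a; exact h a (h' a)
  | vacAll φ => intro ρ h a; exact (φ.Ev_lift S a ρ).2 h
  | exDef φ => intro ρ; simp [iffF, AFml.Ev]
  | gen _ ih => intro ρ a; exact ih _
  | eqRefl t => intro ρ; rfl
  | eqSubst φ t s =>
    intro ρ h h'
    rw [AFml.Ev_subst0] at *
    rw [AFml.Ev] at h
    rwa [← h]

end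

/-! ## Codes -/

theorem ATerm.code_inj : ∀ t s : ATerm, t.code = s.code → t = s := by
  intro t
  induction t with
  | var n => intro s h; cases s <;> simp_all [ATerm.code, Nat.pair_eq_pair]
  | zero => intro s h; cases s <;> simp_all [ATerm.code, Nat.pair_eq_pair]
  | succ t ih => intro s h; cases s <;> simp [ATerm.code, Nat.pair_eq_pair] at h ⊢; exact ih _ h
  | add t s ih1 ih2 =>
    intro s h; cases s <;> simp [ATerm.code, Nat.pair_eq_pair] at h ⊢; exact ⟨ih1 _ h.1, ih2 _ h.2⟩
  | mul t s ih1 ih2 =>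
    intro s h; cases s <;> simp [ATerm.code, Nat.pair_eq_pair] at h ⊢; exact ⟨ih1 _ h.1, ih2 _ h.2⟩

theorem AFml.code_inj : ∀ t s : AFml, t.code = s.code → t = s := by
  intro t
  induction t with
  | eq t s =>
    intro s h; cases s <;> simp [AFml.code, Nat.pair_eq_pair] at h ⊢
    exact ⟨ATerm.code_inj _ _ h.1, ATerm.code_inj _ _ h.2⟩
  | le t s =>
    intro s h; cases s <;> simp [AFml.code, Nat.pair_eq_pair] at h ⊢
    exact ⟨ATerm.code_inj _ _ h.1, ATerm.code_inj _ _ h.2⟩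
  | neg t ih => intro s h; cases s <;> simp [AFml.code, Nat.pair_eq_pair] at h ⊢; exact ih _ h
  | all t ih => intro s h; cases s <;> simp [AFml.code, Nat.pair_eq_pair] at h ⊢; exact ih _ h
  | ex t ih => intro s h; cases s <;> simp [AFml.code, Nat.pair_eq_pair] at h ⊢; exact ih _ h
  | and t s ih1 ih2 =>
    intro s h; cases s <;> simp [AFml.code, Nat.pair_eq_pair] at h ⊢; exact ⟨ih1 _ h.1, ih2 _ h.2⟩
  | or t s ih1 ih2 =>
    intro s h; cases s <;> simp [AFml.code, Nat.pair_eq_pair] at h ⊢; exact ⟨ih1 _ h.1, ih2 _ h.2⟩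
  | imp t s ih1 ih2 =>
    intro s h; cases s <;> simp [AFml.code, Nat.pair_eq_pair] at h ⊢; exact ⟨ih1 _ h.1, ih2 _ h.2⟩

theorem exists_enum : ∃ e : ℕ → AFml, ∀ φ, ∃ k, e k = φ := by
  classical
  refine ⟨fun k => if h : ∃ φ : AFml, φ.code = k then h.choose else botFml, fun φ => ⟨φ.code, ?_⟩⟩
  have h : ∃ ψ : AFml, ψ.code = φ.code := ⟨φ, rfl⟩
  simp only [h, dif_pos]
  exact AFml.code_inj _ _ h.choose_spec

/-! ## Completeness -/

section
variable {Γ : Set AFml}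

theorem step_exists (θ χ : AFml) (hθ : ¬ Proves Γ (.neg θ)) :
    ∃ θ', ¬ Proves Γ (.neg θ') ∧ Proves Γ (.imp θ' θ) ∧
      (Proves Γ (.imp θ' χ) ∨ Proves Γ (.imp θ' (.neg χ))) ∧
      (∀ ψ, χ = .ex ψ → Proves Γ (.imp θ' χ) → ∃ t, Proves Γ (.imp θ' (ψ.subst0 t))) := by
  by_cases h : Proves Γ (.neg (.and θ χ))
  · refine ⟨θ, hθ, .taut fun v => id, Or.inr (h.tc1 fun v => ?_), ?_⟩
    · simp [AFml.evalProp]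
    · intro ψ _ h2
      exact absurd (h.tc2 h2 fun v => by simp only [AFml.evalProp]; tauto) hθ
  · by_cases hex : ∃ ψ, χ = .ex ψ
    · obtain ⟨ψ, rfl⟩ := hex
      obtain ⟨c1, hc1⟩ := θ.exists_FreeLt
      obtain ⟨c2, hc2⟩ := ψ.exists_FreeLt
      set N := max c1 c2 with hN
      have hθN := AFml.FreeLt_mono _ (le_max_left c1 c2) hc1
      have hψN := AFml.FreeLt_mono _ (le_max_right c1 c2) hc2
      refine ⟨.and (.and θ (.ex ψ)) (ψ.subst0 (.var N)), ?_, .taut fun v => ?_,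
        Or.inl (.taut fun v => ?_), ?_⟩
      · intro hbad
        apply h
        have h1 := hbad.ax_subst (fun n => if n = N then .var 0 else .var (n + 1))
        have e1 : (AFml.and θ (.ex ψ)).substAll (fun n => if n = N then .var 0 else .var (n + 1))
            = (AFml.and θ (.ex ψ)).lift 0 := by
          rw [AFml.lift_eq]
          refine AFml.substAll_congr _ (c := N) ?_ ⟨hθN, AFml.FreeLt_mono ψ (Nat.le_succ _) hψN⟩
          intro n hn
          simp [shiftFrom, hn.ne]
        have e2 : (ψ.subst0 (.var N)).substAll (fun n => if n = N then .var 0 else .var (n + 1))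
            = ψ := by
          rw [subst0_substAll]
          conv_rhs => rw [← ψ.substAll_var]
          refine AFml.substAll_congr _ (c := N) ?_ hψN
          intro n hn
          cases n with
          | zero => simp [scons, ATerm.substAll]
          | succ n => simp [scons, show n ≠ N by omega]
        simp only [AFml.substAll] at h1 e1
        rw [e2, e1] at h1
        have h2 : Proves Γ (.imp ((AFml.and θ (.ex ψ)).lift 0) (.neg ψ)) :=
          h1.tc1 fun v => by simp only [AFml.evalProp]; tauto
        have h3 := Proves.mp (.allImp _ _) h2.gen
        have h4 := Proves.vacAll (Γ := Γ) (AFml.and θ (.ex ψ))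
        have h5 : Proves Γ (.imp (AFml.and θ (.ex ψ)) (.all (.neg ψ))) :=
          h3.tc2 h4 fun v => by simp only [AFml.evalProp]; tauto
        exact h5.tc2 (.exDef ψ) fun v => by simp only [AFml.evalProp, iffF]; tauto
      · simp only [AFml.evalProp]; tauto
      · simp only [AFml.evalProp]; tauto
      · intro ψ' e _
        cases e
        exact ⟨.var N, .taut fun v => by simp only [AFml.evalProp]; tauto⟩
    · refine ⟨.and θ χ, h, .taut fun v => ?_, Or.inl (.taut fun v => ?_), ?_⟩
      · simp only [AFml.evalProp]; tauto
      · simp only [AFml.evalProp]; tauto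
      · intro ψ e; exact absurd ⟨ψ, e⟩ hex

theorem exists_henkin (θ : AFml) (hθ : ¬ Proves Γ (.neg θ)) :
    ∃ H : AFml → Prop, H θ ∧ (∀ φ, Proves Γ φ → H φ) ∧ (∀ φ ψ, H (.imp φ ψ) → H φ → H ψ) ∧
      (∀ φ, H φ ∨ H (.neg φ)) ∧ (∀ φ, ¬ (H φ ∧ H (.neg φ))) ∧
      (∀ ψ, H (.ex ψ) → ∃ t, H (ψ.subst0 t)) := by
  obtain ⟨e, he⟩ := exists_enum
  choose! f hf1 hf2 hf3 hf4 using fun θ : AFml => fun χ => step_exists (Γ := Γ) θ χ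
  let s : ℕ → AFml := fun k => Nat.rec θ (fun k x => f x (e k)) k
  have hs0 : s 0 = θ := rfl
  have hss : ∀ k, s (k + 1) = f (s k) (e k) := fun k => rfl
  have hc : ∀ k, ¬ Proves Γ (.neg (s k)) := by
    intro k
    induction k with
    | zero => exact hθ
    | succ k ih => exact hf1 _ _ ih
  have hmono : ∀ k j, Proves Γ (.imp (s (k + j)) (s k)) := by
    intro k j
    induction j with
    | zero => exact .taut fun v => id
    | succ j ih =>
      have := hf2 (s (k + j)) (e (k + j)) (hc _)
      rw [← hss] at this
      exact this.tc2 ih fun v => by simp only [AFml.evalProp]; tauto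
  have hmono' : ∀ {k l φ}, k ≤ l → Proves Γ (.imp (s k) φ) → Proves Γ (.imp (s l) φ) := by
    intro k l φ hkl h
    obtain ⟨j, rfl⟩ := Nat.exists_eq_add_of_le hkl
    exact h.tc2 (hmono k j) fun v => by simp only [AFml.evalProp]; tauto
  refine ⟨fun φ => ∃ k, Proves Γ (.imp (s k) φ), ⟨0, .taut fun v => id⟩, ?_, ?_, ?_, ?_, ?_⟩
  · intro φ h; exact ⟨0, h.tc1 fun v => by simp only [AFml.evalProp]; tauto⟩
  · rintro φ ψ ⟨k, hk⟩ ⟨l, hl⟩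
    exact ⟨max k l, (hmono' (le_max_left k l) hk).tc2 (hmono' (le_max_right k l) hl)
      fun v => by simp only [AFml.evalProp]; tauto⟩
  · intro φ
    obtain ⟨k, rfl⟩ := he φ
    rcases hf3 (s k) (e k) (hc k) with h | h
    · exact Or.inl ⟨k + 1, h⟩
    · exact Or.inr ⟨k + 1, h⟩
  · rintro φ ⟨⟨k, hk⟩, ⟨l, hl⟩⟩
    exact hc (max k l) ((hmono' (le_max_left k l) hk).tc2 (hmono' (le_max_right k l) hl)
      fun v => by simp only [AFml.evalProp]; tauto)
  · rintro ψ ⟨l, hl⟩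
    obtain ⟨k, hk⟩ := he (.ex ψ)
    have h1 : Proves Γ (.imp (s (k + 1)) (.ex ψ)) := by
      rcases hf3 (s k) (e k) (hc k) with h | h
      · rw [← hss, hk] at h; exact h
      · rw [← hss, hk] at h
        exact absurd ((hmono' (le_max_left (k + 1) l) h).tc2 (hmono' (le_max_right (k + 1) l) hl)
          fun v => by simp only [AFml.evalProp]; tauto) (hc (max (k + 1) l))
    obtain ⟨t, ht⟩ := hf4 (s k) (e k) (hc k) ψ hk (by rw [← hss, hk]; exact h1)
    exact ⟨t, k + 1, ht⟩

theorem scons_subst0 (φ : AFml) (σ : ℕ → ATerm) (t : ATerm) :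
    (φ.substAll (liftSub σ)).subst0 t = φ.substAll (scons t σ) := liftSub_subst0 σ t φ

theorem completeness_aux (θ : AFml) (hθ : ¬ Proves Γ (.neg θ)) :
    ∃ (M : Type) (S : PStr M), Models S Γ ∧ ∃ ρ, θ.Ev S ρ := by
  obtain ⟨H, H0, HP, HM, HC, HN, HE⟩ := exists_henkin θ hθ
  have hneg : ∀ φ, H (.neg φ) ↔ ¬ H φ := fun φ =>
    ⟨fun h h' => HN φ ⟨h', h⟩, fun h => (HC φ).resolve_left h⟩
  have t1 : ∀ {φ ψ}, (∀ v, φ.evalProp v → ψ.evalProp v) → H φ → H ψ := fun h h1 =>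
    HM _ _ (HP _ (.taut (φ := .imp _ _) h)) h1
  have t2 : ∀ {φ ψ χ : AFml}, (∀ v, φ.evalProp v → ψ.evalProp v → χ.evalProp v) →
      H φ → H ψ → H χ := fun h h1 h2 =>
    HM _ _ (HM _ _ (HP _ (.taut (φ := .imp _ (.imp _ _)) h)) h1) h2
  have sub : ∀ (φ : AFml) (t s : ATerm), H (.eq t s) → H (φ.subst0 t) → H (φ.subst0 s) :=
    fun φ t s h1 h2 => HM _ _ (HM _ _ (HP _ (.eqSubst φ t s)) h1) h2
  have l0 : ∀ t s : ATerm, (t.lift 0).substAll (subst0Env s) = t := by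
    intro t s
    have : subst0Env s = scons s ATerm.var := by funext k; cases k <;> rfl
    rw [this, ATerm.lift_scons, ATerm.substAll_var]
  have hrefl : ∀ t, H (.eq t t) := fun t => HP _ (.eqRefl t)
  have hsymm : ∀ t s, H (.eq t s) → H (.eq s t) := by
    intro t s h
    have := sub (.eq (.var 0) (t.lift 0)) t s h
    simp only [AFml.subst0, AFml.substAll, l0, ATerm.substAll, subst0Env] at this
    exact this (hrefl t)
  have htrans : ∀ t s u, H (.eq t s) → H (.eq s u) → H (.eq t u) := by
    intro t s u h1 h2
    have := sub (.eq (t.lift 0) (.var 0)) s u h2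
    simp only [AFml.subst0, AFml.substAll, l0, ATerm.substAll, subst0Env] at this
    exact this h1
  let st : Setoid ATerm := ⟨fun t s => H (.eq t s), hrefl, fun {a b} => hsymm a b, fun {a b c} => htrans a b c⟩
  have csucc : ∀ t s, H (.eq t s) → H (.eq (.succ t) (.succ s)) := by
    intro t s h
    have := sub (.eq (.succ (t.lift 0)) (.succ (.var 0))) t s h
    simp only [AFml.subst0, AFml.substAll, l0, ATerm.substAll, subst0Env] at this
    exact this (hrefl _)
  have cadd : ∀ t t' s s', H (.eq t s) → H (.eq t' s') → H (.eq (.add t t') (.add s s')) := by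
    intro t t' s s' h h'
    have := sub (.eq (.add (t.lift 0) (t'.lift 0)) (.add (.var 0) (t'.lift 0))) t s h
    have h2 := sub (.eq (.add (t.lift 0) (t'.lift 0)) (.add (s.lift 0) (.var 0))) t' s' h'
    simp only [AFml.subst0, AFml.substAll, l0, ATerm.substAll, subst0Env] at this h2
    exact h2 (this (hrefl _))
  have cmul : ∀ t t' s s', H (.eq t s) → H (.eq t' s') → H (.eq (.mul t t') (.mul s s')) := by
    intro t t' s s' h h'
    have := sub (.eq (.mul (t.lift 0) (t'.lift 0)) (.mul (.var 0) (t'.lift 0))) t s h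
    have h2 := sub (.eq (.mul (t.lift 0) (t'.lift 0)) (.mul (s.lift 0) (.var 0))) t' s' h'
    simp only [AFml.subst0, AFml.substAll, l0, ATerm.substAll, subst0Env] at this h2
    exact h2 (this (hrefl _))
  have cle : ∀ t t' s s', H (.eq t s) → H (.eq t' s') → H (.le t t') → H (.le s s') := by
    intro t t' s s' h h' hl
    have := sub (.le (.var 0) (t'.lift 0)) t s h
    have h2 := sub (.le (s.lift 0) (.var 0)) t' s' h'
    simp only [AFml.subst0, AFml.substAll, l0, ATerm.substAll, subst0Env] at this h2
    exact h2 (this hl)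
  let S : PStr (Quotient st) :=
    { zero := ⟦.zero⟧
      succ := Quotient.map ATerm.succ (fun a b h => csucc a b h)
      add := Quotient.map₂ ATerm.add (fun a b h a' b' h' => cadd a a' b b' h h')
      mul := Quotient.map₂ ATerm.mul (fun a b h a' b' h' => cmul a a' b b' h h')
      le := Quotient.lift₂ (fun t s => H (.le t s)) (fun a a' b b' h h' =>
        propext ⟨cle a a' b b' h h', cle b b' a a' (hsymm _ _ h) (hsymm _ _ h')⟩) }
  have htm : ∀ (σ : ℕ → ATerm) (t : ATerm),
      t.ev S (fun n => (⟦σ n⟧ : Quotient st)) = ⟦t.substAll σ⟧ := by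
    intro σ t
    induction t with
    | var n => rfl
    | zero => rfl
    | succ t ih => simp only [ATerm.ev, ih]; rfl
    | add t s ih1 ih2 => simp only [ATerm.ev, ih1, ih2]; rfl
    | mul t s ih1 ih2 => simp only [ATerm.ev, ih1, ih2]; rfl
  have hall : ∀ φ, (∀ t, H (φ.subst0 t)) → H (.all φ) := by
    intro φ h
    by_contra hc
    have h1 : ¬ H (.all (.neg (.neg φ))) := by
      intro h2
      apply hc
      refine HM _ _ (HM _ _ (HP _ (.allImp (.neg (.neg φ)) φ)) (HP _ (.gen (.taut ?_)))) h2
      intro v; simp only [AFml.evalProp]; tauto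
    have h2 : H (.ex (.neg φ)) := by
      have := HP _ (.exDef (.neg φ))
      have h3 := (hneg _).2 h1
      exact t2 (fun v => by simp only [AFml.evalProp, iffF]; tauto) this h3
    obtain ⟨t, ht⟩ := HE _ h2
    exact HN _ ⟨h t, ht⟩
  have hcons : ∀ (t : ATerm) (σ : ℕ → ATerm),
      mcons (⟦t⟧ : Quotient st) (fun n => ⟦σ n⟧) = fun n => ⟦scons t σ n⟧ := by
    intro t σ; funext n; cases n <;> rfl
  have truth : ∀ (φ : AFml) (σ : ℕ → ATerm),
      φ.Ev S (fun n => (⟦σ n⟧ : Quotient st)) ↔ H (φ.substAll σ) := by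
    intro φ
    induction φ with
    | eq t s =>
      intro σ
      simp only [AFml.Ev, htm, AFml.substAll]
      exact Quotient.eq (r := st)
    | le t s => intro σ; simp only [AFml.Ev, htm, AFml.substAll]; rfl
    | neg φ ih => intro σ; simp only [AFml.Ev, AFml.substAll, hneg, ih]
    | and φ ψ ih1 ih2 =>
      intro σ
      simp only [AFml.Ev, AFml.substAll, ih1, ih2]
      exact ⟨fun h => t2 (fun v => by simp only [AFml.evalProp]; tauto) h.1 h.2, fun h =>
        ⟨t1 (fun v => by simp only [AFml.evalProp]; tauto) h,
          t1 (fun v => by simp only [AFml.evalProp]; tauto) h⟩⟩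
    | or φ ψ ih1 ih2 =>
      intro σ
      simp only [AFml.Ev, AFml.substAll, ih1, ih2]
      constructor
      · rintro (h | h)
        · exact t1 (fun v => by simp only [AFml.evalProp]; tauto) h
        · exact t1 (fun v => by simp only [AFml.evalProp]; tauto) h
      · intro h
        by_contra hc
        rw [not_or, ← hneg, ← hneg] at hc
        exact HN _ ⟨h, t2 (fun v => by simp only [AFml.evalProp]; tauto) hc.1 hc.2⟩
    | imp φ ψ ih1 ih2 =>
      intro σ
      simp only [AFml.Ev, AFml.substAll, ih1, ih2]
      constructor
      · intro h
        by_cases h1 : H (φ.substAll σ)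
        · exact t1 (fun v => by simp only [AFml.evalProp]; tauto) (h h1)
        · exact t1 (fun v => by simp only [AFml.evalProp]; tauto) ((hneg _).2 h1)
      · exact HM _ _
    | all φ ih =>
      intro σ
      simp only [AFml.Ev, AFml.substAll]
      constructor
      · intro h
        refine hall _ fun t => ?_
        rw [liftSub_subst0, ← ih, ← hcons]
        exact h _
      · intro h a
        induction a using Quotient.inductionOn with
        | h t =>
          rw [hcons, ih, ← liftSub_subst0]
          exact HM _ _ (HP _ (.allE _ t)) h
    | ex φ ih =>
      intro σ
      simp only [AFml.Ev, AFml.substAll]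
      constructor
      · rintro ⟨a, h⟩
        induction a using Quotient.inductionOn with
        | h t =>
          rw [hcons, ih, ← liftSub_subst0] at h
          exact HM _ _ (HP _ (.exI _ t)) h
      · intro h
        obtain ⟨t, ht⟩ := HE _ h
        rw [liftSub_subst0, ← ih, ← hcons] at ht
        exact ⟨_, ht⟩
  refine ⟨Quotient st, S, ?_, fun n => ⟦.var n⟧, ?_⟩
  · intro φ hφ ρ
    have : ρ = fun n => ⟦(ρ n).out⟧ := by funext n; simp
    rw [this, truth]
    exact HP _ ((Proves.ax hφ).ax_subst _)
  · rw [truth]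
    rwa [AFml.substAll_var]

theorem completeness {φ : AFml}
    (h : ∀ (M : Type) (S : PStr M), Models S Γ → ∀ ρ, φ.Ev S ρ) : Proves Γ φ := by
  by_contra hn
  obtain ⟨M, S, hS, ρ, hρ⟩ := completeness_aux (Γ := Γ) (.neg φ)
    (fun h => hn (h.tc1 fun v => by simp only [AFml.evalProp]; tauto))
  exact hρ (h M S hS ρ)

end


/-! ## Bounded quantifiers and instances -/

def AFml.bex (t : ATerm) (D : AFml) : AFml := .ex (.and (.le (.var 0) (t.lift 0)) D)
def AFml.ball (t : ATerm) (D : AFml) : AFml := .all (.imp (.le (.var 0) (t.lift 0)) D)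
def AFml.inst (D : AFml) (ts : List ATerm) : AFml := D.substAll (fun i => ts.getD i .zero)
def PStr.env {M : Type} (S : PStr M) (l : List M) : ℕ → M := fun i => l.getD i S.zero

section
variable {M : Type} (S : PStr M)

theorem mcons_env (a : M) (l : List M) : mcons a (S.env l) = S.env (a :: l) := by
  funext n; cases n <;> simp [mcons, PStr.env]

theorem env_zero (a : M) (l : List M) : S.env (a :: l) 0 = a := rfl
theorem env_succ (a : M) (l : List M) (n : ℕ) : S.env (a :: l) (n + 1) = S.env l n := by
  simp [PStr.env]

theorem Ev_inst (D : AFml) (ts : List ATerm) (ρ : ℕ → M) :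
    (D.inst ts).Ev S ρ ↔ D.Ev S (S.env (ts.map (ATerm.ev S ρ))) := by
  unfold AFml.inst
  rw [AFml.Ev_substAll]
  have : (fun n => ATerm.ev S ρ (ts.getD n .zero)) = S.env (ts.map (ATerm.ev S ρ)) := by
    funext n
    simp only [PStr.env, List.getD_eq_getElem?_getD, List.getElem?_map]
    cases ts[n]? <;> rfl
  rw [this]

theorem Ev_bex (t : ATerm) (D : AFml) (ρ : ℕ → M) :
    (D.bex t).Ev S ρ ↔ ∃ a, S.le a (t.ev S ρ) ∧ D.Ev S (mcons a ρ) := by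
  simp only [AFml.bex, AFml.Ev, ATerm.ev_lift]; rfl

theorem Ev_ball (t : ATerm) (D : AFml) (ρ : ℕ → M) :
    (D.ball t).Ev S ρ ↔ ∀ a, S.le a (t.ev S ρ) → D.Ev S (mcons a ρ) := by
  simp only [AFml.ball, AFml.Ev, ATerm.ev_lift]; rfl

end

theorem IsDelta0.bex' {D : AFml} (t : ATerm) (h : IsDelta0 D) : IsDelta0 (D.bex t) := .bex t h
theorem IsDelta0.ball' {D : AFml} (t : ATerm) (h : IsDelta0 D) : IsDelta0 (D.ball t) := .ball t h

theorem IsDelta0.substAll {D : AFml} (h : IsDelta0 D) : ∀ σ : ℕ → ATerm, IsDelta0 (D.substAll σ) := by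
  induction h with
  | eq t s => intro σ; exact .eq _ _
  | le t s => intro σ; exact .le _ _
  | neg _ ih => intro σ; exact .neg (ih σ)
  | and _ _ ih1 ih2 => intro σ; exact .and (ih1 σ) (ih2 σ)
  | or _ _ ih1 ih2 => intro σ; exact .or (ih1 σ) (ih2 σ)
  | imp _ _ ih1 ih2 => intro σ; exact .imp (ih1 σ) (ih2 σ)
  | ball t _ ih =>
    intro σ
    simp only [AFml.substAll, ATerm.lift_liftSub]
    exact .ball _ (ih _)
  | bex t _ ih =>
    intro σ
    simp only [AFml.substAll, ATerm.lift_liftSub]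
    exact .bex _ (ih _)

theorem IsDelta0.inst {D : AFml} (h : IsDelta0 D) (ts : List ATerm) : IsDelta0 (D.inst ts) :=
  h.substAll _

theorem AFml.FreeLt_inst (D : AFml) (ts : List ATerm) (c : ℕ) (h : ∀ t ∈ ts, t.FreeLt c) :
    (D.inst ts).FreeLt c := by
  obtain ⟨d, hd⟩ := D.exists_FreeLt
  refine AFml.FreeLt_substAll D (c := d) ?_ hd
  intro n _
  rw [List.getD_eq_getElem?_getD]
  by_cases hn : n < ts.length
  · simp [hn, h]
  · simp only [List.getElem?_eq_none (not_lt.1 hn)]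
    trivial

/-! ## Models of PA -/

def nu {M : Type} (S : PStr M) : ℕ → M
  | 0 => S.zero
  | n + 1 => S.succ (nu S n)

section
variable {M : Type} {S : PStr M}


namespace Models

theorem ind (h : Models S PA) (φ : AFml) (ρ : ℕ → M) (h0 : φ.Ev S (mcons S.zero ρ))
    (hs : ∀ a, φ.Ev S (mcons a ρ) → φ.Ev S (mcons (S.succ a) ρ)) (a : M) : φ.Ev S (mcons a ρ) := by
  refine h _ (PAax.ind φ) ρ ⟨?_, ?_⟩ a
  · rw [AFml.Ev_subst0]; exact h0
  · intro a ha
    unfold succSubst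
    rw [AFml.Ev_substAll]
    convert hs a ha using 2
    rename_i n
    cases n <;> simp [ATerm.ev, mcons]

theorem succ_ne (h : Models S PA) (a : M) : S.succ a ≠ S.zero := h _ PAax.succNeZero (fun _ => S.zero) a
theorem succ_inj (h : Models S PA) (a b : M) : S.succ a = S.succ b → a = b :=
  h _ PAax.succInj (fun _ => S.zero) a b
theorem add_zero (h : Models S PA) (a : M) : S.add a S.zero = a := h _ PAax.addZero (fun _ => S.zero) a
theorem add_succ (h : Models S PA) (a b : M) : S.add a (S.succ b) = S.succ (S.add a b) :=
  h _ PAax.addSucc (fun _ => S.zero) a b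
theorem mul_zero (h : Models S PA) (a : M) : S.mul a S.zero = S.zero := h _ PAax.mulZero (fun _ => S.zero) a
theorem mul_succ (h : Models S PA) (a b : M) : S.mul a (S.succ b) = S.add (S.mul a b) a :=
  h _ PAax.mulSucc (fun _ => S.zero) a b
theorem le_def (h : Models S PA) (a b : M) : S.le a b ↔ ∃ c, S.add c a = b := by
  have := h _ PAax.leDef (fun _ => S.zero) a b
  simp only [iffF, AFml.Ev] at this
  exact ⟨this.1, this.2⟩

theorem zero_or_succ (h : Models S PA) (a : M) : a = S.zero ∨ ∃ b, a = S.succ b := by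
  have := h.ind (.or (.eq (.var 0) .zero) (.ex (.eq (.var 1) (.succ (.var 0))))) (fun _ => S.zero)
    (Or.inl rfl) (fun a _ => Or.inr ⟨a, rfl⟩) a
  exact this

theorem zero_add (h : Models S PA) (a : M) : S.add S.zero a = a := by
  have := h.ind (.eq (.add .zero (.var 0)) (.var 0)) (fun _ => S.zero)
    (h.add_zero _) (fun a ha => by
      simp only [AFml.Ev, ATerm.ev, mcons] at *
      rw [h.add_succ, ha]) a
  exact this

theorem succ_add (h : Models S PA) (a b : M) : S.add (S.succ a) b = S.succ (S.add a b) := by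
  have := h.ind (.eq (.add (.succ (.var 1)) (.var 0)) (.succ (.add (.var 1) (.var 0)))) (fun _ => a)
    (by simp only [AFml.Ev, ATerm.ev, mcons]; rw [h.add_zero, h.add_zero]) (fun b hb => by
      simp only [AFml.Ev, ATerm.ev, mcons] at *
      rw [h.add_succ, h.add_succ, hb]) b
  exact this

theorem add_comm (h : Models S PA) (a b : M) : S.add a b = S.add b a := by
  have := h.ind (.eq (.add (.var 1) (.var 0)) (.add (.var 0) (.var 1))) (fun _ => a)
    (by simp only [AFml.Ev, ATerm.ev, mcons]; rw [h.add_zero, h.zero_add]) (fun b hb => by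
      simp only [AFml.Ev, ATerm.ev, mcons] at *
      rw [h.add_succ, h.succ_add, hb]) b
  exact this

theorem le_total (h : Models S PA) (a b : M) : S.le a b ∨ S.le b a := by
  have := h.ind (.or (.le (.var 0) (.var 1)) (.le (.var 1) (.var 0))) (fun _ => b)
    (by
      simp only [AFml.Ev, ATerm.ev, mcons, h.le_def]
      exact Or.inl ⟨b, h.add_zero b⟩) (fun a ha => by
      simp only [AFml.Ev, ATerm.ev, mcons, h.le_def] at *
      rcases ha with ⟨z, hz⟩ | ⟨z, hz⟩
      · rcases h.zero_or_succ z with rfl | ⟨z', rfl⟩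
        · rw [h.zero_add] at hz
          subst hz
          exact Or.inr ⟨S.succ S.zero, by rw [h.succ_add, h.zero_add]⟩
        · exact Or.inl ⟨z', by rw [← hz, h.succ_add, h.add_succ]⟩
      · exact Or.inr ⟨S.succ z, by rw [h.succ_add, hz]⟩) a
  exact this

theorem le_zero (h : Models S PA) (a : M) (ha : S.le a S.zero) : a = S.zero := by
  obtain ⟨z, hz⟩ := (h.le_def _ _).1 ha
  rcases h.zero_or_succ a with rfl | ⟨b, rfl⟩
  · rfl
  · rw [h.add_succ] at hz; exact absurd hz (h.succ_ne _)

theorem le_succ (h : Models S PA) (a b : M) (ha : S.le a (S.succ b)) : S.le a b ∨ a = S.succ b := by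
  obtain ⟨z, hz⟩ := (h.le_def _ _).1 ha
  rcases h.zero_or_succ z with rfl | ⟨c, rfl⟩
  · rw [h.zero_add] at hz; exact Or.inr hz
  · rw [h.succ_add] at hz; exact Or.inl ((h.le_def _ _).2 ⟨c, h.succ_inj _ _ hz⟩)

theorem le_refl (h : Models S PA) (a : M) : S.le a a := (h.le_def _ _).2 ⟨S.zero, h.zero_add a⟩
theorem le_add_right (h : Models S PA) (a b : M) : S.le a (S.add a b) := (h.le_def _ _).2 ⟨b, h.add_comm _ _⟩
theorem le_add_left (h : Models S PA) (a b : M) : S.le b (S.add a b) := (h.le_def _ _).2 ⟨a, rfl⟩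

theorem least (h : Models S PA) (φ : AFml) (ρ : ℕ → M) (a : M) (ha : φ.Ev S (mcons a ρ)) :
    ∃ u, φ.Ev S (mcons u ρ) ∧ ∀ v, S.le v u → φ.Ev S (mcons v ρ) → v = u := by
  by_contra hc
  push Not at hc
  have hsub : ∀ x y : M, (φ.substAll (fun n => if n = 0 then .var 0 else .var (n + 1))).Ev S
      (mcons y (mcons x ρ)) ↔ φ.Ev S (mcons y ρ) := by
    intro x y
    rw [AFml.Ev_substAll]
    have : (fun n => ATerm.ev S (mcons y (mcons x ρ)) (if n = 0 then .var 0 else .var (n + 1)))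
        = mcons y ρ := by
      funext n
      cases n <;> simp [ATerm.ev, mcons]
    rw [this]
  have := h.ind (.ball (.var 0) (.neg (φ.substAll (fun n => if n = 0 then .var 0 else .var (n + 1)))))
    ρ ?_ ?_ a
  · rw [Ev_ball] at this
    have := this a (h.le_refl a)
    rw [AFml.Ev, hsub] at this
    exact this ha
  · rw [Ev_ball]
    intro y hy
    rw [AFml.Ev, hsub]
    intro hφ
    obtain ⟨v, hv, hv1, hv2⟩ := hc y hφ
    have := h.le_zero y hy
    subst this
    exact hv2 (h.le_zero v hv)
  · intro x hx
    rw [Ev_ball] at hx ⊢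
    simp only [AFml.Ev, hsub] at hx ⊢
    have hx' : ∀ y, S.le y x → ¬ φ.Ev S (mcons y ρ) := hx
    intro y hy hφ
    rcases h.le_succ y x hy with h1 | h1
    · exact hx' y h1 hφ
    · subst h1
      obtain ⟨v, hv, hv1, hv2⟩ := hc _ hφ
      rcases h.le_succ v x hv with h1 | h1
      · exact hx' v h1 hv1
      · exact hv2 h1

theorem nu_add (h : Models S PA) (a b : ℕ) : S.add (nu S a) (nu S b) = nu S (a + b) := by
  induction b with
  | zero => exact h.add_zero _
  | succ b ih => simp only [nu, h.add_succ, ih]; rfl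

theorem nu_mul (h : Models S PA) (a b : ℕ) : S.mul (nu S a) (nu S b) = nu S (a * b) := by
  induction b with
  | zero => exact h.mul_zero _
  | succ b ih => simp only [nu, h.mul_succ, ih, h.nu_add]; rfl

theorem nu_inj (h : Models S PA) (a b : ℕ) (hab : nu S a = nu S b) : a = b := by
  induction a generalizing b with
  | zero =>
    cases b with
    | zero => rfl
    | succ b => exact absurd hab.symm (h.succ_ne _)
  | succ a ih =>
    cases b with
    | zero => exact absurd hab (h.succ_ne _)
    | succ b => rw [ih b (h.succ_inj _ _ hab)]

theorem le_nu (h : Models S PA) (k : ℕ) (a : M) (ha : S.le a (nu S k)) : ∃ j ≤ k, a = nu S j := by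
  induction k with
  | zero => exact ⟨0, le_rfl, h.le_zero a ha⟩
  | succ k ih =>
    rcases h.le_succ a _ ha with h1 | h1
    · obtain ⟨j, hj, e⟩ := ih h1
      exact ⟨j, by omega, e⟩
    · exact ⟨k + 1, le_rfl, h1⟩

theorem nu_le (h : Models S PA) (a b : ℕ) : S.le (nu S a) (nu S b) ↔ a ≤ b := by
  constructor
  · intro hab
    obtain ⟨j, hj, e⟩ := h.le_nu b _ hab
    rw [h.nu_inj _ _ e]; exact hj
  · intro hab
    obtain ⟨c, rfl⟩ := Nat.exists_eq_add_of_le hab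
    exact (h.le_def _ _).2 ⟨nu S c, by rw [h.nu_add, Nat.add_comm]⟩

theorem nu_le_of_nonstd (h : Models S PA) (z : M) (hz : ∀ k, z ≠ nu S k) (k : ℕ) : S.le (nu S k) z := by
  rcases h.le_total (nu S k) z with h1 | h1
  · exact h1
  · obtain ⟨j, _, e⟩ := h.le_nu k z h1
    exact absurd e (hz j)

theorem ev_nu (h : Models S PA) (ρ : ℕ → ℕ) (t : ATerm) : t.ev S (fun n => nu S (ρ n)) = nu S (t.ev natStr ρ) := by
  induction t with
  | var n => rfl
  | zero => rfl
  | succ t ih => simp only [ATerm.ev, ih]; rfl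
  | add t s ih1 ih2 => simp only [ATerm.ev, ih1, ih2, h.nu_add]; rfl
  | mul t s ih1 ih2 => simp only [ATerm.ev, ih1, ih2, h.nu_mul]; rfl


theorem mcons_nu (a : ℕ) (ρ : ℕ → ℕ) :
    mcons (nu S a) (fun n => nu S (ρ n)) = fun n => nu S (mcons a ρ n) := by
  funext n; cases n <;> rfl

theorem absolute (h : Models S PA) {D : AFml} (hD : IsDelta0 D) : ∀ ρ : ℕ → ℕ,
    D.Ev S (fun n => nu S (ρ n)) ↔ D.Ev natStr ρ := by
  induction hD with
  | eq t s =>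
    intro ρ
    simp only [AFml.Ev, h.ev_nu]
    exact ⟨h.nu_inj _ _, fun e => by rw [e]⟩
  | le t s => intro ρ; simp only [AFml.Ev, h.ev_nu]; exact h.nu_le _ _
  | neg _ ih => intro ρ; simp only [AFml.Ev, ih]
  | and _ _ ih1 ih2 => intro ρ; simp only [AFml.Ev, ih1, ih2]
  | or _ _ ih1 ih2 => intro ρ; simp only [AFml.Ev, ih1, ih2]
  | imp _ _ ih1 ih2 => intro ρ; simp only [AFml.Ev, ih1, ih2]
  | @ball φ t _ ih =>
    intro ρ
    change (AFml.ball t φ).Ev S _ ↔ (AFml.ball t φ).Ev natStr _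
    rw [Ev_ball, Ev_ball, h.ev_nu]
    constructor
    · intro H a ha
      rw [← ih, ← mcons_nu]
      exact H _ ((h.nu_le _ _).2 ha)
    · intro H a ha
      obtain ⟨j, hj, rfl⟩ := h.le_nu _ _ ha
      rw [mcons_nu, ih]
      exact H j hj
  | @bex φ t _ ih =>
    intro ρ
    change (AFml.bex t φ).Ev S _ ↔ (AFml.bex t φ).Ev natStr _
    rw [Ev_bex, Ev_bex, h.ev_nu]
    constructor
    · rintro ⟨a, ha, H⟩
      obtain ⟨j, hj, rfl⟩ := h.le_nu _ _ ha
      rw [mcons_nu, ih] at H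
      exact ⟨j, hj, H⟩
    · rintro ⟨a, ha, H⟩
      rw [← ih, ← mcons_nu] at H
      exact ⟨_, (h.nu_le _ _).2 ha, H⟩

theorem absolute_env (h : Models S PA) {D : AFml} (hD : IsDelta0 D) (l : List ℕ) :
    D.Ev S (S.env (l.map (nu S))) ↔ D.Ev natStr (natStr.env l) := by
  rw [← h.absolute hD]
  have : S.env (l.map (nu S)) = fun n => nu S (natStr.env l n) := by
    funext n
    simp only [PStr.env, List.getD_eq_getElem?_getD, List.getElem?_map]
    cases l[n]? <;> rfl
  rw [this]

end Models
end

theorem ev_numeral {M : Type} (S : PStr M) (ρ : ℕ → M) (k : ℕ) : (numeral k).ev S ρ = nu S k := by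
  induction k with
  | zero => rfl
  | succ k ih => simp only [numeral, ATerm.ev, ih]; rfl

theorem natModels : Models natStr PA := by
  intro φ hφ ρ
  cases hφ with
  | succNeZero => intro a; exact Nat.succ_ne_zero a
  | succInj => intro a b; exact Nat.succ.inj
  | addZero => intro a; rfl
  | addSucc => intro a b; rfl
  | mulZero => intro a; rfl
  | mulSucc => intro a b; exact Nat.mul_succ a b
  | leDef =>
    intro a b
    refine ⟨fun hab => ?_, ?_⟩
    · exact ⟨b - a, Nat.sub_add_cancel hab⟩
    · rintro ⟨c, hc⟩
      have : c + a = b := hc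
      change a ≤ b
      omega
  | ind φ =>
    rintro ⟨h0, hs⟩ a
    rw [AFml.Ev_subst0] at h0
    induction a with
    | zero => exact h0
    | succ a ih =>
      have := hs a ih
      unfold succSubst at this
      rw [AFml.Ev_substAll] at this
      convert this using 2
      rename_i n
      cases n <;> simp [ATerm.ev, mcons, natStr]

/-! ## Normal form of Σ₁ formulas -/

def HasForm (φ : AFml) : Prop := ∃ δ, IsDelta0 δ ∧ ∀ (M : Type) (S : PStr M), Models S PA →
  ∀ ρ, φ.Ev S ρ ↔ ∃ w, δ.Ev S (mcons w ρ)

theorem HasForm.congr {φ ψ : AFml} (h : HasForm φ)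
    (e : ∀ (M : Type) (S : PStr M), Models S PA → ∀ ρ, ψ.Ev S ρ ↔ φ.Ev S ρ) : HasForm ψ := by
  obtain ⟨δ, hδ, H⟩ := h
  exact ⟨δ, hδ, fun M S hS ρ => (e M S hS ρ).trans (H M S hS ρ)⟩

theorem IsDelta0.hasForm {φ : AFml} (h : IsDelta0 φ) : HasForm φ := by
  refine ⟨φ.lift 0, ?_, ?_⟩
  · rw [AFml.lift_eq]; exact h.substAll _
  · intro M S _ ρ; simp only [AFml.Ev_lift, exists_const_iff]
    exact ⟨fun h => ⟨⟨S.zero⟩, h⟩, fun h => h.2⟩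

theorem HasForm.or {φ ψ : AFml} (h1 : HasForm φ) (h2 : HasForm ψ) : HasForm (.or φ ψ) := by
  obtain ⟨δ, hδ, H⟩ := h1
  obtain ⟨δ', hδ', H'⟩ := h2
  refine ⟨.or δ δ', .or hδ hδ', fun M S hS ρ => ?_⟩
  simp only [AFml.Ev, H M S hS, H' M S hS, exists_or]

/-- skip variable 1 -/
def skip1 : ℕ → ATerm := fun n => if n = 0 then .var 0 else .var (n + 1)

theorem Ev_skip1 {M : Type} (S : PStr M) (φ : AFml) (x y : M) (ρ : ℕ → M) :
    (φ.substAll skip1).Ev S (mcons y (mcons x ρ)) ↔ φ.Ev S (mcons y ρ) := by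
  rw [AFml.Ev_substAll]
  have : (fun n => ATerm.ev S (mcons y (mcons x ρ)) (skip1 n)) = mcons y ρ := by
    funext n
    cases n <;> simp [skip1, ATerm.ev, mcons]
  rw [this]

theorem HasForm.and {φ ψ : AFml} (h1 : HasForm φ) (h2 : HasForm ψ) : HasForm (.and φ ψ) := by
  obtain ⟨δ, hδ, H⟩ := h1
  obtain ⟨δ', hδ', H'⟩ := h2
  refine ⟨.and (.bex (.var 0) (δ.substAll skip1)) (.bex (.var 0) (δ'.substAll skip1)),
    .and ((hδ.substAll _).bex' _) ((hδ'.substAll _).bex' _), fun M S hS ρ => ?_⟩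
  simp only [AFml.Ev, Ev_bex, Ev_skip1, H M S hS, H' M S hS]
  constructor
  · rintro ⟨⟨a, ha⟩, ⟨b, hb⟩⟩
    exact ⟨S.add a b, ⟨a, hS.le_add_right _ _, ha⟩, ⟨b, hS.le_add_left _ _, hb⟩⟩
  · rintro ⟨w, ⟨a, _, ha⟩, ⟨b, _, hb⟩⟩
    exact ⟨⟨a, ha⟩, ⟨b, hb⟩⟩

theorem HasForm.ex {φ : AFml} (h1 : HasForm φ) : HasForm (.ex φ) := by
  obtain ⟨δ, hδ, H⟩ := h1
  refine ⟨.bex (.var 0) (.bex (.var 1) (δ.substAll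
    (fun n => if n = 0 then .var 0 else if n = 1 then .var 1 else .var (n + 1)))),
    ((hδ.substAll _).bex' _).bex' _, fun M S hS ρ => ?_⟩
  have key : ∀ a x w : M, (δ.substAll
      (fun n => if n = 0 then .var 0 else if n = 1 then .var 1 else .var (n + 1))).Ev S
      (mcons a (mcons x (mcons w ρ))) ↔ δ.Ev S (mcons a (mcons x ρ)) := by
    intro a x w
    rw [AFml.Ev_substAll]
    have : (fun n => ATerm.ev S (mcons a (mcons x (mcons w ρ)))
        (if n = 0 then .var 0 else if n = 1 then .var 1 else .var (n + 1)))
        = mcons a (mcons x ρ) := by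
      funext n
      rcases n with _ | _ | n <;> simp [ATerm.ev, mcons]
    rw [this]
  simp only [AFml.Ev, Ev_bex, key, H M S hS]
  constructor
  · rintro ⟨a, b, hb⟩
    exact ⟨S.add a b, a, hS.le_add_right _ _, b, hS.le_add_left _ _, hb⟩
  · rintro ⟨w, a, _, b, _, hb⟩
    exact ⟨a, b, hb⟩

mutual
theorem IsSigma1.hasForm : ∀ {φ : AFml}, IsSigma1 φ → HasForm φ
  | _, .delta0 h => h.hasForm
  | _, .and h1 h2 => h1.hasForm.and h2.hasForm
  | _, .or h1 h2 => h1.hasForm.or h2.hasForm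
  | _, .ex h => h.hasForm.ex
  | _, .negPi h => h.hasForm
  | _, .impPiSigma h1 h2 => (h1.hasForm.or h2.hasForm).congr fun M S hS ρ => by
      simp only [AFml.Ev]; tauto
theorem IsPi1.hasForm : ∀ {φ : AFml}, IsPi1 φ → HasForm (.neg φ)
  | _, .delta0 h => h.neg.hasForm
  | _, .and h1 h2 => (h1.hasForm.or h2.hasForm).congr fun M S hS ρ => by
      simp only [AFml.Ev]; tauto
  | _, .or h1 h2 => (h1.hasForm.and h2.hasForm).congr fun M S hS ρ => by
      simp only [AFml.Ev]; tauto
  | _, .all h => h.hasForm.ex.congr fun M S hS ρ => by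
      simp only [AFml.Ev]; push Not; rfl
  | _, .negSigma h => h.hasForm.congr fun M S hS ρ => by simp only [AFml.Ev]; tauto
  | _, .impSigmaPi h1 h2 => (h1.hasForm.and h2.hasForm).congr fun M S hS ρ => by
      simp only [AFml.Ev]; tauto
end

theorem exists_bad {Tax : Set AFml} (hext : PA ⊆ Tax) (hill : ¬ Sigma1Sound Tax) :
    ∃ δ : AFml, IsDelta0 δ ∧ (∀ (M : Type) (S : PStr M), Models S Tax → ∃ u, δ.Ev S (S.env [u])) ∧
      ∀ u : ℕ, ¬ δ.Ev natStr (natStr.env [u]) := by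
  unfold Sigma1Sound at hill
  push Not at hill
  obtain ⟨φ, h1, _, h3, h4⟩ := hill
  obtain ⟨δ, hδ, H⟩ := h1.hasForm
  refine ⟨δ, hδ, ?_, ?_⟩
  · intro M S hS
    have := hS.sound h3 (S.env [])
    rw [H M S (fun φ hφ => hS φ (hext hφ))] at this
    simpa only [mcons_env] using this
  · intro u hu
    apply h4
    unfold TrueN
    rw [← AFml.Ev_nat, H ℕ natStr natModels]
    refine ⟨u, ?_⟩
    rw [← mcons_env] at hu
    convert hu using 2
    rfl


/-! ## Definability over the standard model -/

def tl (ρ : ℕ → ℕ) : ℕ → ℕ := fun n => ρ (n + 1)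

theorem mcons_tl (ρ : ℕ → ℕ) : mcons (ρ 0) (tl ρ) = ρ := by funext n; cases n <;> rfl
theorem tl_mcons (a : ℕ) (ρ : ℕ → ℕ) : tl (mcons a ρ) = ρ := rfl

def Dl (R : (ℕ → ℕ) → Prop) : Prop := ∃ D, IsDelta0 D ∧ ∀ ρ, R ρ ↔ D.Ev natStr ρ
def Tm (f : (ℕ → ℕ) → ℕ) : Prop := ∃ t : ATerm, ∀ ρ, f ρ = t.ev natStr ρ

theorem Tm.var (i : ℕ) : Tm (fun ρ => ρ i) := ⟨.var i, fun _ => rfl⟩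
theorem Tm.const (k : ℕ) : Tm (fun _ => k) := ⟨numeral k, fun ρ => by
  induction k with
  | zero => rfl
  | succ k ih => exact congrArg Nat.succ ih⟩
theorem Tm.add {f g} (hf : Tm f) (hg : Tm g) : Tm (fun ρ => f ρ + g ρ) := by
  obtain ⟨t, ht⟩ := hf; obtain ⟨s, hs⟩ := hg
  exact ⟨.add t s, fun ρ => by beta_reduce; rw [ht, hs]; rfl⟩
theorem Tm.mul {f g} (hf : Tm f) (hg : Tm g) : Tm (fun ρ => f ρ * g ρ) := by
  obtain ⟨t, ht⟩ := hf; obtain ⟨s, hs⟩ := hg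
  exact ⟨.mul t s, fun ρ => by beta_reduce; rw [ht, hs]; rfl⟩

theorem Dl.congr {R R' : (ℕ → ℕ) → Prop} (h : Dl R) (e : ∀ ρ, R' ρ ↔ R ρ) : Dl R' := by
  obtain ⟨D, hD, H⟩ := h
  exact ⟨D, hD, fun ρ => (e ρ).trans (H ρ)⟩
theorem Dl.eq {f g} (hf : Tm f) (hg : Tm g) : Dl (fun ρ => f ρ = g ρ) := by
  obtain ⟨t, ht⟩ := hf; obtain ⟨s, hs⟩ := hg
  exact ⟨.eq t s, .eq _ _, fun ρ => by beta_reduce; rw [ht, hs]; rfl⟩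
theorem Dl.le {f g} (hf : Tm f) (hg : Tm g) : Dl (fun ρ => f ρ ≤ g ρ) := by
  obtain ⟨t, ht⟩ := hf; obtain ⟨s, hs⟩ := hg
  exact ⟨.le t s, .le _ _, fun ρ => by beta_reduce; rw [ht, hs]; rfl⟩
theorem Dl.lt {f g} (hf : Tm f) (hg : Tm g) : Dl (fun ρ => f ρ < g ρ) :=
  (Dl.le (hf.add (Tm.const 1)) hg).congr fun _ => Iff.rfl
theorem Dl.not {R} (h : Dl R) : Dl (fun ρ => ¬ R ρ) := by
  obtain ⟨D, hD, H⟩ := h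
  exact ⟨.neg D, .neg hD, fun ρ => by beta_reduce; rw [H]; rfl⟩
theorem Dl.and {R R'} (h : Dl R) (h' : Dl R') : Dl (fun ρ => R ρ ∧ R' ρ) := by
  obtain ⟨D, hD, H⟩ := h; obtain ⟨D', hD', H'⟩ := h'
  exact ⟨.and D D', .and hD hD', fun ρ => by beta_reduce; rw [H, H']; rfl⟩
theorem Dl.or {R R'} (h : Dl R) (h' : Dl R') : Dl (fun ρ => R ρ ∨ R' ρ) := by
  obtain ⟨D, hD, H⟩ := h; obtain ⟨D', hD', H'⟩ := h'
  exact ⟨.or D D', .or hD hD', fun ρ => by beta_reduce; rw [H, H']; rfl⟩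
theorem Dl.bex {R : ℕ → (ℕ → ℕ) → Prop} {f} (hf : Tm f) (h : Dl (fun ρ => R (ρ 0) (tl ρ))) :
    Dl (fun ρ => ∃ a ≤ f ρ, R a ρ) := by
  obtain ⟨D, hD, H⟩ := h; obtain ⟨t, ht⟩ := hf
  refine ⟨D.bex t, hD.bex' t, fun ρ => ?_⟩
  rw [Ev_bex]
  simp only [← H, ← ht, tl_mcons]
  rfl
theorem Dl.ball {R : ℕ → (ℕ → ℕ) → Prop} {f} (hf : Tm f) (h : Dl (fun ρ => R (ρ 0) (tl ρ))) :
    Dl (fun ρ => ∀ a ≤ f ρ, R a ρ) := by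
  obtain ⟨D, hD, H⟩ := h; obtain ⟨t, ht⟩ := hf
  refine ⟨D.ball t, hD.ball' t, fun ρ => ?_⟩
  rw [Ev_ball]
  simp only [← H, ← ht, tl_mcons]
  rfl
theorem Dl.ren {R} (h : Dl R) (g : ℕ → ℕ) : Dl (fun ρ => R (fun n => ρ (g n))) := by
  obtain ⟨D, hD, H⟩ := h
  refine ⟨D.substAll (fun n => .var (g n)), hD.substAll _, fun ρ => ?_⟩
  beta_reduce; rw [AFml.Ev_substAll, H]
  rfl

def Sig (R : (ℕ → ℕ) → Prop) : Prop :=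
  ∃ D : ℕ → (ℕ → ℕ) → Prop, Dl (fun ρ => D (ρ 0) (tl ρ)) ∧ ∀ ρ, R ρ ↔ ∃ w, D w ρ

theorem Sig.congr {R R' : (ℕ → ℕ) → Prop} (h : Sig R) (e : ∀ ρ, R' ρ ↔ R ρ) : Sig R' := by
  obtain ⟨D, hD, H⟩ := h
  exact ⟨D, hD, fun ρ => (e ρ).trans (H ρ)⟩

theorem Dl.sig {R} (h : Dl R) : Sig R :=
  ⟨fun _ ρ => R ρ, h.ren Nat.succ, fun ρ => by simp⟩

def ren1 : ℕ → ℕ := fun n => if n = 0 then 0 else n + 1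
def ren2 : ℕ → ℕ := fun n => if n = 0 then 0 else if n = 1 then 1 else n + 1
def swp : ℕ → ℕ := fun n => if n = 0 then 1 else if n = 1 then 0 else n

theorem Dl.ren1 {R : ℕ → (ℕ → ℕ) → Prop} (h : Dl (fun ρ => R (ρ 0) (tl ρ))) :
    Dl (fun ρ => R (ρ 0) (tl (tl ρ))) := h.ren PLN.ren1

theorem Sig.or {R R'} (h : Sig R) (h' : Sig R') : Sig (fun ρ => R ρ ∨ R' ρ) := by
  obtain ⟨D, hD, H⟩ := h; obtain ⟨D', hD', H'⟩ := h'
  exact ⟨fun w ρ => D w ρ ∨ D' w ρ, hD.or hD', fun ρ => by beta_reduce; rw [H, H', exists_or]⟩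

theorem Sig.and {R R'} (h : Sig R) (h' : Sig R') : Sig (fun ρ => R ρ ∧ R' ρ) := by
  obtain ⟨D, hD, H⟩ := h; obtain ⟨D', hD', H'⟩ := h'
  refine ⟨fun w ρ => (∃ a ≤ w, D a ρ) ∧ (∃ a ≤ w, D' a ρ), ?_, fun ρ => ?_⟩
  · exact (Dl.bex (R := fun a ρ => D a (tl ρ)) (Tm.var 0) (Dl.ren1 hD)).and
      (Dl.bex (R := fun a ρ => D' a (tl ρ)) (Tm.var 0) (Dl.ren1 hD'))
  · beta_reduce; rw [H, H']
    constructor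
    · rintro ⟨⟨a, ha⟩, ⟨b, hb⟩⟩
      exact ⟨a + b, ⟨a, by omega, ha⟩, ⟨b, by omega, hb⟩⟩
    · rintro ⟨w, ⟨a, _, ha⟩, ⟨b, _, hb⟩⟩
      exact ⟨⟨a, ha⟩, ⟨b, hb⟩⟩

theorem Sig.ex {R : ℕ → (ℕ → ℕ) → Prop} (h : Sig (fun ρ => R (ρ 0) (tl ρ))) :
    Sig (fun ρ => ∃ a, R a ρ) := by
  obtain ⟨D, hD, H⟩ := h
  have H' : ∀ a ρ, R a ρ ↔ ∃ w, D w (mcons a ρ) := fun a ρ => H (mcons a ρ)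
  refine ⟨fun v ρ => ∃ a ≤ v, ∃ w ≤ v, D w (mcons a ρ), ?_, fun ρ => ?_⟩
  · refine Dl.bex (R := fun a ρ => ∃ w ≤ ρ 0, D w (mcons a (tl ρ))) (Tm.var 0) ?_
    refine Dl.bex (R := fun w ρ => D w (mcons (ρ 0) (tl (tl ρ)))) (Tm.var 1) ?_
    refine (hD.ren PLN.ren2).congr fun ρ => ?_
    have : mcons (tl ρ 0) (tl (tl (tl ρ))) = tl (fun n => ρ (PLN.ren2 n)) := by
      funext n; cases n <;> simp [mcons, tl, PLN.ren2]
    rw [this]; rfl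
  · simp only [H']
    constructor
    · rintro ⟨a, b, hb⟩
      exact ⟨a + b, a, by omega, b, by omega, hb⟩
    · rintro ⟨w, a, _, b, _, hb⟩
      exact ⟨a, b, hb⟩

theorem collect {P : ℕ → ℕ → Prop} (n : ℕ) (h : ∀ a ≤ n, ∃ w, P a w) :
    ∃ W, ∀ a ≤ n, ∃ w ≤ W, P a w := by
  induction n with
  | zero =>
    obtain ⟨w, hw⟩ := h 0 le_rfl
    exact ⟨w, fun a ha => ⟨w, le_rfl, by rwa [Nat.le_zero.1 ha]⟩⟩
  | succ n ih =>
    obtain ⟨W, hW⟩ := ih fun a ha => h a (by omega)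
    obtain ⟨w, hw⟩ := h (n + 1) le_rfl
    refine ⟨W + w, fun a ha => ?_⟩
    rcases Nat.lt_or_ge a (n + 1) with h1 | h1
    · obtain ⟨w', h2, h3⟩ := hW a (by omega)
      exact ⟨w', by omega, h3⟩
    · have : a = n + 1 := by omega
      subst this
      exact ⟨w, by omega, hw⟩

theorem Sig.ballT {R : ℕ → (ℕ → ℕ) → Prop} {f} (hf : Tm f) (h : Sig (fun ρ => R (ρ 0) (tl ρ))) :
    Sig (fun ρ => ∀ a ≤ f ρ, R a ρ) := by
  obtain ⟨D, hD, H⟩ := h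
  have H' : ∀ a ρ, R a ρ ↔ ∃ w, D w (mcons a ρ) := fun a ρ => H (mcons a ρ)
  refine ⟨fun v ρ => ∀ a ≤ f ρ, ∃ w ≤ v, D w (mcons a ρ), ?_, fun ρ => ?_⟩
  · have hf' : Tm (fun ρ => f (tl ρ)) := by
      obtain ⟨t, ht⟩ := hf
      refine ⟨t.lift 0, fun ρ => ?_⟩
      conv_rhs => rw [← mcons_tl ρ]
      rw [ATerm.ev_lift]; exact ht _
    refine Dl.ball (R := fun a ρ => ∃ w ≤ ρ 0, D w (mcons a (tl ρ))) hf' ?_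
    refine Dl.bex (R := fun w ρ => D w (mcons (ρ 0) (tl (tl ρ)))) (Tm.var 1) ?_
    refine (hD.ren PLN.ren2).congr fun ρ => ?_
    have : mcons (tl ρ 0) (tl (tl (tl ρ))) = tl (fun n => ρ (PLN.ren2 n)) := by
      funext n; cases n <;> simp [mcons, tl, PLN.ren2]
    rw [this]; rfl
  · simp only [H']
    constructor
    · intro h; exact collect _ h
    · rintro ⟨W, hW⟩ a ha
      obtain ⟨w, _, hw⟩ := hW a ha
      exact ⟨w, hw⟩

theorem Sig.ren {R} (h : Sig R) (g : ℕ → ℕ) : Sig (fun ρ => R (fun n => ρ (g n))) := by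
  obtain ⟨D, hD, H⟩ := h
  refine ⟨fun w ρ => D w (fun n => ρ (g n)), ?_, fun ρ => H _⟩
  exact (hD.ren (fun n => if n = 0 then 0 else g (n - 1) + 1)).congr fun ρ => by
    simp [tl]; rfl

/-- functions with Σ₁ graph -/
def Fn (f : (ℕ → ℕ) → ℕ) : Prop := Sig (fun ρ => ρ 0 = f (tl ρ))

theorem Tm.fn {f} (h : Tm f) : Fn f := by
  obtain ⟨t, ht⟩ := h
  refine (Dl.eq (Tm.var 0) (g := fun ρ => f (tl ρ)) ⟨t.lift 0, fun ρ => ?_⟩).sig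
  conv_rhs => rw [← mcons_tl ρ]
  rw [ATerm.ev_lift]; exact ht _

theorem Fn.var (i : ℕ) : Fn (fun ρ => ρ i) := (Tm.var i).fn
theorem Fn.const (k : ℕ) : Fn (fun _ => k) := (Tm.const k).fn

theorem Fn.exEq {R : ℕ → (ℕ → ℕ) → Prop} {f} (hf : Fn f) (h : Sig (fun ρ => R (ρ 0) (tl ρ))) :
    Sig (fun ρ => R (f ρ) ρ) := by
  refine (Sig.ex (R := fun a ρ => a = f ρ ∧ R a ρ) (Sig.and hf h)).congr fun ρ => by simp

theorem Fn.tl {f} (hf : Fn f) : Fn (fun ρ => f (PLN.tl ρ)) := Sig.ren hf PLN.ren1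

theorem Sig.tl {R} (h : Sig R) : Sig (fun ρ => R (PLN.tl ρ)) := h.ren Nat.succ

theorem Sig.app1 {P : ℕ → Prop} (hP : Sig (fun ρ => P (ρ 0))) {f} (hf : Fn f) :
    Sig (fun ρ => P (f ρ)) := hf.exEq (R := fun a _ => P a) hP

theorem Sig.app2 {P : ℕ → ℕ → Prop} (hP : Sig (fun ρ => P (ρ 0) (ρ 1))) {f g} (hf : Fn f)
    (hg : Fn g) : Sig (fun ρ => P (f ρ) (g ρ)) := by
  refine hf.exEq (R := fun a ρ => P a (g ρ)) ?_
  refine hg.tl.exEq (R := fun b ρ => P (ρ 0) b) ?_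
  exact hP.ren swp

theorem Sig.app3 {P : ℕ → ℕ → ℕ → Prop} (hP : Sig (fun ρ => P (ρ 0) (ρ 1) (ρ 2))) {f g k}
    (hf : Fn f) (hg : Fn g) (hk : Fn k) : Sig (fun ρ => P (f ρ) (g ρ) (k ρ)) := by
  refine hf.exEq (R := fun a ρ => P a (g ρ) (k ρ)) ?_
  refine hg.tl.exEq (R := fun b ρ => P (ρ 0) b (k (PLN.tl ρ))) ?_
  refine hk.tl.tl.exEq (R := fun b ρ => P (ρ 1) (ρ 0) b) ?_
  exact hP.ren (fun n => 2 - n)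

theorem Sig.eq {f g} (hf : Fn f) (hg : Fn g) : Sig (fun ρ => f ρ = g ρ) :=
  Sig.app2 (P := fun a b => a = b) (Dl.eq (Tm.var 0) (Tm.var 1)).sig hf hg
theorem Sig.ne {f g} (hf : Fn f) (hg : Fn g) : Sig (fun ρ => f ρ ≠ g ρ) :=
  Sig.app2 (P := fun a b => a ≠ b) (Dl.eq (Tm.var 0) (Tm.var 1)).not.sig hf hg
theorem Sig.le {f g} (hf : Fn f) (hg : Fn g) : Sig (fun ρ => f ρ ≤ g ρ) :=
  Sig.app2 (P := fun a b => a ≤ b) (Dl.le (Tm.var 0) (Tm.var 1)).sig hf hg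
theorem Sig.lt {f g} (hf : Fn f) (hg : Fn g) : Sig (fun ρ => f ρ < g ρ) :=
  Sig.app2 (P := fun a b => a < b) (Dl.lt (Tm.var 0) (Tm.var 1)).sig hf hg

theorem Sig.ball {R : ℕ → (ℕ → ℕ) → Prop} {f} (hf : Fn f) (h : Sig (fun ρ => R (ρ 0) (PLN.tl ρ))) :
    Sig (fun ρ => ∀ a ≤ f ρ, R a ρ) := by
  refine hf.exEq (R := fun b ρ => ∀ a ≤ b, R a ρ) ?_
  exact Sig.ballT (R := fun a ρ => R a (PLN.tl ρ)) (Tm.var 0) (h.ren PLN.ren1)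

theorem Fn.app2 {F : ℕ → ℕ → ℕ} (hF : Sig (fun ρ => ρ 0 = F (ρ 1) (ρ 2))) {f g} (hf : Fn f)
    (hg : Fn g) : Fn (fun ρ => F (f ρ) (g ρ)) :=
  Sig.app3 (P := fun a b c => a = F b c) hF (Fn.var 0) hf.tl hg.tl

theorem Fn.app1 {F : ℕ → ℕ} (hF : Sig (fun ρ => ρ 0 = F (ρ 1))) {f} (hf : Fn f) :
    Fn (fun ρ => F (f ρ)) :=
  Sig.app2 (P := fun a b => a = F b) hF (Fn.var 0) hf.tl

theorem Fn.add {f g} (hf : Fn f) (hg : Fn g) : Fn (fun ρ => f ρ + g ρ) :=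
  Fn.app2 (F := fun a b => a + b) (Dl.eq (Tm.var 0) ((Tm.var 1).add (Tm.var 2))).sig hf hg
theorem Fn.mul {f g} (hf : Fn f) (hg : Fn g) : Fn (fun ρ => f ρ * g ρ) :=
  Fn.app2 (F := fun a b => a * b) (Dl.eq (Tm.var 0) ((Tm.var 1).mul (Tm.var 2))).sig hf hg

theorem Dl.pair {f g k} (hf : Tm f) (hg : Tm g) (hk : Tm k) :
    Dl (fun ρ => f ρ = Nat.pair (g ρ) (k ρ)) := by
  refine (((Dl.lt hg hk).and (Dl.eq hf ((hk.mul hk).add hg))).or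
    ((Dl.lt hg hk).not.and (Dl.eq hf (((hg.mul hg).add hg).add hk)))).congr fun ρ => ?_
  unfold Nat.pair
  split_ifs with h <;> simp [h]

theorem Fn.pair {f g} (hf : Fn f) (hg : Fn g) : Fn (fun ρ => Nat.pair (f ρ) (g ρ)) :=
  Fn.app2 (F := Nat.pair) (Dl.pair (Tm.var 0) (Tm.var 1) (Tm.var 2)).sig hf hg

theorem Fn.beta {f g} (hf : Fn f) (hg : Fn g) : Fn (fun ρ => Nat.beta (f ρ) (g ρ)) := by
  refine Fn.app2 (F := Nat.beta) ?_ hf hg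
  have : Sig (fun ρ => ∃ a, ∃ b, ∃ q, ρ 1 = Nat.pair a b ∧ a = q * ((ρ 2 + 1) * b + 1) + ρ 0 ∧
      ρ 0 < (ρ 2 + 1) * b + 1) := by
    apply Sig.ex; apply Sig.ex; apply Sig.ex
    have t : Tm fun ρ => ((ρ 5 + 1) * ρ 1 + 1) :=
      (((Tm.var 5).add (Tm.const 1)).mul (Tm.var 1)).add (Tm.const 1)
    exact (((Dl.pair (Tm.var 4) (Tm.var 2) (Tm.var 1))).and ((Dl.eq (Tm.var 2)
      (((Tm.var 0).mul t).add (Tm.var 3))).and (Dl.lt (Tm.var 3) t))).sig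
  refine this.congr fun ρ => ?_
  unfold Nat.beta
  constructor
  · intro h
    refine ⟨(ρ 1).unpair.1, (ρ 1).unpair.2, (ρ 1).unpair.1 / ((ρ 2 + 1) * (ρ 1).unpair.2 + 1),
      by simp, ?_, ?_⟩
    · rw [h, Nat.div_add_mod']
    · rw [h]; exact Nat.mod_lt _ (by omega)
  · rintro ⟨a, b, q, h1, h2, h3⟩
    rw [h1, Nat.unpair_pair]
    simp only
    rw [h2, Nat.mul_add_mod_self_right, Nat.mod_eq_of_lt h3]

/-! ### Inductively generated sets -/

inductive Gen (B : ℕ → Prop) (R : ℕ → ℕ → ℕ → Prop) : ℕ → Prop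
  | base {x} : B x → Gen B R x
  | step {a b x} : Gen B R a → Gen B R b → R a b x → Gen B R x

def GoodSeq (B : ℕ → Prop) (R : ℕ → ℕ → ℕ → Prop) (s : ℕ → ℕ) (L : ℕ) : Prop :=
  ∀ i ≤ L, B (s i) ∨ ∃ j, ∃ k, j < i ∧ k < i ∧ R (s j) (s k) (s i)

theorem GoodSeq.gen {B R s L} (h : GoodSeq B R s L) : ∀ i ≤ L, Gen B R (s i) := by
  intro i
  induction i using Nat.strong_induction_on with
  | _ i ih =>
    intro hi
    rcases h i hi with h1 | ⟨j, k, hj, hk, hR⟩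
    · exact .base h1
    · exact .step (ih j hj (by omega)) (ih k hk (by omega)) hR

theorem Gen.seq {B R x} (h : Gen B R x) : ∃ s L, GoodSeq B R s L ∧ s L = x := by
  induction h with
  | @base x h => exact ⟨fun _ => x, 0, fun i hi => Or.inl h, rfl⟩
  | @step a b x _ _ hR ih1 ih2 =>
    obtain ⟨s, L, hs, rfl⟩ := ih1
    obtain ⟨s', L', hs', rfl⟩ := ih2
    refine ⟨fun i => if i ≤ L then s i else if i ≤ L + 1 + L' then s' (i - (L + 1)) else x,
      L + 1 + L' + 1, ?_, by simp; omega⟩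
    intro i hi
    by_cases h1 : i ≤ L
    · simp only [h1, if_true]
      rcases hs i h1 with h | ⟨j, k, hj, hk, hR⟩
      · exact Or.inl h
      · refine Or.inr ⟨j, k, hj, hk, ?_⟩
        simp only [show j ≤ L by omega, show k ≤ L by omega, if_true]
        exact hR
    · by_cases h2 : i ≤ L + 1 + L'
      · simp only [h1, h2, if_true, if_false]
        rcases hs' (i - (L + 1)) (by omega) with h | ⟨j, k, hj, hk, hR⟩
        · exact Or.inl h
        · refine Or.inr ⟨j + (L + 1), k + (L + 1), by omega, by omega, ?_⟩
          simp only [show ¬ j + (L + 1) ≤ L by omega, show ¬ k + (L + 1) ≤ L by omega,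
            show j + (L + 1) ≤ L + 1 + L' by omega, show k + (L + 1) ≤ L + 1 + L' by omega,
            if_true, if_false, Nat.add_sub_cancel]
          exact hR
      · simp only [h1, h2, if_false]
        refine Or.inr ⟨L, L + 1 + L', by omega, by omega, ?_⟩
        simp only [le_refl, if_true, show ¬ L + 1 + L' ≤ L by omega, if_false,
          show L + 1 + L' - (L + 1) = L' by omega]
        exact hR

theorem exists_beta (s : ℕ → ℕ) (L : ℕ) : ∃ c, ∀ i ≤ L, Nat.beta c i = s i := by
  refine ⟨Nat.unbeta ((List.range (L + 1)).map s), fun i hi => ?_⟩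
  have := Nat.beta_unbeta_coe ((List.range (L + 1)).map s) ⟨i, by simp; omega⟩
  simpa using this

theorem Gen.sig {B R} (hB : Sig (fun ρ => B (ρ 0))) (hR : Sig (fun ρ => R (ρ 0) (ρ 1) (ρ 2))) :
    Sig (fun ρ => Gen B R (ρ 0)) := by
  have : Sig (fun ρ => ∃ c, ∃ L, (∀ i ≤ L, B (Nat.beta c i) ∨ ∃ j, ∃ k, j < i ∧ k < i ∧
      R (Nat.beta c j) (Nat.beta c k) (Nat.beta c i)) ∧ Nat.beta c L = ρ 0) := by
    apply Sig.ex; apply Sig.ex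
    refine Sig.and (Sig.ball (Fn.var 0) (Sig.or ?_ ?_)) (Sig.eq ((Fn.var 1).beta (Fn.var 0)) (Fn.var 2))
    · exact hB.app1 ((Fn.var 2).beta (Fn.var 0))
    · apply Sig.ex; apply Sig.ex
      refine Sig.and (Sig.lt (Fn.var 1) (Fn.var 2)) (Sig.and (Sig.lt (Fn.var 0) (Fn.var 2)) ?_)
      exact hR.app3 ((Fn.var 4).beta (Fn.var 1)) ((Fn.var 4).beta (Fn.var 0))
        ((Fn.var 4).beta (Fn.var 2))
  refine this.congr fun ρ => ?_
  constructor
  · intro h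
    obtain ⟨s, L, hs, e⟩ := h.seq
    obtain ⟨c, hc⟩ := exists_beta s L
    refine ⟨c, L, ?_, by rw [hc L le_rfl, e]⟩
    intro i hi
    rcases hs i hi with h | ⟨j, k, hj, hk, hR⟩
    · left; rwa [hc i hi]
    · right
      refine ⟨j, k, hj, hk, ?_⟩
      rwa [hc i hi, hc j (by omega), hc k (by omega)]
  · rintro ⟨c, L, h, e⟩
    rw [← e]
    exact GoodSeq.gen (s := Nat.beta c) h L le_rfl

/-! ### Primitive recursive functions -/

theorem Nat.Primrec.sig {f : ℕ → ℕ} (h : Nat.Primrec f) : Sig (fun ρ => ρ 0 = f (ρ 1)) := by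
  induction h with
  | zero => exact Sig.eq (Fn.var 0) (Fn.const 0)
  | succ => exact Sig.eq (Fn.var 0) ((Fn.var 1).add (Fn.const 1))
  | left =>
    have : Sig (fun ρ => ∃ b, ρ 1 = Nat.pair (ρ 0) b) :=
      Sig.ex (Dl.pair (Tm.var 2) (Tm.var 1) (Tm.var 0)).sig
    refine this.congr fun ρ => ⟨fun h => ⟨(ρ 1).unpair.2, by rw [h]; simp⟩, ?_⟩
    rintro ⟨b, h⟩; rw [h]; simp
  | right =>
    have : Sig (fun ρ => ∃ b, ρ 1 = Nat.pair b (ρ 0)) :=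
      Sig.ex (Dl.pair (Tm.var 2) (Tm.var 0) (Tm.var 1)).sig
    refine this.congr fun ρ => ⟨fun h => ⟨(ρ 1).unpair.1, by rw [h]; simp⟩, ?_⟩
    rintro ⟨b, h⟩; rw [h]; simp
  | @pair f g _ _ ih1 ih2 =>
    exact Sig.eq (Fn.var 0) ((Fn.app1 ih1 (Fn.var 1)).pair (Fn.app1 ih2 (Fn.var 1)))
  | @comp f g _ _ ih1 ih2 => exact Sig.eq (Fn.var 0) (Fn.app1 ih1 (Fn.app1 ih2 (Fn.var 1)))
  | @prec f g _ _ ih1 ih2 =>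
    let B : ℕ → Prop := fun x => ∃ z, x = Nat.pair z (Nat.pair 0 (f z))
    let R : ℕ → ℕ → ℕ → Prop := fun a _ x => ∃ z, ∃ n, ∃ y, a = Nat.pair z (Nat.pair n y) ∧
      x = Nat.pair z (Nat.pair (n + 1) (g (Nat.pair z (Nat.pair n y))))
    have hB : Sig (fun ρ => B (ρ 0)) := by
      apply Sig.ex
      exact Sig.eq (Fn.var 1) ((Fn.var 0).pair ((Fn.const 0).pair (Fn.app1 ih1 (Fn.var 0))))
    have hR : Sig (fun ρ => R (ρ 0) (ρ 1) (ρ 2)) := by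
      apply Sig.ex; apply Sig.ex; apply Sig.ex
      have t : Fn (fun ρ => Nat.pair (ρ 2) (Nat.pair (ρ 1) (ρ 0))) :=
        (Fn.var 2).pair ((Fn.var 1).pair (Fn.var 0))
      refine Sig.and (Sig.eq (Fn.var 3) t) (Sig.eq (Fn.var 5) ((Fn.var 2).pair
        (((Fn.var 1).add (Fn.const 1)).pair (Fn.app1 ih2 t))))
    set F : ℕ → ℕ → ℕ := fun z n => n.rec (f z) (fun y IH => g (Nat.pair z (Nat.pair y IH))) with hF
    have key1 : ∀ x, Gen B R x → ∃ z n, x = Nat.pair z (Nat.pair n (F z n)) := by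
      intro x hx
      induction hx with
      | base h => obtain ⟨z, h⟩ := h; exact ⟨z, 0, h⟩
      | step _ _ hR ih1 ih2 =>
        obtain ⟨z, n, e⟩ := ih1
        obtain ⟨z', n', y', e', e''⟩ := hR
        rw [e] at e'
        simp only [Nat.pair_eq_pair] at e'
        obtain ⟨rfl, rfl, rfl⟩ := e'
        exact ⟨z, n + 1, e''⟩
    have key2 : ∀ z n, Gen B R (Nat.pair z (Nat.pair n (F z n))) := by
      intro z n
      induction n with
      | zero => exact .base ⟨z, rfl⟩
      | succ n ih => exact .step ih ih ⟨z, n, _, rfl, rfl⟩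
    have : Sig (fun ρ => ∃ z, ∃ n, ρ 1 = Nat.pair z n ∧ Gen B R (Nat.pair z (Nat.pair n (ρ 0)))) := by
      apply Sig.ex; apply Sig.ex
      exact Sig.and (Sig.eq (Fn.var 3) ((Fn.var 1).pair (Fn.var 0)))
        (Sig.app1 (Gen.sig hB hR) ((Fn.var 1).pair ((Fn.var 0).pair (Fn.var 2))))
    refine this.congr fun ρ => ?_
    constructor
    · intro h
      refine ⟨(ρ 1).unpair.1, (ρ 1).unpair.2, by simp, ?_⟩
      rw [h]
      exact key2 _ _
    · rintro ⟨z, n, e, h⟩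
      obtain ⟨z', n', e'⟩ := key1 _ h
      simp only [Nat.pair_eq_pair] at e'
      obtain ⟨rfl, rfl, e'⟩ := e'
      rw [e, e']
      simp [Nat.unpaired, hF]

theorem Primrec.fn {F : ℕ → ℕ} (h : Primrec F) {f} (hf : Fn f) : Fn (fun ρ => F (f ρ)) :=
  Fn.app1 (Nat.Primrec.sig (Primrec.nat_iff.1 h)) hf


/-! ### Horn programs -/

inductive PT : Type
  | var : ℕ → PT
  | const : ℕ → PT
  | pair : PT → PT → PT
  | pr : (f : ℕ → ℕ) → Primrec f → PT → PT

def PT.ev (ρ : ℕ → ℕ) : PT → ℕ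
  | .var n => ρ n
  | .const k => k
  | .pair s t => Nat.pair (s.ev ρ) (t.ev ρ)
  | .pr f _ t => f (t.ev ρ)

def PT.bd : PT → ℕ
  | .var n => n
  | .const _ => 0
  | .pair s t => s.bd + t.bd
  | .pr _ _ t => t.bd

theorem PT.ev_congr (p : PT) {ρ ρ' : ℕ → ℕ} (h : ∀ i ≤ p.bd, ρ i = ρ' i) : p.ev ρ = p.ev ρ' := by
  induction p with
  | var n => exact h n le_rfl
  | const k => rfl
  | pair s t ih1 ih2 =>
    simp only [PT.ev]
    rw [ih1 fun i hi => h i (by simp only [PT.bd]; omega),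
      ih2 fun i hi => h i (by simp only [PT.bd]; omega)]
  | pr f hf t ih => simp only [PT.ev]; rw [ih h]

theorem PT.fn (p : PT) {f} (hf : Fn f) : Fn (fun ρ => p.ev (Nat.beta (f ρ))) := by
  induction p with
  | var n => exact Fn.beta hf (Fn.const n)
  | const k => exact Fn.const k
  | pair s t ih1 ih2 => exact ih1.pair ih2
  | pr g hg t ih => exact Primrec.fn hg ih

structure HRule where
  p1 : PT
  p2 : PT
  c : PT

def HStep (rules : List HRule) (a b x : ℕ) : Prop :=
  ∃ r ∈ rules, ∃ ρ, a = r.p1.ev ρ ∧ b = r.p2.ev ρ ∧ x = r.c.ev ρ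

def HBase (facts : List PT) (x : ℕ) : Prop := ∃ r ∈ facts, ∃ ρ, x = r.ev ρ

theorem Sig.false : Sig (fun _ => False) := (Sig.ne (Fn.const 0) (Fn.const 0)).congr fun _ => by simp

theorem Sig.list {α : Type} {P : α → (ℕ → ℕ) → Prop} (h : ∀ a, Sig (P a)) (l : List α) :
    Sig (fun ρ => ∃ a ∈ l, P a ρ) := by
  induction l with
  | nil => exact Sig.false.congr fun _ => by simp
  | cons a l ih => exact ((h a).or ih).congr fun _ => by simp

theorem HStep.sig (rules : List HRule) : Sig (fun ρ => HStep rules (ρ 0) (ρ 1) (ρ 2)) := by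
  refine Sig.list (P := fun r σ => ∃ ρ, σ 0 = r.p1.ev ρ ∧ σ 1 = r.p2.ev ρ ∧ σ 2 = r.c.ev ρ)
    (fun r => ?_) rules
  have : Sig (fun σ => ∃ c, σ 0 = r.p1.ev (Nat.beta c) ∧ σ 1 = r.p2.ev (Nat.beta c) ∧
      σ 2 = r.c.ev (Nat.beta c)) := by
    apply Sig.ex
    exact (Sig.eq (Fn.var 1) (r.p1.fn (Fn.var 0))).and ((Sig.eq (Fn.var 2) (r.p2.fn (Fn.var 0))).and
      (Sig.eq (Fn.var 3) (r.c.fn (Fn.var 0))))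
  refine this.congr fun σ => ⟨?_, fun ⟨c, h⟩ => ⟨_, h⟩⟩
  rintro ⟨ρ, h1, h2, h3⟩
  obtain ⟨c, hc⟩ := exists_beta ρ (r.p1.bd + r.p2.bd + r.c.bd)
  refine ⟨c, ?_, ?_, ?_⟩
  · rw [h1]; exact PT.ev_congr _ fun i hi => (hc i (by omega)).symm
  · rw [h2]; exact PT.ev_congr _ fun i hi => (hc i (by omega)).symm
  · rw [h3]; exact PT.ev_congr _ fun i hi => (hc i (by omega)).symm

theorem HBase.sig (facts : List PT) : Sig (fun ρ => HBase facts (ρ 0)) := by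
  refine Sig.list (P := fun r σ => ∃ ρ, σ 0 = r.ev ρ) (fun r => ?_) facts
  have : Sig (fun σ => ∃ c, σ 0 = r.ev (Nat.beta c)) := by
    apply Sig.ex
    exact Sig.eq (Fn.var 1) (r.fn (Fn.var 0))
  refine this.congr fun σ => ⟨?_, fun ⟨c, h⟩ => ⟨_, h⟩⟩
  rintro ⟨ρ, h1⟩
  obtain ⟨c, hc⟩ := exists_beta ρ r.bd
  refine ⟨c, ?_⟩
  rw [h1]; exact PT.ev_congr _ fun i hi => (hc i (by omega)).symm

/-- Derivability in a Horn program with extra facts `B`. -/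
def Horn (B : ℕ → Prop) (facts : List PT) (rules : List HRule) : ℕ → Prop :=
  Gen (fun x => B x ∨ HBase facts x) (HStep rules)

theorem Horn.sig {B} (hB : Sig (fun ρ => B (ρ 0))) (facts rules) :
    Sig (fun ρ => Horn B facts rules (ρ 0)) :=
  Gen.sig (hB.or (HBase.sig facts)) (HStep.sig rules)

def lv (l : List ℕ) : ℕ → ℕ := fun n => l.getD n 0

theorem Horn.fact {B facts rules} (r : PT) (hr : r ∈ facts) (l : List ℕ) :
    Horn B facts rules (r.ev (lv l)) := .base (Or.inr ⟨r, hr, _, rfl⟩)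

theorem Horn.rule {B facts rules} (r : HRule) (hr : r ∈ rules) (l : List ℕ)
    (h1 : Horn B facts rules (r.p1.ev (lv l))) (h2 : Horn B facts rules (r.p2.ev (lv l))) :
    Horn B facts rules (r.c.ev (lv l)) := .step h1 h2 ⟨r, hr, _, rfl, rfl, rfl⟩

theorem Horn.rule1 {B facts rules} (r : HRule) (hr : r ∈ rules) (e : r.p2 = r.p1) (l : List ℕ)
    (h1 : Horn B facts rules (r.p1.ev (lv l))) :
    Horn B facts rules (r.c.ev (lv l)) := .rule r hr l h1 (by rw [e]; exact h1)

theorem Horn.ind {B facts rules} {X : ℕ → Prop} (hB : ∀ x, B x → X x)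
    (hf : ∀ r ∈ facts, ∀ ρ, X (r.ev ρ))
    (hr : ∀ r ∈ rules, ∀ ρ, X (r.p1.ev ρ) → X (r.p2.ev ρ) → X (r.c.ev ρ)) {x : ℕ}
    (h : Horn B facts rules x) : X x := by
  induction h with
  | base h =>
    rcases h with h | ⟨r, h1, ρ, rfl⟩
    · exact hB _ h
    · exact hf r h1 ρ
  | step _ _ hR ih1 ih2 =>
    obtain ⟨r, h1, ρ, rfl, rfl, rfl⟩ := hR
    exact hr r h1 ρ ih1 ih2


/-! ### Tautologies are Σ₁ -/

theorem primrec_pow2 : Primrec (fun x : ℕ => 2 ^ x) := by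
  have : Primrec (fun x : ℕ => (Nat.rec 1 (fun _ y => 2 * y) x : ℕ)) :=
    Primrec.nat_rec₁ 1 (Primrec.nat_mul.comp (Primrec.const 2) Primrec.snd).to₂
  refine this.of_eq fun x => ?_
  induction x with
  | zero => rfl
  | succ x ih => rw [pow_succ, ← ih]; simp [mul_comm]

theorem primrec_un {f : ℕ → ℕ → ℕ} (h : Primrec₂ f) :
    Primrec (fun p : ℕ => f p.unpair.1 p.unpair.2) :=
  h.comp (Primrec.fst.comp Primrec.unpair) (Primrec.snd.comp Primrec.unpair)

def bitN (u x : ℕ) : ℕ := u / 2 ^ x % 2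

theorem primrec_bit : Primrec₂ bitN :=
  Primrec.nat_mod.comp₂ (Primrec.nat_div.comp₂ Primrec₂.left
    ((primrec_pow2.comp Primrec.snd).to₂)) (Primrec₂.const 2)

def PT.bit (u x : PT) : PT := .pr _ (primrec_un primrec_bit) (.pair u x)
def PT.mul (u x : PT) : PT := .pr _ (primrec_un Primrec.nat_mul) (.pair u x)
def PT.max (u x : PT) : PT := .pr _ (primrec_un Primrec.nat_max) (.pair u x)
def PT.not (u : PT) : PT := .pr (fun b => 1 - b) (Primrec.nat_sub.comp (Primrec.const 1) Primrec.id) u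
def PT.succ (u : PT) : PT := .pr _ Primrec.succ u

@[simp] theorem PT.ev_var (ρ n) : (PT.var n).ev ρ = ρ n := rfl
@[simp] theorem PT.ev_const (ρ n) : (PT.const n).ev ρ = n := rfl
@[simp] theorem PT.ev_pair (ρ s t) : (PT.pair s t).ev ρ = Nat.pair (s.ev ρ) (t.ev ρ) := rfl
@[simp] theorem PT.ev_bit (ρ s t) : (PT.bit s t).ev ρ = bitN (s.ev ρ) (t.ev ρ) := by simp [PT.bit, PT.ev]
@[simp] theorem PT.ev_mul (ρ s t) : (PT.mul s t).ev ρ = (s.ev ρ) * (t.ev ρ) := by simp [PT.mul, PT.ev]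
@[simp] theorem PT.ev_max (ρ s t) : (PT.max s t).ev ρ = Max.max (s.ev ρ) (t.ev ρ) := by
  simp [PT.max, PT.ev]
@[simp] theorem PT.ev_not (ρ s) : (PT.not s).ev ρ = 1 - (s.ev ρ) := by simp [PT.not, PT.ev]
@[simp] theorem PT.ev_succ (ρ s) : (PT.succ s).ev ρ = s.ev ρ + 1 := by simp [PT.succ, PT.ev]

def jv (u x b : PT) : PT := .pair u (.pair x b)

def evAtom (k : ℕ) : PT :=
  jv (.var 0) (.pair (.const k) (.var 1)) (.bit (.var 0) (.pair (.const k) (.var 1)))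
def evNeg : HRule := ⟨jv (.var 0) (.var 1) (.var 2), jv (.var 0) (.var 1) (.var 2),
  jv (.var 0) (.pair (.const 2) (.var 1)) (.not (.var 2))⟩
def evBin (k : ℕ) (b : PT) : HRule := ⟨jv (.var 0) (.var 1) (.var 2), jv (.var 0) (.var 3) (.var 4),
  jv (.var 0) (.pair (.const k) (.pair (.var 1) (.var 3))) b⟩
def evFacts : List PT := [evAtom 0, evAtom 1, evAtom 6, evAtom 7]
def evRules : List HRule := [evNeg, evBin 3 (.mul (.var 2) (.var 4)), evBin 4 (.max (.var 2) (.var 4)),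
  evBin 5 (.max (.not (.var 2)) (.var 4))]

def EvJ (u x b : ℕ) : Prop := Horn (fun _ => False) evFacts evRules (Nat.pair u (Nat.pair x b))

open Classical in
noncomputable def tv (p : Prop) : ℕ := if p then 1 else 0

theorem tv_not (p : Prop) : tv (¬ p) = 1 - tv p := by by_cases h : p <;> simp [tv, h]
theorem tv_and (p q : Prop) : tv (p ∧ q) = tv p * tv q := by
  by_cases h : p <;> by_cases h' : q <;> simp [tv, h, h']
theorem tv_or (p q : Prop) : tv (p ∨ q) = max (tv p) (tv q) := by
  by_cases h : p <;> by_cases h' : q <;> simp [tv, h, h']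
theorem tv_imp (p q : Prop) : tv (p → q) = max (1 - tv p) (tv q) := by
  by_cases h : p <;> by_cases h' : q <;> simp [tv, h, h']
theorem tv_eq_one (p : Prop) : tv p = 1 ↔ p := by by_cases h : p <;> simp [tv, h]
theorem tv_bit (u x : ℕ) : tv (bitN u x = 1) = bitN u x := by
  have : bitN u x < 2 := Nat.mod_lt _ (by omega)
  by_cases h : bitN u x = 1
  · simp [tv, h]
  · simp [tv, h]; omega

def bval (u : ℕ) (φ : AFml) : Prop := bitN u φ.code = 1

theorem EvJ.complete (u : ℕ) (φ : AFml) : EvJ u φ.code (tv (φ.evalProp (bval u))) := by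
  have atom : ∀ k, evAtom k ∈ evFacts → ∀ y, EvJ u (Nat.pair k y) (bitN u (Nat.pair k y)) := by
    intro k hk y
    have := Horn.fact (B := fun _ => False) (rules := evRules) _ hk [u, y]
    simpa [evAtom, jv, lv, EvJ] using this
  have bin : ∀ k b, evBin k b ∈ evRules → ∀ x y c d, EvJ u x c → EvJ u y d →
      EvJ u (Nat.pair k (Nat.pair x y)) (b.ev (lv [u, x, c, y, d])) := by
    intro k b hk x y c d h1 h2
    have := Horn.rule (B := fun _ => False) (facts := evFacts) _ hk [u, x, c, y, d]
      (by simpa [evBin, jv, lv, EvJ] using h1) (by simpa [evBin, jv, lv, EvJ] using h2)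
    simpa [evBin, jv, lv, EvJ] using this
  induction φ with
  | eq t s => simp only [AFml.evalProp, bval, tv_bit]; exact atom 0 (by simp [evFacts]) _
  | le t s => simp only [AFml.evalProp, bval, tv_bit]; exact atom 1 (by simp [evFacts]) _
  | all t => simp only [AFml.evalProp, bval, tv_bit]; exact atom 6 (by simp [evFacts]) _
  | ex t => simp only [AFml.evalProp, bval, tv_bit]; exact atom 7 (by simp [evFacts]) _
  | neg φ ih =>
    simp only [AFml.evalProp, tv_not]
    have := Horn.rule1 (B := fun _ => False) (facts := evFacts) (rules := evRules) evNeg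
      (by simp [evRules]) rfl [u, φ.code, _]
      (by simpa [evNeg, jv, lv, EvJ, AFml.code] using ih)
    simpa [evNeg, jv, lv, EvJ, AFml.code] using this
  | and φ ψ ih1 ih2 =>
    simp only [AFml.evalProp, tv_and]
    simpa [lv, AFml.code] using bin 3 (.mul (.var 2) (.var 4)) (by simp [evRules]) _ _ _ _ ih1 ih2
  | or φ ψ ih1 ih2 =>
    simp only [AFml.evalProp, tv_or]
    simpa [lv, AFml.code] using bin 4 (.max (.var 2) (.var 4)) (by simp [evRules]) _ _ _ _ ih1 ih2
  | imp φ ψ ih1 ih2 =>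
    simp only [AFml.evalProp, tv_imp]
    simpa [lv, AFml.code] using bin 5 (.max (.not (.var 2)) (.var 4)) (by simp [evRules]) _ _ _ _ ih1 ih2

theorem EvJ.sound {u x b : ℕ} (h : EvJ u x b) : ∀ φ : AFml, x = φ.code → b = tv (φ.evalProp (bval u)) := by
  have key : ∀ z, Horn (fun _ => False) evFacts evRules z → ∀ u φ b,
      z = Nat.pair u (Nat.pair (AFml.code φ) b) → b = tv (φ.evalProp (bval u)) := by
    intro z hz
    refine Horn.ind (X := fun z => ∀ u φ b,
      z = Nat.pair u (Nat.pair (AFml.code φ) b) → b = tv (φ.evalProp (bval u))) ?_ ?_ ?_ hz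
    · simp
    · intro r hr ρ u φ b
      have : ∃ k, (k = 0 ∨ k = 1 ∨ k = 6 ∨ k = 7) ∧ r = evAtom k := by
        simp [evFacts] at hr; rcases hr with h | h | h | h <;> exact ⟨_, by simp, h⟩
      obtain ⟨k, hk, rfl⟩ := this
      simp only [evAtom, jv, PT.ev_pair, PT.ev_var, PT.ev_const, PT.ev_bit, Nat.pair_eq_pair]
      rintro ⟨rfl, h1, rfl⟩
      rw [h1]
      cases φ <;> simp [AFml.code, Nat.pair_eq_pair] at h1 <;>
        simp only [AFml.evalProp, bval, tv_bit] <;> omega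
    · intro r hr ρ h1 h2 u φ b
      simp only [evRules, List.mem_cons, List.not_mem_nil, or_false] at hr
      rcases hr with rfl | rfl | rfl | rfl <;>
      simp only [evNeg, evBin, jv, PT.ev_pair, PT.ev_var, PT.ev_const, PT.ev_not, PT.ev_mul,
        PT.ev_max, Nat.pair_eq_pair] at h1 h2 ⊢ <;>
      rintro ⟨rfl, e, rfl⟩ <;>
      cases φ <;> simp [AFml.code, Nat.pair_eq_pair] at e <;>
      simp only [AFml.evalProp, tv_not, tv_and, tv_or, tv_imp]
      · rw [h1 _ _ _ ⟨rfl, e, rfl⟩]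
      · rw [← h1 _ _ _ ⟨rfl, e.1, rfl⟩, ← h2 _ _ _ ⟨rfl, e.2, rfl⟩]
      · rw [← h1 _ _ _ ⟨rfl, e.1, rfl⟩, ← h2 _ _ _ ⟨rfl, e.2, rfl⟩]
      · rw [← h1 _ _ _ ⟨rfl, e.1, rfl⟩, ← h2 _ _ _ ⟨rfl, e.2, rfl⟩]
  intro φ e
  exact key _ h u φ b (by rw [e])

def TautN (x : ℕ) : Prop := ∀ u ≤ 2 ^ (x + 1), EvJ u x 1

theorem TautN.sig : Sig (fun ρ => TautN (ρ 0)) := by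
  refine Sig.ball (R := fun u ρ => EvJ u (ρ 0) 1)
    (Primrec.fn (primrec_pow2.comp Primrec.succ) (Fn.var 0)) ?_
  exact Sig.app1 (Horn.sig Sig.false evFacts evRules)
    ((Fn.var 0).pair ((Fn.var 1).pair (Fn.const 1)))

theorem evalProp_congr {v v' : AFml → Prop} (φ : AFml)
    (h : ∀ ψ : AFml, ψ.code ≤ φ.code → (v ψ ↔ v' ψ)) : φ.evalProp v ↔ φ.evalProp v' := by
  have l := Nat.left_le_pair
  have r := Nat.right_le_pair
  induction φ with
  | eq t s => exact h _ le_rfl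
  | le t s => exact h _ le_rfl
  | all φ => exact h _ le_rfl
  | ex φ => exact h _ le_rfl
  | neg φ ih => exact not_congr (ih fun ψ hψ => h ψ (hψ.trans (r _ _)))
  | and φ χ ih1 ih2 =>
    exact and_congr (ih1 fun ψ hψ => h ψ (hψ.trans ((l _ _).trans (r _ _))))
      (ih2 fun ψ hψ => h ψ (hψ.trans ((r _ _).trans (r _ _))))
  | or φ χ ih1 ih2 =>
    exact or_congr (ih1 fun ψ hψ => h ψ (hψ.trans ((l _ _).trans (r _ _))))
      (ih2 fun ψ hψ => h ψ (hψ.trans ((r _ _).trans (r _ _))))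
  | imp φ χ ih1 ih2 =>
    exact imp_congr (ih1 fun ψ hψ => h ψ (hψ.trans ((l _ _).trans (r _ _))))
      (ih2 fun ψ hψ => h ψ (hψ.trans ((r _ _).trans (r _ _))))

theorem TautN_iff (φ : AFml) : TautN φ.code ↔ ATaut φ := by
  classical
  constructor
  · intro h v
    let f : Fin (φ.code + 1) → Bool := fun i => decide (∃ ψ : AFml, ψ.code = i ∧ v ψ)
    have h1 := (h (Nat.ofBits f) (Nat.ofBits_lt_two_pow f).le).sound φ rfl
    have h2 := (tv_eq_one _).1 h1.symm
    refine (evalProp_congr φ fun ψ hψ => ?_).1 h2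
    have h3 := Nat.testBit_ofBits_lt f ψ.code (by omega)
    rw [Nat.testBit_eq_decide_div_mod_eq] at h3
    unfold bval bitN
    rw [← decide_eq_true_iff (p := _ = 1), h3, decide_eq_true_iff]
    constructor
    · rintro ⟨χ, e, hχ⟩
      rwa [← AFml.code_inj _ _ e]
    · intro h; exact ⟨ψ, rfl, h⟩
  · intro h u _
    have := EvJ.complete u φ
    rwa [(tv_eq_one _).2 (h _)] at this


/-! ### Provability is Σ₁ -/

inductive SEnv : Type
  | shift : SEnv
  | sub : ATerm → SEnv
  | up : SEnv → SEnv

def SEnv.code : SEnv → ℕ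
  | .shift => Nat.pair 0 0
  | .sub t => Nat.pair 1 t.code
  | .up e => Nat.pair 2 e.code

def SEnv.fn : SEnv → ℕ → ATerm
  | .shift => fun n => .var (n + 1)
  | .sub t => subst0Env t
  | .up e => liftSub e.fn

theorem SEnv.code_inj : ∀ e e' : SEnv, e.code = e'.code → e = e' := by
  intro e
  induction e with
  | shift => intro s h; cases s <;> simp_all [SEnv.code, Nat.pair_eq_pair]
  | sub t =>
    intro s h
    cases s <;> simp_all [SEnv.code, Nat.pair_eq_pair]
    exact ATerm.code_inj _ _ h
  | up e ih =>
    intro s h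
    cases s <;> simp [SEnv.code, Nat.pair_eq_pair] at h
    rw [ih _ h]

inductive XJ (Γ : Set AFml) (p : ℕ → Prop) : ℕ → Prop
  | env (e : SEnv) (n : ℕ) : XJ Γ p (Nat.pair 0 (Nat.pair e.code (Nat.pair n (e.fn n).code)))
  | tsub (e : SEnv) (t : ATerm) :
      XJ Γ p (Nat.pair 1 (Nat.pair e.code (Nat.pair t.code (t.substAll e.fn).code)))
  | fsub (e : SEnv) (φ : AFml) :
      XJ Γ p (Nat.pair 2 (Nat.pair e.code (Nat.pair φ.code (φ.substAll e.fn).code)))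
  | prf {φ : AFml} : Proves Γ φ → XJ Γ p (Nat.pair 3 φ.code)
  | side {x : ℕ} : p x → XJ Γ p (Nat.pair 4 x)

section
variable {Γ : Set AFml} {p : ℕ → Prop}

theorem XJ.inv0 {e n t} (h : XJ Γ p (Nat.pair 0 (Nat.pair e (Nat.pair n t)))) :
    ∃ E : SEnv, e = E.code ∧ t = (E.fn n).code := by
  generalize hx : Nat.pair 0 (Nat.pair e (Nat.pair n t)) = x at h
  cases h <;> simp [Nat.pair_eq_pair] at hx
  obtain ⟨rfl, rfl, rfl⟩ := hx
  exact ⟨_, rfl, rfl⟩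
theorem XJ.inv1 {e n t} (h : XJ Γ p (Nat.pair 1 (Nat.pair e (Nat.pair n t)))) :
    ∃ (E : SEnv) (s : ATerm), e = E.code ∧ n = s.code ∧ t = (s.substAll E.fn).code := by
  generalize hx : Nat.pair 1 (Nat.pair e (Nat.pair n t)) = x at h
  cases h <;> simp [Nat.pair_eq_pair] at hx
  obtain ⟨rfl, rfl, rfl⟩ := hx
  exact ⟨_, _, rfl, rfl, rfl⟩
theorem XJ.inv2 {e n t} (h : XJ Γ p (Nat.pair 2 (Nat.pair e (Nat.pair n t)))) :
    ∃ (E : SEnv) (s : AFml), e = E.code ∧ n = s.code ∧ t = (s.substAll E.fn).code := by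
  generalize hx : Nat.pair 2 (Nat.pair e (Nat.pair n t)) = x at h
  cases h <;> simp [Nat.pair_eq_pair] at hx
  obtain ⟨rfl, rfl, rfl⟩ := hx
  exact ⟨_, _, rfl, rfl, rfl⟩
theorem XJ.inv3 {e} (h : XJ Γ p (Nat.pair 3 e)) : ∃ φ : AFml, Proves Γ φ ∧ e = φ.code := by
  generalize hx : Nat.pair 3 e = x at h
  cases h <;> simp [Nat.pair_eq_pair] at hx
  exact ⟨_, ‹_›, hx⟩
theorem XJ.inv4 {e} (h : XJ Γ p (Nat.pair 4 e)) : p e := by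
  generalize hx : Nat.pair 4 e = x at h
  cases h <;> simp [Nat.pair_eq_pair] at hx
  rwa [hx]
end

def PT.j (k : ℕ) (e x y : PT) : PT := .pair (.const k) (.pair e (.pair x y))
def PT.p2 (k : ℕ) (x : PT) : PT := .pair (.const k) x
def PT.p3 (k : ℕ) (x y : PT) : PT := .pair (.const k) (.pair x y)
def pSh : PT := .p2 0 (.const 0)

def pvFacts : List PT := [.j 0 pSh (.var 0) (.p2 0 (.succ (.var 0)))]

def HRule.one (a c : PT) : HRule := ⟨a, a, c⟩

def rSub0 : HRule := .one (.j 1 pSh (.var 0) (.var 1)) (.j 0 (.p2 1 (.var 0)) (.const 0) (.var 0))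
def rSub1 : HRule := .one (.j 1 pSh (.var 0) (.var 1))
  (.j 0 (.p2 1 (.var 0)) (.succ (.var 2)) (.p2 0 (.var 2)))
def rUp0 : HRule := .one (.j 0 (.var 0) (.var 1) (.var 2))
  (.j 0 (.p2 2 (.var 0)) (.const 0) (.p2 0 (.const 0)))
def rUp1 : HRule := ⟨.j 0 (.var 0) (.var 1) (.var 2), .j 1 pSh (.var 2) (.var 3),
  .j 0 (.p2 2 (.var 0)) (.succ (.var 1)) (.var 3)⟩
def rVar : HRule := .one (.j 0 (.var 0) (.var 1) (.var 2)) (.j 1 (.var 0) (.p2 0 (.var 1)) (.var 2))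
def rZero : HRule := .one (.j 0 (.var 0) (.var 1) (.var 2))
  (.j 1 (.var 0) (.p2 1 (.const 0)) (.p2 1 (.const 0)))
def rSucc : HRule := .one (.j 1 (.var 0) (.var 1) (.var 2))
  (.j 1 (.var 0) (.p2 2 (.var 1)) (.p2 2 (.var 2)))
/-- binary congruence rule from judgment `i` to judgment `j`, constructor `k` -/
def rBin (i j k : ℕ) : HRule := ⟨.j i (.var 0) (.var 1) (.var 2), .j i (.var 0) (.var 3) (.var 4),
  .j j (.var 0) (.p3 k (.var 1) (.var 3)) (.p3 k (.var 2) (.var 4))⟩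
def rNeg : HRule := .one (.j 2 (.var 0) (.var 1) (.var 2))
  (.j 2 (.var 0) (.p2 2 (.var 1)) (.p2 2 (.var 2)))
def rQ (k : ℕ) : HRule := .one (.j 2 (.p2 2 (.var 0)) (.var 1) (.var 2))
  (.j 2 (.var 0) (.p2 k (.var 1)) (.p2 k (.var 2)))
def rAx : HRule := ⟨.p2 4 (.var 0), .j 2 pSh (.var 0) (.var 1), .p2 3 (.var 0)⟩
def rMp : HRule := ⟨.p2 3 (.p3 5 (.var 0) (.var 1)), .p2 3 (.var 0), .p2 3 (.var 1)⟩
def rAllE : HRule := .one (.j 2 (.p2 1 (.var 0)) (.var 1) (.var 2))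
  (.p2 3 (.p3 5 (.p2 6 (.var 1)) (.var 2)))
def rExI : HRule := .one (.j 2 (.p2 1 (.var 0)) (.var 1) (.var 2))
  (.p2 3 (.p3 5 (.var 2) (.p2 7 (.var 1))))
def rAllImp : HRule := ⟨.j 2 pSh (.var 0) (.var 1), .j 2 pSh (.var 2) (.var 3),
  .p2 3 (.p3 5 (.p2 6 (.p3 5 (.var 0) (.var 2))) (.p3 5 (.p2 6 (.var 0)) (.p2 6 (.var 2))))⟩
def rVac : HRule := .one (.j 2 pSh (.var 0) (.var 1)) (.p2 3 (.p3 5 (.var 0) (.p2 6 (.var 1))))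
def rExDef : HRule := .one (.j 2 pSh (.var 0) (.var 1))
  (.p2 3 (.p3 3 (.p3 5 (.p2 7 (.var 0)) (.p2 2 (.p2 6 (.p2 2 (.var 0)))))
    (.p3 5 (.p2 2 (.p2 6 (.p2 2 (.var 0)))) (.p2 7 (.var 0)))))
def rGen : HRule := .one (.p2 3 (.var 0)) (.p2 3 (.p2 6 (.var 0)))
def rRefl : HRule := .one (.j 1 pSh (.var 0) (.var 1)) (.p2 3 (.p3 0 (.var 0) (.var 0)))
def rEqS : HRule := ⟨.j 2 (.p2 1 (.var 0)) (.var 2) (.var 3), .j 2 (.p2 1 (.var 1)) (.var 2) (.var 4),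
  .p2 3 (.p3 5 (.p3 0 (.var 0) (.var 1)) (.p3 5 (.var 3) (.var 4)))⟩

def pvRules : List HRule := [rSub0, rSub1, rUp0, rUp1, rVar, rZero, rSucc, rBin 1 1 3, rBin 1 1 4,
  rBin 1 2 0, rBin 1 2 1, rNeg, rBin 2 2 3, rBin 2 2 4, rBin 2 2 5, rQ 6, rQ 7, rAx, rMp, rAllE, rExI,
  rAllImp, rVac, rExDef, rGen, rRefl, rEqS]

def sideB (p : ℕ → Bool) (x : ℕ) : Prop := ∃ y, x = Nat.pair 4 y ∧ (p y = true ∨ TautN y)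

def PvJ (p : ℕ → Bool) : ℕ → Prop := Horn (sideB p) pvFacts pvRules

theorem PvJ.sig {p} (hp : Primrec p) : Sig (fun ρ => PvJ p (ρ 0)) := by
  refine Horn.sig ?_ _ _
  refine Sig.ex (R := fun y ρ => ρ 0 = Nat.pair 4 y ∧ (p y = true ∨ TautN y)) ?_
  refine Sig.and (Sig.eq (Fn.var 1) ((Fn.const 4).pair (Fn.var 0))) (Sig.or ?_ TautN.sig)
  have hp' : Primrec (fun y => (p y).toNat) := (Primrec.dom_bool Bool.toNat).comp hp
  exact (Sig.eq (Primrec.fn hp' (Fn.var 0)) (Fn.const 1)).congr fun ρ => by simp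

theorem sh_eq : SEnv.code .shift = Nat.pair 0 0 := rfl

theorem PvJ.sound {Γ : Set AFml} {p : ℕ → Bool} (hp : ∀ φ : AFml, φ ∈ Γ ↔ p φ.code = true) {x : ℕ}
    (h : PvJ p x) : XJ Γ (fun y => p y = true ∨ TautN y) x := by
  refine Horn.ind (X := XJ Γ (fun y => p y = true ∨ TautN y)) ?_ ?_ ?_ h
  · rintro x ⟨y, rfl, h⟩; exact .side h
  · intro r hr ρ
    simp only [pvFacts, List.mem_cons, List.not_mem_nil, or_false] at hr
    subst hr
    exact .env .shift (ρ 0)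
  · intro r hr ρ h1 h2
    simp only [pvRules, List.mem_cons, List.not_mem_nil, or_false] at hr
    rcases hr with rfl | rfl | rfl | rfl | rfl | rfl | rfl | rfl | rfl | rfl | rfl | rfl | rfl |
      rfl | rfl | rfl | rfl | rfl | rfl | rfl | rfl | rfl | rfl | rfl | rfl | rfl | rfl <;>
    simp only [HRule.one, rSub0, rSub1, rUp0, rUp1, rVar, rZero, rSucc, rBin, rNeg, rQ, rAx, rMp,
      rAllE, rExI, rAllImp, rVac, rExDef, rGen, rRefl, rEqS, PT.j, PT.p2, PT.p3, pSh, PT.ev_pair,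
      PT.ev_var, PT.ev_const, PT.ev_succ] at h1 h2 ⊢ <;>
    generalize ρ 0 = a at * <;> generalize ρ 1 = b at * <;> generalize ρ 2 = c at * <;>
    generalize ρ 3 = d at * <;> generalize ρ 4 = e at *
    · obtain ⟨E, s, e1, rfl, rfl⟩ := h1.inv1
      exact .env (.sub s) 0
    · obtain ⟨E, s, e1, rfl, rfl⟩ := h1.inv1
      exact .env (.sub s) (c + 1)
    · obtain ⟨E, rfl, rfl⟩ := h1.inv0
      exact .env (.up E) 0
    · obtain ⟨E, rfl, rfl⟩ := h1.inv0
      obtain ⟨E', s, e1, e2, rfl⟩ := h2.inv1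
      rw [← sh_eq] at e1
      have := SEnv.code_inj _ _ e1; subst this
      have := ATerm.code_inj _ _ e2; subst this
      have := XJ.env (Γ := Γ) (p := fun y => p y = true ∨ TautN y) (.up E) (b + 1)
      simp only [SEnv.fn, liftSub, ATerm.lift_eq] at this
      exact this
    · obtain ⟨E, rfl, rfl⟩ := h1.inv0
      exact .tsub E (.var b)
    · obtain ⟨E, rfl, rfl⟩ := h1.inv0
      exact .tsub E .zero
    · obtain ⟨E, s, rfl, rfl, rfl⟩ := h1.inv1
      exact .tsub E (.succ s)
    · obtain ⟨E, s, rfl, rfl, rfl⟩ := h1.inv1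
      obtain ⟨E', s', e1, rfl, rfl⟩ := h2.inv1
      have := SEnv.code_inj _ _ e1; subst this
      exact .tsub E (.add s s')
    · obtain ⟨E, s, rfl, rfl, rfl⟩ := h1.inv1
      obtain ⟨E', s', e1, rfl, rfl⟩ := h2.inv1
      have := SEnv.code_inj _ _ e1; subst this
      exact .tsub E (.mul s s')
    · obtain ⟨E, s, rfl, rfl, rfl⟩ := h1.inv1
      obtain ⟨E', s', e1, rfl, rfl⟩ := h2.inv1
      have := SEnv.code_inj _ _ e1; subst this
      exact .fsub E (.eq s s')
    · obtain ⟨E, s, rfl, rfl, rfl⟩ := h1.inv1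
      obtain ⟨E', s', e1, rfl, rfl⟩ := h2.inv1
      have := SEnv.code_inj _ _ e1; subst this
      exact .fsub E (.le s s')
    · obtain ⟨E, s, rfl, rfl, rfl⟩ := h1.inv2
      exact .fsub E (.neg s)
    · obtain ⟨E, s, rfl, rfl, rfl⟩ := h1.inv2
      obtain ⟨E', s', e1, rfl, rfl⟩ := h2.inv2
      have := SEnv.code_inj _ _ e1; subst this
      exact .fsub E (.and s s')
    · obtain ⟨E, s, rfl, rfl, rfl⟩ := h1.inv2
      obtain ⟨E', s', e1, rfl, rfl⟩ := h2.inv2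
      have := SEnv.code_inj _ _ e1; subst this
      exact .fsub E (.or s s')
    · obtain ⟨E, s, rfl, rfl, rfl⟩ := h1.inv2
      obtain ⟨E', s', e1, rfl, rfl⟩ := h2.inv2
      have := SEnv.code_inj _ _ e1; subst this
      exact .fsub E (.imp s s')
    · obtain ⟨E, s, e1, rfl, rfl⟩ := h1.inv2
      cases E <;> simp [SEnv.code, Nat.pair_eq_pair] at e1
      subst e1
      exact .fsub _ (.all s)
    · obtain ⟨E, s, e1, rfl, rfl⟩ := h1.inv2
      cases E <;> simp [SEnv.code, Nat.pair_eq_pair] at e1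
      subst e1
      exact .fsub _ (.ex s)
    · obtain ⟨E, s, e1, rfl, rfl⟩ := h2.inv2
      rcases h1.inv4 with h | h
      · exact .prf (.ax ((hp s).2 h))
      · exact .prf (.taut ((TautN_iff s).1 h))
    · obtain ⟨φ, hφ, e1⟩ := h1.inv3
      obtain ⟨ψ, hψ, rfl⟩ := h2.inv3
      cases φ <;> simp [AFml.code, Nat.pair_eq_pair] at e1
      obtain ⟨e1, rfl⟩ := e1
      have := AFml.code_inj _ _ e1; subst this
      exact .prf (.mp hφ hψ)
    · obtain ⟨E, s, e1, rfl, rfl⟩ := h1.inv2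
      cases E <;> simp [SEnv.code, Nat.pair_eq_pair] at e1
      subst e1
      exact .prf (.allE s _)
    · obtain ⟨E, s, e1, rfl, rfl⟩ := h1.inv2
      cases E <;> simp [SEnv.code, Nat.pair_eq_pair] at e1
      subst e1
      exact .prf (.exI s _)
    · obtain ⟨E, s, e1, rfl, rfl⟩ := h1.inv2
      obtain ⟨E', s', e2, rfl, rfl⟩ := h2.inv2
      exact .prf (.allImp s s')
    · obtain ⟨E, s, e1, rfl, rfl⟩ := h1.inv2
      rw [← sh_eq] at e1
      have := SEnv.code_inj _ _ e1; subst this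
      have := Proves.vacAll (Γ := Γ) s
      rw [AFml.lift_eq] at this
      exact .prf this
    · obtain ⟨E, s, e1, rfl, rfl⟩ := h1.inv2
      exact .prf (.exDef s)
    · obtain ⟨φ, hφ, rfl⟩ := h1.inv3
      exact .prf (.gen hφ)
    · obtain ⟨E, s, e1, rfl, rfl⟩ := h1.inv1
      exact .prf (.eqRefl s)
    · obtain ⟨E, s, e1, rfl, rfl⟩ := h1.inv2
      obtain ⟨E', s', e2, e3, rfl⟩ := h2.inv2
      have := AFml.code_inj _ _ e3; subst this
      cases E <;> simp [SEnv.code, Nat.pair_eq_pair] at e1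
      cases E' <;> simp [SEnv.code, Nat.pair_eq_pair] at e2
      subst e1 e2
      exact .prf (.eqSubst s _ _)

section complete
variable {p : ℕ → Bool}


theorem PvJ.r2 (r : HRule) (hr : r ∈ pvRules) (l : List ℕ) (h1 : PvJ p (r.p1.ev (lv l)))
    (h2 : PvJ p (r.p2.ev (lv l))) : PvJ p (r.c.ev (lv l)) := Horn.rule r hr l h1 h2

theorem PvJ.tshift (t : ATerm) :
    PvJ p (Nat.pair 1 (Nat.pair (Nat.pair 0 0) (Nat.pair t.code (t.substAll (SEnv.fn .shift)).code))) := by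
  have h0 : ∀ n, PvJ p (Nat.pair 0 (Nat.pair (Nat.pair 0 0) (Nat.pair n (Nat.pair 0 (n + 1))))) :=
    fun n => Horn.fact (.j 0 pSh (.var 0) (.p2 0 (.succ (.var 0)))) (by simp [pvFacts]) [n]
  induction t with
  | var n => exact PvJ.r2 rVar (by simp [pvRules]) [_, _, _] (h0 n) (h0 n)
  | zero => exact PvJ.r2 rZero (by simp [pvRules]) [_, _, _] (h0 0) (h0 0)
  | succ t ih => exact PvJ.r2 rSucc (by simp [pvRules]) [_, _, _] ih ih
  | add t s ih1 ih2 => exact PvJ.r2 (rBin 1 1 3) (by simp [pvRules]) [_, _, _, _, _] ih1 ih2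
  | mul t s ih1 ih2 => exact PvJ.r2 (rBin 1 1 4) (by simp [pvRules]) [_, _, _, _, _] ih1 ih2

theorem PvJ.env (e : SEnv) : ∀ n,
    PvJ p (Nat.pair 0 (Nat.pair e.code (Nat.pair n (e.fn n).code))) := by
  induction e with
  | shift => exact fun n => Horn.fact (.j 0 pSh (.var 0) (.p2 0 (.succ (.var 0)))) (by simp [pvFacts]) [n]
  | sub t =>
    intro n
    cases n with
    | zero => exact PvJ.r2 rSub0 (by simp [pvRules]) [_, _] (PvJ.tshift t) (PvJ.tshift t)
    | succ n => exact PvJ.r2 rSub1 (by simp [pvRules]) [_, _, n] (PvJ.tshift t) (PvJ.tshift t)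
  | up e ih =>
    intro n
    cases n with
    | zero => exact PvJ.r2 rUp0 (by simp [pvRules]) [_, _, _] (ih 0) (ih 0)
    | succ n =>
      have := PvJ.r2 rUp1 (by simp [pvRules]) [_, _, _, _] (ih n) (PvJ.tshift (e.fn n))
      simp only [SEnv.fn, liftSub, ATerm.lift_eq]
      exact this

theorem PvJ.tsub (e : SEnv) (t : ATerm) :
    PvJ p (Nat.pair 1 (Nat.pair e.code (Nat.pair t.code (t.substAll e.fn).code))) := by
  induction t with
  | var n => exact PvJ.r2 rVar (by simp [pvRules]) [_, _, _] (PvJ.env e n) (PvJ.env e n)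
  | zero => exact PvJ.r2 rZero (by simp [pvRules]) [_, _, _] (PvJ.env e 0) (PvJ.env e 0)
  | succ t ih => exact PvJ.r2 rSucc (by simp [pvRules]) [_, _, _] ih ih
  | add t s ih1 ih2 => exact PvJ.r2 (rBin 1 1 3) (by simp [pvRules]) [_, _, _, _, _] ih1 ih2
  | mul t s ih1 ih2 => exact PvJ.r2 (rBin 1 1 4) (by simp [pvRules]) [_, _, _, _, _] ih1 ih2

theorem PvJ.fsub (φ : AFml) : ∀ e : SEnv,
    PvJ p (Nat.pair 2 (Nat.pair e.code (Nat.pair φ.code (φ.substAll e.fn).code))) := by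
  induction φ with
  | eq t s =>
    exact fun e => PvJ.r2 (rBin 1 2 0) (by simp [pvRules]) [_, _, _, _, _]
      (PvJ.tsub e t) (PvJ.tsub e s)
  | le t s =>
    exact fun e => PvJ.r2 (rBin 1 2 1) (by simp [pvRules]) [_, _, _, _, _]
      (PvJ.tsub e t) (PvJ.tsub e s)
  | neg φ ih => exact fun e => PvJ.r2 rNeg (by simp [pvRules]) [_, _, _] (ih e) (ih e)
  | and t s ih1 ih2 =>
    exact fun e => PvJ.r2 (rBin 2 2 3) (by simp [pvRules]) [_, _, _, _, _]
      (ih1 e) (ih2 e)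
  | or t s ih1 ih2 =>
    exact fun e => PvJ.r2 (rBin 2 2 4) (by simp [pvRules]) [_, _, _, _, _]
      (ih1 e) (ih2 e)
  | imp t s ih1 ih2 =>
    exact fun e => PvJ.r2 (rBin 2 2 5) (by simp [pvRules]) [_, _, _, _, _]
      (ih1 e) (ih2 e)
  | all φ ih => exact fun e => PvJ.r2 (rQ 6) (by simp [pvRules]) [_, _, _] (ih (.up e)) (ih (.up e))
  | ex φ ih => exact fun e => PvJ.r2 (rQ 7) (by simp [pvRules]) [_, _, _] (ih (.up e)) (ih (.up e))

theorem PvJ.complete {Γ : Set AFml} (hp : ∀ φ : AFml, φ ∈ Γ ↔ p φ.code = true) {φ : AFml}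
    (h : Proves Γ φ) : PvJ p (Nat.pair 3 φ.code) := by
  induction h with
  | @ax φ h =>
    have hb : PvJ p (Nat.pair 4 φ.code) := .base (Or.inl ⟨_, rfl, Or.inl ((hp φ).1 h)⟩)
    exact PvJ.r2 rAx (by simp [pvRules]) [_, _] hb (PvJ.fsub φ .shift)
  | @taut φ h =>
    have hb : PvJ p (Nat.pair 4 φ.code) := .base (Or.inl ⟨_, rfl, Or.inr ((TautN_iff φ).2 h)⟩)
    exact PvJ.r2 rAx (by simp [pvRules]) [_, _] hb (PvJ.fsub φ .shift)
  | mp _ _ ih1 ih2 => exact PvJ.r2 rMp (by simp [pvRules]) [_, _] ih1 ih2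
  | allE φ t => exact PvJ.r2 rAllE (by simp [pvRules]) [_, _, _] (PvJ.fsub φ (.sub t)) (PvJ.fsub φ (.sub t))
  | exI φ t => exact PvJ.r2 rExI (by simp [pvRules]) [_, _, _] (PvJ.fsub φ (.sub t)) (PvJ.fsub φ (.sub t))
  | allImp φ ψ => exact PvJ.r2 rAllImp (by simp [pvRules]) [_, _, _, _] (PvJ.fsub φ .shift) (PvJ.fsub ψ .shift)
  | vacAll φ =>
    rw [AFml.lift_eq]
    exact PvJ.r2 rVac (by simp [pvRules]) [_, _] (PvJ.fsub φ .shift) (PvJ.fsub φ .shift)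
  | exDef φ => exact PvJ.r2 rExDef (by simp [pvRules]) [_, _] (PvJ.fsub φ .shift) (PvJ.fsub φ .shift)
  | gen _ ih => exact PvJ.r2 rGen (by simp [pvRules]) [_] ih ih
  | eqRefl t => exact PvJ.r2 rRefl (by simp [pvRules]) [_, _] (PvJ.tsub .shift t) (PvJ.tsub .shift t)
  | eqSubst φ t s =>
    exact PvJ.r2 rEqS (by simp [pvRules]) [_, _, _, _, _] (PvJ.fsub φ (.sub t)) (PvJ.fsub φ (.sub s))

theorem provable_sig {Γ : Set AFml} (h : PrAxiomatized Γ) :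
    ∃ R : ℕ → Prop, Sig (fun ρ => R (ρ 0)) ∧ ∀ x, R x ↔ ∃ φ : AFml, Proves Γ φ ∧ x = φ.code := by
  obtain ⟨p, hp, H⟩ := h
  refine ⟨fun x => PvJ p (Nat.pair 3 x), Sig.app1 (PvJ.sig hp) ((Fn.const 3).pair (Fn.var 0)), fun x => ?_⟩
  constructor
  · intro h; exact (PvJ.sound H h).inv3
  · rintro ⟨φ, hφ, rfl⟩; exact PvJ.complete H hφ

end complete


/-! ### The clause function -/

def num : ℕ → ℕ
  | 0 => Nat.pair 1 0
  | k + 1 => Nat.pair 2 (num k)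

theorem code_numeral (k : ℕ) : (numeral k).code = num k := by
  induction k with
  | zero => rfl
  | succ k ih => simp only [numeral, ATerm.code, ih, num]

theorem le_num (k : ℕ) : k ≤ num k := by
  induction k with
  | zero => exact Nat.zero_le _
  | succ k ih =>
    have h1 : num k < Nat.pair 2 (num k) := by
      have := Nat.add_le_pair 2 (num k); omega
    simp only [num]; omega

theorem primrec_num : Primrec num := by
  have : Primrec (fun x : ℕ => (Nat.rec (Nat.pair 1 0) (fun _ y => Nat.pair 2 y) x : ℕ)) :=
    Primrec.nat_rec₁ _ (Primrec₂.natPair.comp (Primrec.const 2) Primrec.snd).to₂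
  refine this.of_eq fun x => ?_
  induction x with
  | zero => rfl
  | succ x ih => simp only [num, ← ih]

/-- code of `∃ y (y = t ∧ c)` -/
def exEqC (t c : ℕ) : ℕ := Nat.pair 7 (Nat.pair 3 (Nat.pair (Nat.pair 0 (Nat.pair (Nat.pair 0 0) t)) c))
def pcode (q k : ℕ) : ℕ := exEqC (num k) (exEqC (num q) q)

theorem primrec_exEqC : Primrec₂ exEqC := by
  unfold exEqC
  exact Primrec₂.natPair.comp₂ (Primrec₂.const 7) (Primrec₂.natPair.comp₂ (Primrec₂.const 3)
    (Primrec₂.natPair.comp₂ (Primrec₂.natPair.comp₂ (Primrec₂.const 0)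
      (Primrec₂.natPair.comp₂ (Primrec₂.const _) Primrec₂.left)) Primrec₂.right))

theorem primrec_pcode : Primrec₂ pcode := by
  unfold pcode
  exact primrec_exEqC.comp₂ (primrec_num.comp₂ Primrec₂.right)
    (primrec_exEqC.comp₂ (primrec_num.comp₂ Primrec₂.left) Primrec₂.left)

theorem lt_pcode (q k : ℕ) : k < pcode q k := by
  unfold pcode exEqC
  have h0 := le_num k
  have h1 := Nat.right_le_pair (Nat.pair 0 0) (num k)
  have h2 := Nat.right_le_pair 0 (Nat.pair (Nat.pair 0 0) (num k))
  have h3 := Nat.left_le_pair (Nat.pair 0 (Nat.pair (Nat.pair 0 0) (num k))) (exEqC (num q) q)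
  have h4 := Nat.add_le_pair 3 (Nat.pair (Nat.pair 0 (Nat.pair (Nat.pair 0 0) (num k))) (exEqC (num q) q))
  have h5 := Nat.right_le_pair 7 (Nat.pair 3 (Nat.pair (Nat.pair 0 (Nat.pair (Nat.pair 0 0) (num k))) (exEqC (num q) q)))
  unfold exEqC at *
  omega

def piter (n q a : ℕ) : ℕ := (pcode q)^[n] a

theorem primrec_piter (n : ℕ) : Primrec₂ (piter n) := by
  have : Primrec (fun p : ℕ × ℕ => (fun a => pcode p.1 a)^[n] p.2) :=
    Primrec.nat_iterate (Primrec.const n) Primrec.snd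
      (primrec_pcode.comp (Primrec.fst.comp Primrec.fst) Primrec.snd).to₂
  exact this

def pinv (q x : ℕ) : ℕ := Nat.findGreatest (fun k => pcode q k = x) x

theorem primrec_pinv : Primrec₂ pinv := by
  have : Primrec (fun p : ℕ × ℕ => Nat.findGreatest (fun k => pcode p.1 k = p.2) p.2) :=
    Primrec.nat_findGreatest Primrec.snd
      (Primrec.eq.comp (primrec_pcode.comp (Primrec.fst.comp Primrec.fst) Primrec.snd)
        (Primrec.snd.comp Primrec.fst))
  exact this

theorem pinv_spec (q k : ℕ) : pcode q (pinv q (pcode q k)) = pcode q k :=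
  Nat.findGreatest_spec (P := fun j => pcode q j = pcode q k) (lt_pcode q k).le rfl

def botC : ℕ := botFml.code
theorem botC_eq : botC = botFml.code := rfl
attribute [irreducible] botC

def Impure (q x : ℕ) : Prop :=
  (x.unpair.1 = 0 ∧ x ≠ botC) ∨ x.unpair.1 = 1 ∨ x.unpair.1 = 6 ∨
    (x.unpair.1 = 7 ∧ pcode q (pinv q x) ≠ x)

instance (q x : ℕ) : Decidable (Impure q x) := by unfold Impure; infer_instance

def i0 (x : ℕ) : ℕ := 3 * x + 1
def i1 (x : ℕ) : ℕ := 3 * x + 2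
def i2 (x : ℕ) : ℕ := 3 * x + 3

def quad (a b c d : ℕ) : ℕ := Nat.pair a (Nat.pair b (Nat.pair c d))

def clauses (m n : ℕ) : List (ℕ → ℕ → ℕ) :=
  [fun _ s => quad (i2 s) 0 (i1 (Nat.pair 2 s)) (i1 (Nat.pair 2 s)),
   fun _ s => quad (i1 s) 0 (i2 (Nat.pair 2 s)) (i2 (Nat.pair 2 s)),
   fun _ s => quad (i1 s.unpair.1) (i1 s.unpair.2) (i1 (Nat.pair 3 s)) (i1 (Nat.pair 3 s)),
   fun _ s => quad (i2 s.unpair.1) 0 (i2 (Nat.pair 3 s)) (i2 (Nat.pair 3 s)),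
   fun _ s => quad (i2 s.unpair.2) 0 (i2 (Nat.pair 3 s)) (i2 (Nat.pair 3 s)),
   fun _ s => quad (i1 s.unpair.1) 0 (i1 (Nat.pair 4 s)) (i1 (Nat.pair 4 s)),
   fun _ s => quad (i1 s.unpair.2) 0 (i1 (Nat.pair 4 s)) (i1 (Nat.pair 4 s)),
   fun _ s => quad (i2 s.unpair.1) (i2 s.unpair.2) (i2 (Nat.pair 4 s)) (i2 (Nat.pair 4 s)),
   fun _ s => quad (i2 s.unpair.1) 0 (i1 (Nat.pair 5 s)) (i1 (Nat.pair 5 s)),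
   fun _ s => quad (i1 s.unpair.2) 0 (i1 (Nat.pair 5 s)) (i1 (Nat.pair 5 s)),
   fun _ s => quad (i1 s.unpair.1) (i2 s.unpair.2) (i2 (Nat.pair 5 s)) (i2 (Nat.pair 5 s)),
   fun q s => if Impure q s then quad 0 0 (i1 s) (i1 s) else 0,
   fun q s => if Impure q s then quad 0 0 (i2 s) (i2 s) else 0,
   fun _ _ => quad 0 0 (i2 botC) (i2 botC),
   fun q s => quad (i0 s) 0 (i1 (pcode q s)) (i1 (pcode q s)),
   fun q s => quad 0 0 (i0 s) (i2 (pcode q s)),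
   fun q s => quad (i1 (pcode q s)) 0 (i0 s) (i0 s),
   fun q s => if s.unpair.1 < 8 then
     quad (i1 (piter n q s)) 0 (i1 (piter m q s)) (i1 (piter m q s)) else 0]

theorem primrec_i0 : Primrec i0 :=
  Primrec.nat_add.comp (Primrec.nat_mul.comp (Primrec.const 3) Primrec.id) (Primrec.const 1)
theorem primrec_i1 : Primrec i1 :=
  Primrec.nat_add.comp (Primrec.nat_mul.comp (Primrec.const 3) Primrec.id) (Primrec.const 2)
theorem primrec_i2 : Primrec i2 :=
  Primrec.nat_add.comp (Primrec.nat_mul.comp (Primrec.const 3) Primrec.id) (Primrec.const 3)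

theorem primrec_quad {a b c d : ℕ → ℕ → ℕ} (ha : Primrec₂ a) (hb : Primrec₂ b) (hc : Primrec₂ c)
    (hd : Primrec₂ d) : Primrec₂ (fun q s => quad (a q s) (b q s) (c q s) (d q s)) :=
  Primrec₂.natPair.comp₂ ha (Primrec₂.natPair.comp₂ hb (Primrec₂.natPair.comp₂ hc hd))

theorem primrec_u1 : Primrec₂ (fun _ s : ℕ => s.unpair.1) :=
  ((Primrec.fst.comp Primrec.unpair).comp Primrec.snd).to₂
theorem primrec_u2 : Primrec₂ (fun _ s : ℕ => s.unpair.2) :=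
  ((Primrec.snd.comp Primrec.unpair).comp Primrec.snd).to₂
theorem primrec_tag (k : ℕ) : Primrec₂ (fun _ s : ℕ => Nat.pair k s) :=
  Primrec₂.natPair.comp₂ (Primrec₂.const k) Primrec₂.right

theorem primrec_impure : PrimrecPred (fun p : ℕ × ℕ => Impure p.1 p.2) := by
  have u : Primrec (fun p : ℕ × ℕ => p.2.unpair.1) := primrec_u1
  have e : ∀ k, PrimrecPred (fun p : ℕ × ℕ => p.2.unpair.1 = k) := fun k =>
    Primrec.eq.comp u (Primrec.const k)
  have h1 : PrimrecPred (fun p : ℕ × ℕ => p.2 = botC) := Primrec.eq.comp Primrec.snd (Primrec.const _)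
  have h2 : PrimrecPred (fun p : ℕ × ℕ => pcode p.1 (pinv p.1 p.2) = p.2) :=
    Primrec.eq.comp (primrec_pcode.comp Primrec.fst primrec_pinv) Primrec.snd
  exact ((e 0).and h1.not).or ((e 1).or ((e 6).or ((e 7).and h2.not)))

set_option maxHeartbeats 1000000 in
theorem primrec_clauses (m n : ℕ) : ∀ f ∈ clauses m n, Primrec₂ f := by
  have z : Primrec₂ (fun _ _ : ℕ => 0) := Primrec₂.const 0
  have r : Primrec₂ (fun _ s : ℕ => s) := Primrec₂.right
  have t := primrec_tag
  have a1 : Primrec₂ (fun _ s : ℕ => i1 s.unpair.1) := primrec_i1.comp₂ primrec_u1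
  have a2 : Primrec₂ (fun _ s : ℕ => i2 s.unpair.1) := primrec_i2.comp₂ primrec_u1
  have b1 : Primrec₂ (fun _ s : ℕ => i1 s.unpair.2) := primrec_i1.comp₂ primrec_u2
  have b2 : Primrec₂ (fun _ s : ℕ => i2 s.unpair.2) := primrec_i2.comp₂ primrec_u2
  have t1 : ∀ k, Primrec₂ (fun _ s : ℕ => i1 (Nat.pair k s)) := fun k => primrec_i1.comp₂ (t k)
  have t2 : ∀ k, Primrec₂ (fun _ s : ℕ => i2 (Nat.pair k s)) := fun k => primrec_i2.comp₂ (t k)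
  have pc1 : Primrec₂ (fun q s : ℕ => i1 (pcode q s)) := primrec_i1.comp₂ primrec_pcode
  have pc2 : Primrec₂ (fun q s : ℕ => i2 (pcode q s)) := primrec_i2.comp₂ primrec_pcode
  have s0 : Primrec₂ (fun _ s : ℕ => i0 s) := primrec_i0.comp₂ r
  have s1 : Primrec₂ (fun _ s : ℕ => i1 s) := primrec_i1.comp₂ r
  have s2 : Primrec₂ (fun _ s : ℕ => i2 s) := primrec_i2.comp₂ r
  have bb : Primrec₂ (fun _ _ : ℕ => i2 botC) := Primrec₂.const (i2 botC)
  simp only [clauses, List.forall_mem_cons]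
  refine ⟨?_, ?_, ?_, ?_, ?_, ?_, ?_, ?_, ?_, ?_, ?_, ?_, ?_, ?_, ?_, ?_, ?_, ?_, ?_⟩
  · exact primrec_quad s2 z (t1 2) (t1 2)
  · exact primrec_quad s1 z (t2 2) (t2 2)
  · exact primrec_quad a1 b1 (t1 3) (t1 3)
  · exact primrec_quad a2 z (t2 3) (t2 3)
  · exact primrec_quad b2 z (t2 3) (t2 3)
  · exact primrec_quad a1 z (t1 4) (t1 4)
  · exact primrec_quad b1 z (t1 4) (t1 4)
  · exact primrec_quad a2 b2 (t2 4) (t2 4)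
  · exact primrec_quad a2 z (t1 5) (t1 5)
  · exact primrec_quad b1 z (t1 5) (t1 5)
  · exact primrec_quad a1 b2 (t2 5) (t2 5)
  · exact Primrec.ite primrec_impure (primrec_quad z z s1 s1) z
  · exact Primrec.ite primrec_impure (primrec_quad z z s2 s2) z
  · exact primrec_quad z z bb bb
  · exact primrec_quad s0 z pc1 pc1
  · exact primrec_quad z z s0 pc2
  · exact primrec_quad pc1 z s0 s0
  · exact Primrec.ite (Primrec.nat_lt.comp primrec_u1 (Primrec.const 8))
      (primrec_quad (primrec_i1.comp₂ (primrec_piter n)) z (primrec_i1.comp₂ (primrec_piter m))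
        (primrec_i1.comp₂ (primrec_piter m))) z
  · simp

def selL (l : List (ℕ → ℕ → ℕ)) (t q s : ℕ) : ℕ := (l.getD t (fun _ _ => 0)) q s

theorem primrec_selL (l : List (ℕ → ℕ → ℕ)) (h : ∀ f ∈ l, Primrec₂ f) :
    Primrec (fun p : ℕ × (ℕ × ℕ) => selL l p.1 p.2.1 p.2.2) := by
  induction l with
  | nil => exact (Primrec.const 0).of_eq fun p => by simp [selL]
  | cons f l ih =>
    have h1 : Primrec (fun p : ℕ × (ℕ × ℕ) => f p.2.1 p.2.2) :=
      Primrec.comp (h f (by simp)) Primrec.snd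
    have h2 := (ih fun g hg => h g (by simp [hg])).comp
      (Primrec.pair (Primrec.pred.comp Primrec.fst) Primrec.snd)
    refine (Primrec.ite (Primrec.eq.comp Primrec.fst (Primrec.const 0)) h1 h2).of_eq fun p => ?_
    obtain ⟨t, q, s⟩ := p
    cases t <;> simp [selL]

def cl (m n q i : ℕ) : ℕ := selL (clauses m n) (i % 32) q (i / 32)

theorem primrec_cl (m n : ℕ) : Primrec (fun p : ℕ => cl m n p.unpair.1 p.unpair.2) := by
  have h1 : Primrec (fun p : ℕ => p.unpair.1) := Primrec.fst.comp Primrec.unpair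
  have h2 : Primrec (fun p : ℕ => p.unpair.2) := Primrec.snd.comp Primrec.unpair
  exact (primrec_selL _ (primrec_clauses m n)).comp
    (Primrec.pair (Primrec.nat_mod.comp h2 (Primrec.const 32))
      (Primrec.pair h1 (Primrec.nat_div.comp h2 (Primrec.const 32))))

theorem cl_eq (m n q s t : ℕ) (ht : t < 32) : cl m n q (32 * s + t) = selL (clauses m n) t q s := by
  unfold cl
  rw [show (32 * s + t) % 32 = t by omega, show (32 * s + t) / 32 = s by omega]

/-! ### Codes of finite sets -/

def facN : ℕ → ℕ
  | 0 => 1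
  | k + 1 => (k + 1) * facN k
def prodN (d : ℕ) : ℕ → ℕ
  | 0 => 1
  | k + 1 => (1 + (k + 1) * d) * prodN d k

def bigF (z : ℕ) : ℕ :=
  Nat.pair (prodN (facN (3 * z + 4)) (3 * z + 4)) (facN (3 * z + 4)) + 1

theorem primrec_facN : Primrec facN := by
  have : Primrec (fun x : ℕ => (Nat.rec 1 (fun k y => (k + 1) * y) x : ℕ)) :=
    Primrec.nat_rec₁ _ (Primrec.nat_mul.comp (Primrec.succ.comp Primrec.fst) Primrec.snd).to₂
  refine this.of_eq fun x => ?_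
  induction x with
  | zero => rfl
  | succ x ih => simp only [facN, ← ih]

theorem primrec_prodN : Primrec₂ prodN := by
  have : Primrec₂ (fun d x : ℕ => (Nat.rec 1 (fun k y => (1 + (k + 1) * d) * y) x : ℕ)) := by
    refine Primrec.nat_rec (f := fun _ => 1) (g := fun d p => (1 + (p.1 + 1) * d) * p.2) (Primrec.const 1) ?_
    exact Primrec.nat_mul.comp (Primrec.nat_add.comp (Primrec.const 1)
      (Primrec.nat_mul.comp (Primrec.succ.comp (Primrec.fst.comp Primrec.snd)) Primrec.fst))
      (Primrec.snd.comp Primrec.snd)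
  refine this.of_eq fun d x => ?_
  induction x with
  | zero => rfl
  | succ x ih => simp only [prodN, ← ih]

theorem primrec_bigF : Primrec bigF := by
  have h : Primrec (fun z : ℕ => 3 * z + 4) :=
    Primrec.nat_add.comp (Primrec.nat_mul.comp (Primrec.const 3) Primrec.id) (Primrec.const 4)
  exact Primrec.succ.comp (Primrec₂.natPair.comp (primrec_prodN.comp (primrec_facN.comp h) h)
    (primrec_facN.comp h))

def InS (u i : ℕ) : Prop := (1 + (i + 1) * u.unpair.2) ∣ u.unpair.1

open Classical in
theorem exists_code (A : Set ℕ) (z : ℕ) :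
    ∃ u, z ≤ u ∧ u < bigF z ∧ ∀ i ≤ 3 * z + 3, InS u i ↔ i ∈ A := by
  set B := 3 * z + 4 with hB
  set d := facN B with hd
  have hdvd : ∀ N, ∀ k, 1 ≤ k → k ≤ N → k ∣ facN N := by
    intro N
    induction N with
    | zero => intro k h1 h2; omega
    | succ N ih =>
      intro k h1 h2
      rcases Nat.lt_or_ge k (N + 1) with h | h
      · exact (ih k h1 (by omega)).mul_left _
      · have : k = N + 1 := by omega
        subst this; exact Dvd.intro _ rfl
  have hpos : ∀ N, 0 < facN N := by
    intro N
    induction N with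
    | zero => simp [facN]
    | succ N ih => simp only [facN]; positivity
  have hdB : B ≤ d := Nat.le_of_dvd (hpos B) (hdvd B B (by omega) le_rfl)
  have cop : ∀ i j, i < j → j < B → Nat.Coprime (1 + (i + 1) * d) (1 + (j + 1) * d) := by
    intro i j hij hj
    refine Nat.coprime_of_dvd fun p hp h1 h2 => ?_
    have h3 : p ∣ (j - i) * d := by
      have := Nat.dvd_sub h2 h1
      rwa [show 1 + (j + 1) * d - (1 + (i + 1) * d) = (j - i) * d by
        rw [Nat.add_sub_add_left, ← Nat.sub_mul]; congr 1; omega] at this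
    have h4 : p ∣ d := by
      rcases (Nat.Prime.dvd_mul hp).1 h3 with h | h
      · exact h.trans (hdvd B _ (by omega) (by omega))
      · exact h
    have h5 : p ∣ 1 := (Nat.dvd_add_left (h4.mul_left _)).1 h1
    exact hp.one_lt.ne' (Nat.dvd_one.1 h5)
  -- the partial products
  have key : ∀ N ≤ B, ∃ c, 0 < c ∧ c ≤ prodN d N ∧ (∀ i < N, (1 + (i + 1) * d) ∣ c ↔ i ∈ A) ∧
      ∀ j, N ≤ j → j < B → Nat.Coprime (1 + (j + 1) * d) c := by
    intro N
    induction N with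
    | zero => intro _; exact ⟨1, by omega, by simp [prodN], by simp, by simp⟩
    | succ N ih =>
      intro hN
      obtain ⟨c, h0, h1, h2, h3⟩ := ih (by omega)
      have hm : 0 < (N + 1) * d := Nat.mul_pos (by omega) (hpos B)
      by_cases hA : N ∈ A
      · refine ⟨(1 + (N + 1) * d) * c, by positivity, Nat.mul_le_mul_left _ h1, ?_, ?_⟩
        · intro i hi
          rcases Nat.lt_or_ge i N with h | h
          · rw [(cop i N h (by omega)).dvd_mul_left]; exact h2 i h
          · have : i = N := by omega
            subst this; simp [hA]
        · intro j hj hjB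
          exact Nat.Coprime.mul_right (cop N j (by omega) hjB).symm (h3 j (by omega) hjB)
      · refine ⟨c, h0, h1.trans (Nat.le_mul_of_pos_left _ (by omega)), ?_, fun j hj => h3 j (by omega)⟩
        intro i hi
        rcases Nat.lt_or_ge i N with h | h
        · exact h2 i h
        · have : i = N := by omega
          subst this
          simp only [hA, iff_false]
          intro hdv
          have := Nat.Coprime.eq_one_of_dvd (h3 i le_rfl (by omega)) hdv
          omega
  obtain ⟨c, h0, h1, h2, _⟩ := key B le_rfl
  refine ⟨Nat.pair c d, ?_, ?_, ?_⟩
  · have := Nat.right_le_pair c d; omega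
  · unfold bigF
    rw [← hB, ← hd]
    rcases h1.lt_or_eq with h | h
    · exact (Nat.pair_lt_pair_left d h).trans (Nat.lt_succ_self _)
    · rw [h]; exact Nat.lt_succ_self _
  · intro i hi
    simp only [InS, Nat.unpair_pair]
    exact h2 i (by omega)


/-- The `Δ₀` building blocks of the predicate, with their meaning in the standard model. -/
structure Dat (Tax : Set AFml) (m n : ℕ) where
  CD : AFml
  ThD : AFml
  DTh : AFml
  SS : AFml
  del : AFml
  hCD : IsDelta0 CD
  hThD : IsDelta0 ThD
  hDTh : IsDelta0 DTh
  hSS : IsDelta0 SS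
  hdel : IsDelta0 del
  cd : ∀ q i a b c d, quad a b c d = cl m n q i ↔ ∃ w, CD.Ev natStr (natStr.env [q, i, a, b, c, d, w])
  thd1 : ∀ q z x, ThD.Ev natStr (natStr.env [q, z, x]) → ∃ φ, Proves Tax φ ∧ x = φ.code
  thd2 : ∀ q z x, ThD.Ev natStr (natStr.env [q, z, x]) → ∀ i ≤ 32 * x + 31, ∃ a ≤ z, ∃ b ≤ z,
    ∃ c ≤ z, ∃ d ≤ z, ∃ w ≤ z, CD.Ev natStr (natStr.env [q, i, a, b, c, d, w])
  thd2' : ∀ q z x, ThD.Ev natStr (natStr.env [q, z, x]) → 32 * x + 31 ≤ z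
  thd3 : ∀ q φ, Proves Tax φ → ∃ z, ThD.Ev natStr (natStr.env [q, z, φ.code])
  dth1 : ∀ q w x, DTh.Ev natStr (natStr.env [q, w, x]) →
    ∃ z, ThD.Ev natStr (natStr.env [q, z, x]) ∧ ∀ z0 ≤ z, bigF z0 ≤ w
  dth2 : ∀ q z x, ThD.Ev natStr (natStr.env [q, z, x]) → ∃ w, DTh.Ev natStr (natStr.env [q, w, x])
  ss : ∀ u i, SS.Ev natStr (natStr.env [u, i]) ↔ InS u i
  del1 : ∀ (M : Type) (S : PStr M), Models S Tax → ∃ u, del.Ev S (S.env [u])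
  del2 : ∀ u, ¬ del.Ev natStr (natStr.env [u])

theorem exists_dat (Tax : Set AFml) (hext : PA ⊆ Tax) (hpr : PrAxiomatized Tax)
    (hill : ¬ Sigma1Sound Tax) (m n : ℕ) : Nonempty (Dat Tax m n) := by
  obtain ⟨del, hdel, del1, del2⟩ := exists_bad hext hill
  obtain ⟨R, ⟨Th, hTh, ThS⟩, hR⟩ := provable_sig hpr
  have hcd : Sig (fun ρ => Nat.pair (ρ 2) (Nat.pair (ρ 3) (Nat.pair (ρ 4) (ρ 5))) =
      (fun p : ℕ => cl m n p.unpair.1 p.unpair.2) (Nat.pair (ρ 0) (ρ 1))) :=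
    Sig.eq ((Fn.var 2).pair ((Fn.var 3).pair ((Fn.var 4).pair (Fn.var 5))))
      (PLN.Primrec.fn (primrec_cl m n) ((Fn.var 0).pair (Fn.var 1)))
  obtain ⟨Cd, ⟨CDf, hCDf, CDfe⟩, CdS⟩ := hcd
  have hbig : Sig (fun ρ => ∀ z ≤ ρ 0, bigF z ≤ ρ 1) :=
    Sig.ballT (R := fun z ρ => bigF z ≤ ρ 1) (Tm.var 0)
      (Sig.le (PLN.Primrec.fn primrec_bigF (Fn.var 0)) (Fn.var 2))
  obtain ⟨Bg, hBg, BgS⟩ := hbig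
  have hss : Dl (fun ρ => ∃ c ≤ ρ 0, ∃ d ≤ ρ 0, ρ 0 = Nat.pair c d ∧ ∃ e ≤ c,
      c = (1 + (ρ 1 + 1) * d) * e) := by
    refine Dl.bex (R := fun c ρ => ∃ d ≤ ρ 0, ρ 0 = Nat.pair c d ∧ ∃ e ≤ c,
      c = (1 + (ρ 1 + 1) * d) * e) (Tm.var 0) ?_
    refine Dl.bex (R := fun d ρ => ρ 1 = Nat.pair (ρ 0) d ∧ ∃ e ≤ ρ 0,
      ρ 0 = (1 + (ρ 2 + 1) * d) * e) (Tm.var 1) ?_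
    refine (Dl.pair (Tm.var 2) (Tm.var 1) (Tm.var 0)).and ?_
    refine Dl.bex (R := fun e ρ => ρ 1 = (1 + (ρ 3 + 1) * ρ 0) * e) (Tm.var 1) ?_
    exact Dl.eq (Tm.var 2) (((Tm.const 1).add (((Tm.var 4).add (Tm.const 1)).mul (Tm.var 1))).mul
      (Tm.var 0))
  obtain ⟨SS, hSS, SSe⟩ := hss
  -- `ThD`, variables `[q, z, x]`
  let cdR : ℕ → ℕ → ℕ → ℕ → ℕ → ℕ → ℕ → Prop := fun q i a b c d w =>
    CDf.Ev natStr (natStr.env [w, q, i, a, b, c, d])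
  obtain ⟨dC, hdC⟩ := CDf.exists_FreeLt
  have hcdR : Dl (fun ρ => CDf.Ev natStr (natStr.env [ρ 6, ρ 0, ρ 1, ρ 2, ρ 3, ρ 4, ρ 5])) :=
    ⟨CDf.inst [.var 6, .var 0, .var 1, .var 2, .var 3, .var 4, .var 5], hCDf.inst _,
      fun ρ => by rw [Ev_inst]; rfl⟩
  have hcdR' : Dl (fun ρ => cdR (ρ 0) (ρ 1) (ρ 2) (ρ 3) (ρ 4) (ρ 5) (ρ 6)) := hcdR
  have cdS : ∀ q i a b c d, quad a b c d = cl m n q i ↔ ∃ w, cdR q i a b c d w := by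
    intro q i a b c d
    have := CdS (natStr.env [q, i, a, b, c, d])
    simp only [Nat.unpair_pair] at this
    refine (Iff.trans Iff.rfl this).trans (exists_congr fun w => ?_)
    have h2 := CDfe (mcons w (natStr.env [q, i, a, b, c, d]))
    rw [mcons_env] at h2
    exact h2
  have thS : ∀ x, R x ↔ ∃ w, Th w (fun _ => x) := fun x => ThS (fun _ => x)
  have hth : Dl (fun ρ => Th (ρ 1) (fun _ => ρ 0)) := hTh.ren (fun i => if i = 0 then 1 else 0)
  let thd : ℕ → ℕ → ℕ → Prop := fun q z x => (32 * x + 31 ≤ z ∧ ∃ w ≤ z, Th w (fun _ => x)) ∧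
    ∀ i ≤ 32 * x + 31, ∃ a ≤ z, ∃ b ≤ z, ∃ c ≤ z, ∃ d ≤ z, ∃ w ≤ z, cdR q i a b c d w
  have hthd : Dl (fun ρ => thd (ρ 0) (ρ 1) (ρ 2)) := by
    have t : Tm (fun ρ => 32 * ρ 2 + 31) := ((Tm.const 32).mul (Tm.var 2)).add (Tm.const 31)
    refine ((Dl.le t (Tm.var 1)).and ?_).and ?_
    · refine Dl.bex (R := fun w ρ => Th w (fun _ => ρ 2)) (Tm.var 1) ?_
      exact hth.ren (fun i => if i = 0 then 3 else 0)
    · refine Dl.ball (R := fun i ρ => ∃ a ≤ ρ 1, ∃ b ≤ ρ 1, ∃ c ≤ ρ 1, ∃ d ≤ ρ 1, ∃ w ≤ ρ 1,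
        cdR (ρ 0) i a b c d w) t ?_
      refine Dl.bex (R := fun a ρ => ∃ b ≤ ρ 2, ∃ c ≤ ρ 2, ∃ d ≤ ρ 2, ∃ w ≤ ρ 2,
        cdR (ρ 1) (ρ 0) a b c d w) (Tm.var 2) ?_
      refine Dl.bex (R := fun b ρ => ∃ c ≤ ρ 3, ∃ d ≤ ρ 3, ∃ w ≤ ρ 3,
        cdR (ρ 2) (ρ 1) (ρ 0) b c d w) (Tm.var 3) ?_
      refine Dl.bex (R := fun c ρ => ∃ d ≤ ρ 4, ∃ w ≤ ρ 4,
        cdR (ρ 3) (ρ 2) (ρ 1) (ρ 0) c d w) (Tm.var 4) ?_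
      refine Dl.bex (R := fun d ρ => ∃ w ≤ ρ 5,
        cdR (ρ 4) (ρ 3) (ρ 2) (ρ 1) (ρ 0) d w) (Tm.var 5) ?_
      refine Dl.bex (R := fun w ρ =>
        cdR (ρ 5) (ρ 4) (ρ 3) (ρ 2) (ρ 1) (ρ 0) w) (Tm.var 6) ?_
      exact hcdR'.ren (fun i => [6, 5, 4, 3, 2, 1, 0].getD i 0)
  have hbgD : Dl (fun ρ => Bg (ρ 0) (fun i => if i = 0 then ρ 1 else ρ 2)) := by
    have := hBg.ren (fun i => if i = 0 then 0 else if i = 1 then 1 else 2)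
    refine this.congr fun ρ => ?_
    have : (fun i => if i = 0 then ρ 1 else ρ 2) =
        tl (fun n => ρ (if n = 0 then 0 else if n = 1 then 1 else 2)) := by
      funext i; simp only [tl]; by_cases hi : i = 0 <;> simp [hi]
    rw [this]; exact Iff.rfl
  let bgR : ℕ → ℕ → ℕ → Prop := fun w z y => Bg w (fun i => if i = 0 then z else y)
  have bgS : ∀ z y, (∀ z' ≤ z, bigF z' ≤ y) ↔ ∃ w, bgR w z y := fun z y =>
    BgS (fun i => if i = 0 then z else y)
  have hbgR : Dl (fun ρ => bgR (ρ 0) (ρ 1) (ρ 2)) := hbgD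
  let dth : ℕ → ℕ → ℕ → Prop := fun q w x =>
    ∃ z ≤ w, thd q z x ∧ ∃ w' ≤ w, ∃ y ≤ w, bgR w' z y
  have hdth : Dl (fun ρ => dth (ρ 0) (ρ 1) (ρ 2)) := by
    refine Dl.bex (R := fun z ρ => thd (ρ 0) z (ρ 2) ∧ ∃ w' ≤ ρ 1, ∃ y ≤ ρ 1, bgR w' z y) (Tm.var 1) ?_
    refine Dl.and (hthd.ren (fun i => [1, 0, 3].getD i 0)) ?_
    refine Dl.bex (R := fun w' ρ => ∃ y ≤ ρ 2, bgR w' (ρ 0) y) (Tm.var 2) ?_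
    refine Dl.bex (R := fun y ρ => bgR (ρ 0) (ρ 1) y) (Tm.var 3) ?_
    exact hbgR.ren (fun i => [1, 2, 0].getD i 0)
  obtain ⟨CD, hCD, CDe⟩ := hcdR'
  obtain ⟨ThD, hThD, ThDe⟩ := hthd
  obtain ⟨DTh, hDTh, DThe⟩ := hdth
  have CDe' : ∀ q i a b c d w, CD.Ev natStr (natStr.env [q, i, a, b, c, d, w]) ↔ cdR q i a b c d w :=
    fun q i a b c d w => (CDe _).symm
  have ThDe' : ∀ q z x, ThD.Ev natStr (natStr.env [q, z, x]) ↔ thd q z x :=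
    fun q z x => (ThDe _).symm
  have DThe' : ∀ q z x, DTh.Ev natStr (natStr.env [q, z, x]) ↔ dth q z x :=
    fun q z x => (DThe _).symm
  refine ⟨⟨CD, ThD, DTh, SS, del, hCD, hThD, hDTh, hSS, hdel, ?_, ?_, ?_, ?_, ?_, ?_, ?_, ?_,
    del1, del2⟩⟩
  · intro q i a b c d
    simp only [CDe']; exact cdS q i a b c d
  · intro q z x h
    obtain ⟨⟨_, w, _, hw⟩, _⟩ := (ThDe' q z x).1 h
    exact (hR x).1 ((thS x).2 ⟨w, hw⟩)
  · intro q z x h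
    simp only [CDe']
    exact ((ThDe' q z x).1 h).2
  · intro q z x h
    exact ((ThDe' q z x).1 h).1.1
  · intro q φ hφ
    obtain ⟨w, hw⟩ := (thS φ.code).1 ((hR _).2 ⟨φ, hφ, rfl⟩)
    obtain ⟨W, hW⟩ := collect (P := fun i z => ∃ a ≤ z, ∃ b ≤ z, ∃ c ≤ z, ∃ d ≤ z, ∃ w ≤ z,
        cdR q i a b c d w) (32 * φ.code + 31) (by
      intro i _
      obtain ⟨w, hw⟩ := (cdS q i (cl m n q i).unpair.1 (cl m n q i).unpair.2.unpair.1
        (cl m n q i).unpair.2.unpair.2.unpair.1 (cl m n q i).unpair.2.unpair.2.unpair.2).1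
        (by simp [quad])
      refine ⟨(cl m n q i).unpair.1 + (cl m n q i).unpair.2.unpair.1 +
        (cl m n q i).unpair.2.unpair.2.unpair.1 + (cl m n q i).unpair.2.unpair.2.unpair.2 + w,
        _, ?_, _, ?_, _, ?_, _, ?_, w, ?_, hw⟩ <;> omega)
    refine ⟨32 * φ.code + 31 + w + W, (ThDe' _ _ _).2 ⟨⟨by omega, w, by omega, hw⟩, ?_⟩⟩
    intro i hi
    obtain ⟨z, hz, a, ha, b, hb, c, hc, d, hd, w, hw, h⟩ := hW i hi
    exact ⟨a, by omega, b, by omega, c, by omega, d, by omega, w, by omega, h⟩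
  · intro q w x h
    obtain ⟨z, _, h1, w', _, y, hy, hb⟩ := (DThe' q w x).1 h
    exact ⟨z, (ThDe' _ _ _).2 h1, fun z0 hz0 => ((bgS z y).2 ⟨w', hb⟩ z0 hz0).trans hy⟩
  · intro q z x h
    obtain ⟨W, hW⟩ := collect (P := fun z w => w = bigF z) z (fun a _ => ⟨_, rfl⟩)
    obtain ⟨w', hw'⟩ := (bgS z W).1 (fun z' hz' => by
      obtain ⟨w, hw, rfl⟩ := hW z' hz'; exact hw)
    exact ⟨z + w' + W, (DThe' _ _ _).2 ⟨z, by omega, (ThDe' _ _ _).1 h, w', by omega, W, by omega, hw'⟩⟩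
  · intro u i
    refine (SSe _).symm.trans ?_
    show (∃ c ≤ u, ∃ d ≤ u, u = Nat.pair c d ∧ ∃ e ≤ c, c = (1 + (i + 1) * d) * e) ↔ _
    constructor
    · rintro ⟨c, _, d, _, rfl, e, _, rfl⟩
      simp only [InS, Nat.unpair_pair]
      exact Dvd.intro _ rfl
    · rintro ⟨e, he⟩
      refine ⟨u.unpair.1, Nat.unpair_left_le u, u.unpair.2, Nat.unpair_right_le u,
        (Nat.pair_unpair u).symm, e, ?_, he⟩
      rw [he]; exact Nat.le_mul_of_pos_left _ (by omega)


/-! ### The predicate -/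

section
variable {Tax : Set AFml} {m n : ℕ} (D : Dat Tax m n)

def tI (k : ℕ) (t : ATerm) : ATerm := .add (.mul (numeral 3) t) (numeral k)

/-- variables `[u, q]` -/
def Dat.E : AFml :=
  .or (D.del.inst [.var 0]) (AFml.bex (.var 0) (.and (D.SS.inst [.var 1, .zero]) (.and
    (AFml.bex (.var 0) (.and (D.ThD.inst [.var 3, .var 1, .var 0])
      (.neg (D.SS.inst [.var 2, tI 2 (.var 0)]))))
    (.and (AFml.ball (.var 0) (AFml.ball (.var 1) (AFml.ball (.var 2) (AFml.ball (.var 3)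
        (AFml.ball (.var 4) (AFml.ball (.var 5)
          (.imp (D.CD.inst [.var 8, .var 5, .var 3, .var 2, .var 1, .var 0, .var 4])
            (.imp (D.SS.inst [.var 7, .var 3]) (.imp (D.SS.inst [.var 7, .var 2])
              (.or (D.SS.inst [.var 7, .var 1]) (D.SS.inst [.var 7, .var 0])))))))))))
      (AFml.ball (.var 1) (AFml.ball (.var 1) (.imp (D.DTh.inst [.var 4, .var 1, .var 0])
        (D.SS.inst [.var 3, tI 1 (.var 0)]))))))))

/-- variables `[q, x]` -/
def Dat.Q0 : AFml :=
  .or (.ex (.and (D.DTh.inst [.var 1, .var 0, .var 2])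
      (AFml.ball (.var 0) (.neg (D.E.inst [.var 0, .var 2])))))
    (.ex (.and (D.E.inst [.var 0, .var 1]) (.and
      (AFml.ball (.var 0) (.imp (D.E.inst [.var 0, .var 2]) (.eq (.var 0) (.var 1))))
      (.or (D.del.inst [.var 0]) (D.SS.inst [.var 0, tI 1 (.var 2)])))))

def Dat.q : ℕ := D.Q0.code
theorem Dat.q_eq : D.q = D.Q0.code := rfl
attribute [irreducible] Dat.q
def Dat.Q : AFml := .ex (.and (.eq (.var 0) (numeral D.q)) D.Q0)
def Dat.P : AFml := .ex (.and (.eq (.var 0) (.var 1)) D.Q)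

theorem Dat.E_delta0 : IsDelta0 D.E := by
  unfold Dat.E
  refine .or (D.hdel.inst _) (.bex' _ (.and (D.hSS.inst _) (.and (.bex' _ (.and (D.hThD.inst _)
    (.neg (D.hSS.inst _)))) (.and ?_ (.ball' _ (.ball' _ (.imp (D.hDTh.inst _) (D.hSS.inst _))))))))
  exact .ball' _ (.ball' _ (.ball' _ (.ball' _ (.ball' _ (.ball' _ (.imp (D.hCD.inst _)
    (.imp (D.hSS.inst _) (.imp (D.hSS.inst _) (.or (D.hSS.inst _) (D.hSS.inst _))))))))))

theorem Dat.P_sigma1 : IsSigma1 D.P := by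
  unfold Dat.P Dat.Q Dat.Q0
  refine .ex (.and (.delta0 (.eq _ _)) (.ex (.and (.delta0 (.eq _ _)) (.or (.ex (.delta0 ?_))
    (.ex (.delta0 ?_))))))
  · exact .and (D.hDTh.inst _) (.ball' _ (.neg (D.E_delta0.inst _)))
  · exact .and (D.E_delta0.inst _) (.and (.ball' _ (.imp (D.E_delta0.inst _) (.eq _ _)))
      (.or (D.hdel.inst _) (D.hSS.inst _)))

theorem numeral_FreeLt (k c : ℕ) : (numeral k).FreeLt c := by
  induction k with
  | zero => trivial
  | succ k ih => exact ih

theorem numeral_subst (k : ℕ) (σ : ℕ → ATerm) : (numeral k).substAll σ = numeral k := by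
  induction k with
  | zero => rfl
  | succ k ih => simp only [numeral, ATerm.substAll, ih]

theorem Dat.Q0_free : D.Q0.FreeLt 2 := by
  have h := fun D' ts c h => AFml.FreeLt_inst D' ts c h
  unfold Dat.Q0
  refine ⟨⟨h _ _ _ ?_, ?_, h _ _ _ ?_⟩, h _ _ _ ?_, ⟨?_, h _ _ _ ?_, ?_⟩, h _ _ _ ?_, h _ _ _ ?_⟩ <;>
    simp [AFml.FreeLt, ATerm.FreeLt, ATerm.lift, tI, numeral_FreeLt]

theorem Dat.Q_free : D.Q.FreeLt 1 := by
  unfold Dat.Q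
  exact ⟨⟨Nat.zero_lt_succ _, numeral_FreeLt _ _⟩, D.Q0_free⟩
theorem Dat.P_free : D.P.FreeLt 1 := by
  unfold Dat.P
  refine ⟨⟨?_, ?_⟩, AFml.FreeLt_mono _ ?_ D.Q_free⟩ <;> simp [ATerm.FreeLt]

theorem Dat.P_subst (k : ℕ) :
    D.P.subst0 (numeral k) = .ex (.and (.eq (.var 0) (numeral k)) D.Q) := by
  unfold Dat.P AFml.subst0
  simp only [AFml.substAll, ATerm.substAll, liftSub, subst0Env]
  rw [show (numeral k).lift 0 = numeral k by
    rw [ATerm.lift_eq]; exact numeral_subst _ _]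
  rw [D.Q.substAll_congr (c := 1) (τ := ATerm.var) ?_ D.Q_free, AFml.substAll_var]
  intro i hi
  obtain rfl : i = 0 := by omega
  rfl

theorem Dat.code_P (k : ℕ) : (D.P.subst0 (numeral k)).code = pcode D.q k := by
  rw [D.P_subst]
  simp only [AFml.code, ATerm.code, code_numeral, Dat.Q, pcode, exEqC, Dat.q_eq]

end

section
variable {M : Type} (S : PStr M)

/-- `k * x + j` in a structure -/
def mlin (j : ℕ) (x : M) : M := S.add (S.mul (nu S 3) x) (nu S j)

variable {Tax : Set AFml} {m n : ℕ} (D : Dat Tax m n)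

/-- membership in the coded set -/
def Dat.In (u i : M) : Prop := D.SS.Ev S (S.env [u, i])

structure Dat.Wit (q u z : M) : Prop where
  zero : D.In S u S.zero
  bad : ∃ x, S.le x z ∧ D.ThD.Ev S (S.env [q, z, x]) ∧ ¬ D.In S u (mlin S 2 x)
  clo : ∀ i, S.le i z → ∀ w, S.le w z → ∀ a, S.le a z → ∀ b, S.le b z → ∀ c, S.le c z →
    ∀ d, S.le d z → D.CD.Ev S (S.env [q, i, a, b, c, d, w]) → D.In S u a → D.In S u b →
      D.In S u c ∨ D.In S u d
  thm : ∀ w, S.le w u → ∀ x, S.le x z → D.DTh.Ev S (S.env [q, w, x]) → D.In S u (mlin S 1 x)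

def Dat.EE (q u : M) : Prop := D.del.Ev S (S.env [u]) ∨ ∃ z, S.le z u ∧ D.Wit S q u z

theorem Dat.Ev_E (q u : M) : D.E.Ev S (S.env [u, q]) ↔ D.EE S q u := by
  unfold Dat.E Dat.EE
  simp only [AFml.Ev, Ev_bex, Ev_ball, Ev_inst, mcons_env, List.map, ATerm.ev, ev_numeral, tI]
  refine or_congr Iff.rfl (exists_congr fun z => and_congr Iff.rfl ?_)
  constructor
  · rintro ⟨h1, h2, h3, h4⟩
    exact ⟨h1, h2, h3, h4⟩
  · rintro ⟨h1, h2, h3, h4⟩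
    exact ⟨h1, h2, h3, h4⟩

def Dat.QQ (q x : M) : Prop :=
  (∃ w, D.DTh.Ev S (S.env [q, w, x]) ∧ ∀ u, S.le u w → ¬ D.EE S q u) ∨
  ∃ u, D.EE S q u ∧ (∀ u', S.le u' u → D.EE S q u' → u' = u) ∧
    (D.del.Ev S (S.env [u]) ∨ D.In S u (mlin S 1 x))

theorem Dat.Ev_Q0 (q x : M) : D.Q0.Ev S (S.env [q, x]) ↔ D.QQ S q x := by
  unfold Dat.Q0 Dat.QQ
  simp only [AFml.Ev, Ev_ball, Ev_inst, mcons_env, List.map, ATerm.ev, ev_numeral, tI]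
  simp only [← Dat.Ev_E]
  exact Iff.rfl

theorem Dat.Ev_P (k : ℕ) (ρ : ℕ → M) :
    (D.P.subst0 (numeral k)).Ev S ρ ↔ D.QQ S (nu S D.q) (nu S k) := by
  rw [← Dat.Ev_Q0, Dat.P_subst]
  unfold Dat.Q
  simp only [AFml.Ev, ATerm.ev, ev_numeral]
  constructor
  · rintro ⟨a, ha, b, hb, h⟩
    simp only [mcons] at ha hb
    subst ha hb
    refine (AFml.Ev_congr S D.Q0 (c := 2) ?_ D.Q0_free).1 h
    intro i hi
    rcases i with _ | _ | i
    · rfl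
    · rfl
    · omega
  · intro h
    refine ⟨nu S k, rfl, nu S D.q, rfl, (AFml.Ev_congr S D.Q0 (c := 2) ?_ D.Q0_free).1 h⟩
    intro i hi
    rcases i with _ | _ | i
    · rfl
    · rfl
    · omega

end


section
variable {M : Type} {S : PStr M} {Tax : Set AFml} {m n : ℕ} (D : Dat Tax m n)

theorem mlin_nu (h : Models S PA) (j x : ℕ) : mlin S j (nu S x) = nu S (3 * x + j) := by
  unfold mlin; rw [h.nu_mul, h.nu_add]

/-- `u` is the least element with `E`, `E(u)` not holding because of `del`. -/
structure Dat.Lst (S : PStr M) (u z : M) : Prop where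
  pa : Models S PA
  wit : D.Wit S (nu S D.q) u z
  zle : S.le z u
  least : ∀ u', S.le u' u → D.EE S (nu S D.q) u' → u' = u
  ndel : ¬ D.del.Ev S (S.env [u])

theorem Dat.exists_least (h : Models S PA) (q u : M) (hu : D.EE S q u) :
    ∃ u, D.EE S q u ∧ ∀ u', S.le u' u → D.EE S q u' → u' = u := by
  simp only [← D.Ev_E, ← mcons_env] at hu ⊢
  exact h.least D.E _ u hu

def Dat.Cov (S : PStr M) (z : M) (i : ℕ) : Prop := S.le (nu S i) z ∧
  ∃ a b c d w : ℕ, S.le (nu S a) z ∧ S.le (nu S b) z ∧ S.le (nu S c) z ∧ S.le (nu S d) z ∧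
    S.le (nu S w) z ∧ D.CD.Ev natStr (natStr.env [D.q, i, a, b, c, d, w])

variable {D} {u z : M}

theorem Dat.Lst.QQ_iff (L : D.Lst S u z) (k : ℕ) (hk : S.le (nu S k) z) :
    D.QQ S (nu S D.q) (nu S k) ↔ D.In S u (nu S (i0 k)) := by
  have e : mlin S 1 (nu S k) = nu S (i0 k) := mlin_nu L.pa 1 k
  have hE : D.EE S (nu S D.q) u := Or.inr ⟨z, L.zle, L.wit⟩
  constructor
  · rintro (⟨w, h1, h2⟩ | ⟨u', h1, h2, h3⟩)
    · rcases L.pa.le_total w u with h | h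
      · rw [← e]; exact L.wit.thm w h _ hk h1
      · exact absurd hE (h2 u h)
    · have : u' = u := by
        rcases L.pa.le_total u' u with h | h
        · exact L.least u' h h1
        · exact (h2 u h hE).symm
      subst this
      rw [← e]; exact h3.resolve_left L.ndel
  · intro h
    exact Or.inr ⟨u, hE, L.least, Or.inr (e ▸ h)⟩

theorem quad_inj {a b c d a' b' c' d' : ℕ} (h : quad a b c d = quad a' b' c' d') :
    a = a' ∧ b = b' ∧ c = c' ∧ d = d' := by
  simpa [quad, Nat.pair_eq_pair] using h

theorem Dat.Lst.clause (L : D.Lst S u z) {s t a b c d : ℕ} (hC : D.Cov S z (32 * s + t)) (ht : t < 32)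
    (he : selL (clauses m n) t D.q s = quad a b c d)
    (ha : D.In S u (nu S a)) (hb : D.In S u (nu S b)) : D.In S u (nu S c) ∨ D.In S u (nu S d) := by
  obtain ⟨hi, a', b', c', d', w, h1, h2, h3, h4, h5, h6⟩ := hC
  have := (D.cd _ _ _ _ _ _).2 ⟨w, h6⟩
  rw [cl_eq _ _ _ _ _ ht, he] at this
  obtain ⟨rfl, rfl, rfl, rfl⟩ := quad_inj this
  exact L.wit.clo _ hi _ h5 _ h1 _ h2 _ h3 _ h4 ((L.pa.absolute_env D.hCD [_, _, _, _, _, _, _]).2 h6) ha hb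

theorem Dat.Lst.clause1 (L : D.Lst S u z) {s t a b c : ℕ} (hC : D.Cov S z (32 * s + t)) (ht : t < 32)
    (he : selL (clauses m n) t D.q s = quad a b c c)
    (ha : D.In S u (nu S a)) (hb : D.In S u (nu S b)) : D.In S u (nu S c) :=
  (L.clause hC ht he ha hb).elim id id

theorem Dat.Lst.in0 (L : D.Lst S u z) : D.In S u (nu S 0) := L.wit.zero

set_option maxHeartbeats 400000 in
theorem Dat.Lst.truth (L : D.Lst S u z) (X : ℕ) (hX : ∀ k ≤ X, S.le (nu S k) z)
    (hC : ∀ i ≤ 32 * X + 31, D.Cov S z i) (ρ : ℕ → M) (φ : AFml) : φ.code ≤ X →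
    (φ.Ev S ρ → D.In S u (nu S (i1 φ.code))) ∧ (¬ φ.Ev S ρ → D.In S u (nu S (i2 φ.code))) := by
  have z0 := L.in0
  have cov : ∀ s t, s ≤ X → t < 32 → D.Cov S z (32 * s + t) := fun s t h1 h2 => hC _ (by omega)
  have imp : ∀ φ : AFml, φ.code ≤ X → Impure D.q φ.code →
      (φ.Ev S ρ → D.In S u (nu S (i1 φ.code))) ∧ (¬ φ.Ev S ρ → D.In S u (nu S (i2 φ.code))) := by
    intro φ h hi
    refine ⟨fun _ => L.clause1 (cov _ 11 h (by omega)) (by omega) (a := 0) (b := 0) ?_ z0 z0,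
      fun _ => L.clause1 (cov _ 12 h (by omega)) (by omega) (a := 0) (b := 0) ?_ z0 z0⟩ <;>
    · simp [selL, clauses, hi]
  have bin : ∀ t (φ ψ : AFml), Nat.pair t (Nat.pair φ.code ψ.code) ≤ X →
      φ.code ≤ X ∧ ψ.code ≤ X ∧ Nat.pair φ.code ψ.code ≤ X := by
    intro t φ ψ h
    have h1 := Nat.right_le_pair t (Nat.pair φ.code ψ.code)
    have h2 := Nat.left_le_pair φ.code ψ.code
    have h3 := Nat.right_le_pair φ.code ψ.code
    omega
  induction φ with
  | eq t s =>
    intro h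
    by_cases hb : (AFml.eq t s).code = botC
    · have : AFml.eq t s = botFml := AFml.code_inj _ _ (hb.trans botC_eq)
      rw [this] at h ⊢
      refine ⟨fun he => absurd he.symm (L.pa.succ_ne _), fun _ => ?_⟩
      rw [← botC_eq] at h ⊢
      exact L.clause1 (cov _ 13 h (by omega)) (by omega) (a := 0) (b := 0)
        (by simp only [selL, clauses, List.getD_cons_succ, List.getD_cons_zero]) z0 z0
    · exact imp _ h (Or.inl ⟨by simp [AFml.code], hb⟩)
  | le t s => intro h; exact imp _ h (Or.inr (Or.inl (by simp [AFml.code])))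
  | neg φ ih =>
    intro h
    have h1 : φ.code ≤ X := (Nat.right_le_pair 2 φ.code).trans h
    simp only [AFml.Ev, AFml.code, not_not]
    exact ⟨fun hn => L.clause1 (cov φ.code 0 h1 (by omega)) (by omega)
        (by simp only [selL, clauses, List.getD_cons_succ, List.getD_cons_zero]) ((ih h1).2 hn) z0,
      fun hn => L.clause1 (cov φ.code 1 h1 (by omega)) (by omega)
        (by simp only [selL, clauses, List.getD_cons_succ, List.getD_cons_zero]) ((ih h1).1 hn) z0⟩
  | and φ ψ ih1 ih2 =>
    intro h
    obtain ⟨h1, h2, h3⟩ := bin 3 φ ψ h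
    have i1 := ih1 h1
    have i2 := ih2 h2
    simp only [AFml.Ev, AFml.code]
    refine ⟨fun hn => L.clause1 (cov _ 2 h3 (by omega)) (by omega)
      (by simp only [selL, clauses, List.getD_cons_succ, List.getD_cons_zero, Nat.unpair_pair])
      (i1.1 hn.1) (i2.1 hn.2), fun hn => ?_⟩
    rcases not_and_or.1 hn with hn | hn
    · exact L.clause1 (cov _ 3 h3 (by omega)) (by omega)
        (by simp only [selL, clauses, List.getD_cons_succ, List.getD_cons_zero, Nat.unpair_pair])
        (i1.2 hn) z0
    · exact L.clause1 (cov _ 4 h3 (by omega)) (by omega)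
        (by simp only [selL, clauses, List.getD_cons_succ, List.getD_cons_zero, Nat.unpair_pair])
        (i2.2 hn) z0
  | or φ ψ ih1 ih2 =>
    intro h
    obtain ⟨h1, h2, h3⟩ := bin 4 φ ψ h
    have i1 := ih1 h1
    have i2 := ih2 h2
    simp only [AFml.Ev, AFml.code]
    refine ⟨fun hn => ?_, fun hn => L.clause1 (cov _ 7 h3 (by omega)) (by omega)
      (by simp only [selL, clauses, List.getD_cons_succ, List.getD_cons_zero, Nat.unpair_pair])
      (i1.2 (not_or.1 hn).1) (i2.2 (not_or.1 hn).2)⟩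
    rcases hn with hn | hn
    · exact L.clause1 (cov _ 5 h3 (by omega)) (by omega)
        (by simp only [selL, clauses, List.getD_cons_succ, List.getD_cons_zero, Nat.unpair_pair])
        (i1.1 hn) z0
    · exact L.clause1 (cov _ 6 h3 (by omega)) (by omega)
        (by simp only [selL, clauses, List.getD_cons_succ, List.getD_cons_zero, Nat.unpair_pair])
        (i2.1 hn) z0
  | imp φ ψ ih1 ih2 =>
    intro h
    obtain ⟨h1, h2, h3⟩ := bin 5 φ ψ h
    have i1 := ih1 h1
    have i2 := ih2 h2
    simp only [AFml.Ev, AFml.code]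
    refine ⟨fun hn => ?_, fun hn => L.clause1 (cov _ 10 h3 (by omega)) (by omega)
      (by simp only [selL, clauses, List.getD_cons_succ, List.getD_cons_zero, Nat.unpair_pair])
      (i1.1 (Classical.not_imp.1 hn).1) (i2.2 (Classical.not_imp.1 hn).2)⟩
    rcases Classical.em (φ.Ev S ρ) with hp | hp
    · exact L.clause1 (cov _ 9 h3 (by omega)) (by omega)
        (by simp only [selL, clauses, List.getD_cons_succ, List.getD_cons_zero, Nat.unpair_pair])
        (i2.1 (hn hp)) z0
    · exact L.clause1 (cov _ 8 h3 (by omega)) (by omega)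
        (by simp only [selL, clauses, List.getD_cons_succ, List.getD_cons_zero, Nat.unpair_pair])
        (i1.2 hp) z0
  | all φ ih => intro h; exact imp _ h (Or.inr (Or.inr (Or.inl (by simp [AFml.code]))))
  | ex φ ih =>
    intro h
    by_cases hb : pcode D.q (pinv D.q (AFml.ex φ).code) = (AFml.ex φ).code
    · generalize pinv D.q (AFml.ex φ).code = k at hb
      have hk : k ≤ X := by have := lt_pcode D.q k; omega
      rw [← D.code_P] at hb
      rw [← AFml.code_inj _ _ hb, D.Ev_P, L.QQ_iff k (hX k hk), D.code_P]
      refine ⟨fun hn => L.clause1 (cov k 14 hk (by omega)) (by omega)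
        (by simp only [selL, clauses, List.getD_cons_succ, List.getD_cons_zero]) hn z0, fun hn => ?_⟩
      exact (L.clause (cov k 15 hk (by omega)) (by omega)
        (by simp only [selL, clauses, List.getD_cons_succ, List.getD_cons_zero]) z0 z0).resolve_left hn
    · exact imp _ h (Or.inr (Or.inr (Or.inr ⟨by simp [AFml.code], hb⟩)))

/-- In a model of `T` the witness is nonstandard. -/
theorem Dat.Lst.nonstd (L : D.Lst S u z) (hT : Models S Tax) (k : ℕ) : z ≠ nu S k := by
  rintro rfl
  obtain ⟨x, hx, h1, h2⟩ := L.wit.bad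
  obtain ⟨x, hxk, rfl⟩ := L.pa.le_nu k x hx
  have h1' := (L.pa.absolute_env D.hThD [D.q, k, x]).1 h1
  obtain ⟨φ, hφ, rfl⟩ := D.thd1 _ _ _ h1'
  rw [mlin_nu L.pa] at h2
  have hle := D.thd2' _ _ _ h1'
  refine h2 ((L.truth φ.code (fun j hj => (L.pa.nu_le _ _).2 (by omega)) ?_
    (fun _ => S.zero) φ le_rfl).1 (hT.sound hφ _))
  intro i hi
  obtain ⟨a, ha, b, hb, c, hc, d, hd, w, hw, h⟩ := D.thd2 _ _ _ h1' i hi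
  exact ⟨(L.pa.nu_le _ _).2 (by omega), a, b, c, d, w, (L.pa.nu_le _ _).2 ha, (L.pa.nu_le _ _).2 hb,
    (L.pa.nu_le _ _).2 hc, (L.pa.nu_le _ _).2 hd, (L.pa.nu_le _ _).2 hw, h⟩

theorem Dat.Lst.cov (L : D.Lst S u z) (hT : Models S Tax) (i : ℕ) : D.Cov S z i := by
  have hz := fun k => L.pa.nu_le_of_nonstd z (L.nonstd hT) k
  obtain ⟨w, hw⟩ := (D.cd D.q i (cl m n D.q i).unpair.1 (cl m n D.q i).unpair.2.unpair.1
        (cl m n D.q i).unpair.2.unpair.2.unpair.1 (cl m n D.q i).unpair.2.unpair.2.unpair.2).1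
        (by simp [quad])
  exact ⟨hz _, _, _, _, _, _, hz _, hz _, hz _, hz _, hz _, hw⟩

theorem nu_nat (k : ℕ) : nu natStr k = k := by
  induction k with
  | zero => rfl
  | succ k ih => simp only [nu, ih]; rfl

variable (D)

theorem Dat.EE_abs (h : Models S PA) (q u : ℕ) :
    D.EE S (nu S q) (nu S u) ↔ D.EE natStr q u := by
  rw [← D.Ev_E, ← D.Ev_E]
  exact h.absolute_env D.E_delta0 [u, q]

theorem Dat.no_E (hext : PA ⊆ Tax) (hcons : ¬ Proves Tax botFml) (u : ℕ) : ¬ D.EE natStr D.q u := by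
  intro hu
  obtain ⟨u, hu, hl⟩ := D.exists_least natModels D.q u hu
  obtain ⟨M, S, hT, -⟩ := completeness_aux (Γ := Tax) (.neg botFml) (fun h => hcons
    (h.tc1 fun v => by simp only [AFml.evalProp]; tauto))
  have hPA : Models S PA := fun φ hφ => hT φ (hext hφ)
  have hu' := (D.EE_abs hPA _ _).2 hu
  have nd : ¬ D.del.Ev S (S.env [nu S u]) := fun h =>
    D.del2 u ((hPA.absolute_env D.hdel [u]).1 h)
  obtain ⟨z, hz, hw⟩ := hu'.resolve_left nd
  have L : D.Lst S (nu S u) z := ⟨hPA, hw, hz, fun u' h1 h2 => by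
    obtain ⟨j, hj, rfl⟩ := hPA.le_nu u u' h1
    rw [hl j hj ((D.EE_abs hPA _ _).1 h2)], nd⟩
  obtain ⟨j, hj, rfl⟩ := hPA.le_nu u z hz
  exact L.nonstd hT j rfl

theorem Dat.prov (hext : PA ⊆ Tax) (hcons : ¬ Proves Tax botFml) : IsProvPred Tax D.P := by
  refine ⟨D.P_free, fun φ => ⟨fun h => completeness fun M S hS ρ => ?_, fun h => ?_⟩⟩
  · unfold AFml.appNum gnum
    rw [D.Ev_P]
    obtain ⟨z, hz⟩ := D.thd3 D.q φ h
    obtain ⟨w, hw⟩ := D.dth2 _ _ _ hz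
    refine Or.inl ⟨nu S w, (hS.absolute_env D.hDTh [D.q, w, φ.code]).2 hw, fun u hu => ?_⟩
    obtain ⟨j, hj, rfl⟩ := hS.le_nu w u hu
    rw [D.EE_abs hS]
    exact D.no_E hext hcons j
  · have := natModels.sound h (fun _ => 0)
    unfold AFml.appNum gnum at this
    rw [D.Ev_P, nu_nat, nu_nat] at this
    rcases this with ⟨w, hw, _⟩ | ⟨u, hu, _⟩
    · obtain ⟨z, hz, _⟩ := D.dth1 _ _ _ hw
      obtain ⟨ψ, hψ, e⟩ := D.thd1 _ _ _ hz
      rw [AFml.code_inj _ _ e]; exact hψ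
    · exact absurd hu (D.no_E hext hcons u)

theorem Dat.code_iter (k : ℕ) (φ : AFml) : (iterPred D.P k φ).code = piter k D.q φ.code := by
  induction k with
  | zero => rfl
  | succ k ih =>
    simp only [iterPred, AFml.appNum, gnum, D.code_P, ih, piter, Function.iterate_succ', Function.comp]

theorem code_tag (φ : AFml) : φ.code.unpair.1 < 8 := by
  cases φ <;> simp [AFml.code]

theorem Dat.acc (hext : PA ⊆ Tax) (hm : 1 ≤ m) (hT : Models S Tax) (ρ : ℕ → M) (φ : AFml)
    (h : (iterPred D.P n φ).Ev S ρ) : (iterPred D.P m φ).Ev S ρ := by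
  obtain ⟨m, rfl⟩ : ∃ m', m = m' + 1 := ⟨m - 1, by omega⟩
  have hPA : Models S PA := fun φ hφ => hT φ (hext hφ)
  simp only [iterPred, AFml.appNum, gnum, D.Ev_P]
  obtain ⟨u0, hu0⟩ := D.del1 M S hT
  obtain ⟨u, hu, hl⟩ := D.exists_least hPA (nu S D.q) u0 (Or.inl hu0)
  by_cases nd : D.del.Ev S (S.env [u])
  · exact Or.inr ⟨u, hu, hl, Or.inl nd⟩
  obtain ⟨z, hz, hw⟩ := hu.resolve_left nd
  have L : D.Lst S u z := ⟨hPA, hw, hz, hl, nd⟩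
  have hst := fun k => L.pa.nu_le_of_nonstd z (L.nonstd hT) k
  rw [L.QQ_iff _ (hst _)]
  have h1 := (L.truth (iterPred D.P n φ).code (fun k _ => hst k) (fun i _ => L.cov hT i) ρ _ le_rfl).1 h
  have h2 : D.In S u (nu S (i1 (iterPred D.P (m + 1) φ).code)) :=
    L.clause1 (L.cov hT (32 * φ.code + 17)) (by omega) (b := 0) (by
      rw [D.code_iter, D.code_iter]
      simp only [selL, clauses, List.getD_cons_succ, List.getD_cons_zero, code_tag, if_true]) h1 L.in0
  simp only [iterPred, AFml.appNum, gnum, D.code_P] at h2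
  exact L.clause1 (L.cov hT (32 * (iterPred D.P m φ).code + 16)) (by omega)
        (by simp only [selL, clauses, List.getD_cons_succ, List.getD_cons_zero]) h2 L.in0

end


/-! ### Valuations of modal formulas -/

theorem exists_valuation {m n : ℕ} {A : MFml} (hA : ¬ NAProves m n A) :
    ∃ v : MFml → Prop, (∀ B, NAProves m n B → B.evalTC v) ∧ ¬ A.evalTC v := by
  let F : Filter (MFml → Prop) :=
    { sets := {s | ∃ B, NAProves m n B ∧ {v | B.evalTC v ∧ ¬ A.evalTC v} ⊆ s}
      univ_sets := ⟨.imp .bot .bot, .taut fun v => by simp [MFml.evalTC], Set.subset_univ _⟩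
      sets_of_superset := fun ⟨B, hB, hs⟩ h => ⟨B, hB, hs.trans h⟩
      inter_sets := by
        rintro s t ⟨B, hB, hs⟩ ⟨C, hC, ht⟩
        refine ⟨.and B C, .mp (.mp (.taut (A := .imp B (.imp C (.and B C))) fun v => ?_) hB) hC, ?_⟩
        · simp only [MFml.evalTC]; tauto
        · rintro v ⟨h1, h2⟩
          exact ⟨hs ⟨h1.1, h2⟩, ht ⟨h1.2, h2⟩⟩ }
  have hF : F.NeBot := by
    rw [Filter.neBot_iff]
    intro h
    have : (∅ : Set (MFml → Prop)) ∈ F := by rw [h]; exact Filter.mem_bot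
    obtain ⟨B, hB, hs⟩ := this
    refine hA (.mp (.taut fun v => ?_) hB)
    simp only [MFml.evalTC]
    intro h1
    by_contra h2
    exact hs ⟨h1, h2⟩
  let U := Ultrafilter.of F
  have key : ∀ C : MFml, C.evalTC (fun B => ∀ᶠ v in (U : Filter (MFml → Prop)), v B) ↔
      ∀ᶠ v in (U : Filter (MFml → Prop)), C.evalTC v := by
    intro C
    induction C with
    | var i => exact Iff.rfl
    | bot => simp [MFml.evalTC, U.neBot.ne]
    | neg A ih => simp only [MFml.evalTC, ih, Ultrafilter.eventually_not]
    | and A B ih1 ih2 => simp only [MFml.evalTC, ih1, ih2, Filter.eventually_and]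
    | or A B ih1 ih2 => simp only [MFml.evalTC, ih1, ih2, Ultrafilter.eventually_or]
    | imp A B ih1 ih2 => simp only [MFml.evalTC, ih1, ih2, Ultrafilter.eventually_imp]
    | box A ih => exact Iff.rfl
  have sub : ∀ B, NAProves m n B →
      ∀ᶠ v in (U : Filter (MFml → Prop)), B.evalTC v ∧ ¬ A.evalTC v := fun B hB =>
    Ultrafilter.of_le F (show _ ∈ F from ⟨B, hB, subset_rfl⟩)
  refine ⟨_, fun B hB => (key B).2 ((sub B hB).mono fun v h => h.1), fun h => ?_⟩
  have h1 := (key A).1 h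
  have h2 := (sub (.imp .bot .bot) (.taut fun v => by simp [MFml.evalTC])).mono fun v h => h.2
  exact (Ultrafilter.eventually_not.1 h2) h1

theorem all_true {m n : ℕ} (hm : 1 ≤ m) {A : MFml} (h : NAProves m n A) :
    A.evalTC (fun _ => True) := by
  induction h with
  | taut h => exact h _
  | acc A =>
    obtain ⟨m, rfl⟩ : ∃ m', m = m' + 1 := ⟨m - 1, by omega⟩
    exact fun _ => trivial
  | mp _ _ ih1 ih2 => exact ih1 ih2
  | nec _ _ => trivial
  | ros _ ih => exact absurd trivial ih

section
variable {Tax : Set AFml} {m n : ℕ} (D : Dat Tax m n)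

theorem interp_Ev {P : AFml} {f : MFml → AFml} (hf : IsInterp P f) {M : Type} {S : PStr M}
    (hS : Models S PA) (ρ : ℕ → M) (A : MFml) :
    (f A).Ev S ρ ↔ A.evalTC (fun B => (f B).Ev S ρ) := by
  obtain ⟨_, h1, h2, h3, h4, h5, h6⟩ := hf
  induction A with
  | var i => exact Iff.rfl
  | bot =>
    rw [h1]
    exact iff_of_false (fun h => hS.succ_ne _ h.symm) id
  | neg A ih => rw [h2]; exact not_congr ih
  | and A B ih1 ih2 => rw [h3]; exact and_congr ih1 ih2
  | or A B ih1 ih2 => rw [h4]; exact or_congr ih1 ih2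
  | imp A B ih1 ih2 => rw [h5]; exact imp_congr ih1 ih2
  | box A ih => exact Iff.rfl

theorem interp_iter {P : AFml} {f : MFml → AFml} (hf : IsInterp P f) (k : ℕ) (A : MFml) :
    f (boxIter k A) = iterPred P k (f A) := by
  obtain ⟨_, h1, h2, h3, h4, h5, h6⟩ := hf
  induction k with
  | zero => rfl
  | succ k ih => simp only [boxIter, iterPred, h6, ih]

theorem Dat.sound (hext : PA ⊆ Tax) (hcons : ¬ Proves Tax botFml) (hm : 1 ≤ m) (A : MFml)
    (f : MFml → AFml) (hf : IsInterp D.P f) (h : NAProves m n A) : Proves Tax (f A) := by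
  have hPA : ∀ {M : Type} {S : PStr M}, Models S Tax → Models S PA := fun hT φ hφ => hT φ (hext hφ)
  induction h with
  | taut h =>
    exact completeness fun M S hS ρ => (interp_Ev hf (hPA hS) ρ _).2 (h _)
  | acc A =>
    refine completeness fun M S hS ρ => ?_
    rw [hf.2.2.2.2.2.1, interp_iter hf, interp_iter hf]
    exact D.acc hext hm hS ρ (f A)
  | mp _ _ ih1 ih2 => rw [hf.2.2.2.2.2.1] at ih1; exact ih1.mp ih2
  | nec _ ih =>
    rw [hf.2.2.2.2.2.2]
    have := ((D.prov hext hcons).2 _).1 ih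
    exact completeness fun M S hS ρ => (hPA hS).sound this ρ
  | ros h _ => exact absurd trivial (all_true hm h)

/-! ### The exact interpretation -/

def Dat.f : MFml → AFml
  | .var i => D.P.subst0 (numeral (Nat.pair 8 i))
  | .bot => botFml
  | .neg A => .neg (Dat.f A)
  | .and A B => .and (Dat.f A) (Dat.f B)
  | .or A B => .or (Dat.f A) (Dat.f B)
  | .imp A B => .imp (Dat.f A) (Dat.f B)
  | .box A => D.P.appNum (Dat.f A)

theorem Dat.f_interp : IsInterp D.P D.f := by
  refine ⟨fun i => ?_, rfl, fun _ => rfl, fun _ _ => rfl, fun _ _ => rfl, fun _ _ => rfl, fun _ => rfl⟩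
  simp only [Dat.f, D.P_subst]
  exact ⟨⟨Nat.zero_lt_succ _, numeral_FreeLt _ _⟩, D.Q_free⟩

theorem num_inj {a b : ℕ} (h : num a = num b) : a = b := by
  induction a generalizing b with
  | zero =>
    cases b with
    | zero => rfl
    | succ b => simp [num, Nat.pair_eq_pair] at h
  | succ a ih =>
    cases b with
    | zero => simp [num, Nat.pair_eq_pair] at h
    | succ b =>
      simp only [num, Nat.pair_eq_pair, true_and] at h
      rw [ih h]

theorem pcode_inj {q a b : ℕ} (h : pcode q a = pcode q b) : a = b := by
  simp only [pcode, exEqC, Nat.pair_eq_pair, true_and, and_true] at h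
  exact num_inj h

theorem pcode_tag (q a : ℕ) : (pcode q a).unpair.1 = 7 := by
  simp only [pcode, exEqC, Nat.unpair_pair]

/-- the code of `f A` -/
def Dat.g (A : MFml) : ℕ := (D.f A).code

theorem Dat.g_var (i : ℕ) : D.g (.var i) = pcode D.q (Nat.pair 8 i) := D.code_P _
theorem Dat.g_bot : D.g .bot = botC := botC_eq.symm
theorem Dat.g_neg (A) : D.g (.neg A) = Nat.pair 2 (D.g A) := rfl
theorem Dat.g_and (A B) : D.g (.and A B) = Nat.pair 3 (Nat.pair (D.g A) (D.g B)) := rfl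
theorem Dat.g_or (A B) : D.g (.or A B) = Nat.pair 4 (Nat.pair (D.g A) (D.g B)) := rfl
theorem Dat.g_imp (A B) : D.g (.imp A B) = Nat.pair 5 (Nat.pair (D.g A) (D.g B)) := rfl
theorem Dat.g_box (A) : D.g (.box A) = pcode D.q (D.g A) := D.code_P _
theorem botC_tag : botC.unpair.1 = 0 := by
  rw [botC_eq]; simp only [botFml, AFml.code, Nat.unpair_pair]
theorem Dat.g_tag (A) : (D.g A).unpair.1 < 8 := code_tag _

theorem Dat.dec_un {s : ℕ} {B : MFml} (h : Nat.pair 2 s = D.g B) : ∃ C, B = .neg C ∧ s = D.g C := by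
  have ht := congrArg (fun x => x.unpair.1) h
  cases B <;> simp only [g_var, g_bot, g_neg, g_and, g_or, g_imp, g_box, Nat.unpair_pair, pcode_tag,
    botC_tag] at ht h <;> first | omega | skip
  rename_i C
  exact ⟨C, rfl, (Nat.pair_eq_pair.1 h).2⟩

theorem Dat.dec_and {s : ℕ} {B : MFml} (h : Nat.pair 3 s = D.g B) :
    ∃ C E, B = .and C E ∧ s.unpair.1 = D.g C ∧ s.unpair.2 = D.g E := by
  have ht := congrArg (fun x => x.unpair.1) h
  cases B <;> simp only [g_var, g_bot, g_neg, g_and, g_or, g_imp, g_box, Nat.unpair_pair, pcode_tag,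
    botC_tag] at ht h <;> first | omega | skip
  rename_i C E
  rw [(Nat.pair_eq_pair.1 h).2]
  exact ⟨C, E, rfl, by simp, by simp⟩

theorem Dat.dec_or {s : ℕ} {B : MFml} (h : Nat.pair 4 s = D.g B) :
    ∃ C E, B = .or C E ∧ s.unpair.1 = D.g C ∧ s.unpair.2 = D.g E := by
  have ht := congrArg (fun x => x.unpair.1) h
  cases B <;> simp only [g_var, g_bot, g_neg, g_and, g_or, g_imp, g_box, Nat.unpair_pair, pcode_tag,
    botC_tag] at ht h <;> first | omega | skip
  rename_i C E
  rw [(Nat.pair_eq_pair.1 h).2]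
  exact ⟨C, E, rfl, by simp, by simp⟩

theorem Dat.dec_imp {s : ℕ} {B : MFml} (h : Nat.pair 5 s = D.g B) :
    ∃ C E, B = .imp C E ∧ s.unpair.1 = D.g C ∧ s.unpair.2 = D.g E := by
  have ht := congrArg (fun x => x.unpair.1) h
  cases B <;> simp only [g_var, g_bot, g_neg, g_and, g_or, g_imp, g_box, Nat.unpair_pair, pcode_tag,
    botC_tag] at ht h <;> first | omega | skip
  rename_i C E
  rw [(Nat.pair_eq_pair.1 h).2]
  exact ⟨C, E, rfl, by simp, by simp⟩

theorem Dat.dec_bot {B : MFml} (h : botC = D.g B) : B = .bot := by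
  have ht := congrArg (fun x => x.unpair.1) h
  cases B <;> simp only [g_var, g_bot, g_neg, g_and, g_or, g_imp, g_box, Nat.unpair_pair, pcode_tag,
    botC_tag] at ht h <;> first | omega | rfl

theorem Dat.dec_P {s : ℕ} {B : MFml} (h : pcode D.q s = D.g B) :
    (∃ i, B = .var i ∧ s = Nat.pair 8 i) ∨ ∃ C, B = .box C ∧ s = D.g C := by
  have ht := congrArg (fun x => x.unpair.1) h
  cases B <;> simp only [g_var, g_bot, g_neg, g_and, g_or, g_imp, g_box, Nat.unpair_pair, pcode_tag,
    botC_tag] at ht h <;> first | omega | skip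
  · exact Or.inl ⟨_, rfl, pcode_inj h⟩
  · exact Or.inr ⟨_, rfl, pcode_inj h⟩

theorem Dat.dec_impure (B : MFml) : ¬ Impure D.q (D.g B) := by
  unfold Impure
  cases B <;> simp only [g_var, g_bot, g_neg, g_and, g_or, g_imp, g_box, Nat.unpair_pair, pcode_tag,
    botC_tag, pinv_spec] <;> simp

theorem Dat.g_inj {A B : MFml} (h : D.g A = D.g B) : A = B := by
  induction A generalizing B with
  | var i =>
    rw [g_var] at h
    rcases D.dec_P h with ⟨j, hB, h2⟩ | ⟨C, hB, h2⟩
    · rw [hB, (Nat.pair_eq_pair.1 h2).2]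
    · have := D.g_tag C
      rw [← h2, Nat.unpair_pair] at this
      exact absurd this (lt_irrefl 8)
  | bot => rw [g_bot] at h; exact (D.dec_bot h).symm
  | neg A ih =>
    rw [g_neg] at h
    obtain ⟨C, hB, h2⟩ := D.dec_un h
    rw [hB, ih h2]
  | and A A' ih1 ih2 =>
    rw [g_and] at h
    obtain ⟨C, E, hB, h1, h2⟩ := D.dec_and h
    rw [Nat.unpair_pair] at h1 h2
    rw [hB, ih1 h1, ih2 h2]
  | or A A' ih1 ih2 =>
    rw [g_or] at h
    obtain ⟨C, E, hB, h1, h2⟩ := D.dec_or h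
    rw [Nat.unpair_pair] at h1 h2
    rw [hB, ih1 h1, ih2 h2]
  | imp A A' ih1 ih2 =>
    rw [g_imp] at h
    obtain ⟨C, E, hB, h1, h2⟩ := D.dec_imp h
    rw [Nat.unpair_pair] at h1 h2
    rw [hB, ih1 h1, ih2 h2]
  | box A ih =>
    rw [g_box] at h
    rcases D.dec_P h with ⟨j, hB, h2⟩ | ⟨C, hB, h2⟩
    · have := D.g_tag A
      rw [h2, Nat.unpair_pair] at this
      exact absurd this (lt_irrefl 8)
    · rw [hB, ih h2]

theorem piter_succ (k q s : ℕ) : piter (k + 1) q s = pcode q (piter k q s) := by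
  simp only [piter, Function.iterate_succ', Function.comp]

theorem Dat.g_iter (k : ℕ) (C : MFml) : D.g (boxIter k C) = piter k D.q (D.g C) := by
  induction k with
  | zero => rfl
  | succ k ih => rw [piter_succ, ← ih]; exact D.g_box _

theorem Dat.dec_iter (k : ℕ) {s : ℕ} (hs : s.unpair.1 < 8) {B : MFml} (h : piter k D.q s = D.g B) :
    ∃ C, B = boxIter k C ∧ s = D.g C := by
  induction k generalizing B with
  | zero => exact ⟨B, rfl, h⟩
  | succ k ih =>
    rw [piter_succ] at h
    rcases D.dec_P h with ⟨i, hB, h2⟩ | ⟨C, hB, h2⟩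
    · exfalso
      have := congrArg (fun x => x.unpair.1) h2
      simp only [Nat.unpair_pair] at this
      cases k with
      | zero => simp only [piter, Function.iterate_zero, id] at this; omega
      | succ k => rw [piter_succ, pcode_tag] at this; omega
    · obtain ⟨E, hC, h'⟩ := ih h2
      exact ⟨E, by rw [hB, hC]; rfl, h'⟩

end

section
variable {Tax : Set AFml} {m n : ℕ} (D : Dat Tax m n) (v : MFml → Prop)

def Dat.S1 (x : ℕ) : Prop := ∀ B, x = D.g B → B.evalTC v
def Dat.S2 (x : ℕ) : Prop := ∀ B, x = D.g B → ¬ B.evalTC v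
def Dat.AA : Set ℕ := {i | i = 0 ∨ (∃ x, i = i0 x ∧ D.S1 v (pcode D.q x)) ∨
  (∃ x, i = i1 x ∧ D.S1 v x) ∨ ∃ x, i = i2 x ∧ D.S2 v x}

theorem Dat.mem_zero : 0 ∈ D.AA v := Or.inl rfl
theorem Dat.mem_i0 (x : ℕ) : i0 x ∈ D.AA v ↔ D.S1 v (pcode D.q x) := by
  simp only [Dat.AA, Set.mem_setOf_eq, i0, i1, i2]
  constructor
  · rintro (h | ⟨y, h, h'⟩ | ⟨y, h, h'⟩ | ⟨y, h, h'⟩)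
    · omega
    · obtain rfl : x = y := by omega
      exact h'
    · omega
    · omega
  · intro h; exact Or.inr (Or.inl ⟨x, rfl, h⟩)
theorem Dat.mem_i1 (x : ℕ) : i1 x ∈ D.AA v ↔ D.S1 v x := by
  simp only [Dat.AA, Set.mem_setOf_eq, i0, i1, i2]
  constructor
  · rintro (h | ⟨y, h, h'⟩ | ⟨y, h, h'⟩ | ⟨y, h, h'⟩)
    · omega
    · omega
    · obtain rfl : x = y := by omega
      exact h'
    · omega
  · intro h; exact Or.inr (Or.inr (Or.inl ⟨x, rfl, h⟩))
theorem Dat.mem_i2 (x : ℕ) : i2 x ∈ D.AA v ↔ D.S2 v x := by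
  simp only [Dat.AA, Set.mem_setOf_eq, i0, i1, i2]
  constructor
  · rintro (h | ⟨y, h, h'⟩ | ⟨y, h, h'⟩ | ⟨y, h, h'⟩)
    · omega
    · omega
    · omega
    · obtain rfl : x = y := by omega
      exact h'
  · intro h; exact Or.inr (Or.inr (Or.inr ⟨x, rfl, h⟩))

def OkC (A : Set ℕ) (y : ℕ) : Prop :=
  ∀ a b c d, y = quad a b c d → a ∈ A → b ∈ A → c ∈ A ∨ d ∈ A

theorem OkC.mk {A : Set ℕ} {a b c d : ℕ} (h : a ∈ A → b ∈ A → c ∈ A ∨ d ∈ A) : OkC A (quad a b c d) := by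
  intro a' b' c' d' e
  obtain ⟨rfl, rfl, rfl, rfl⟩ := quad_inj e
  exact h
theorem OkC.mk1 {A : Set ℕ} {a b c : ℕ} (h : a ∈ A → b ∈ A → c ∈ A) : OkC A (quad a b c c) :=
  OkC.mk fun h1 h2 => Or.inl (h h1 h2)
theorem OkC.zero {A : Set ℕ} : OkC A 0 := by
  have : OkC A (quad 0 0 0 0) := OkC.mk1 fun h _ => h
  have e : quad 0 0 0 0 = 0 := by decide
  rwa [e] at this

theorem Dat.S12 (x : ℕ) : D.S1 v x ∨ D.S2 v x := by
  by_cases h : D.S1 v x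
  · exact Or.inl h
  · unfold Dat.S1 at h
    push Not at h
    obtain ⟨B, hB, h⟩ := h
    refine Or.inr fun C hC => ?_
    rw [← D.g_inj (hB.symm.trans hC)]; exact h

theorem Dat.clauses_ok (hv : ∀ B, NAProves m n B → B.evalTC v) :
    ∀ g ∈ clauses m n, ∀ s, OkC (D.AA v) (g D.q s) := by
  simp only [clauses, List.forall_mem_cons]
  refine ⟨?_, ?_, ?_, ?_, ?_, ?_, ?_, ?_, ?_, ?_, ?_, ?_, ?_, ?_, ?_, ?_, ?_, ?_, ?_⟩
  · refine fun s => OkC.mk1 ?_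
    rw [D.mem_i2, D.mem_i1]
    intro h _ B hB
    obtain ⟨C, rfl, e⟩ := D.dec_un hB
    exact h C e
  · refine fun s => OkC.mk1 ?_
    rw [D.mem_i2, D.mem_i1]
    intro h _ B hB
    obtain ⟨C, rfl, e⟩ := D.dec_un hB
    exact not_not.2 (h C e)
  · refine fun s => OkC.mk1 ?_
    simp only [D.mem_i2, D.mem_i1]
    intro h h' B hB
    obtain ⟨C, E, rfl, e, e'⟩ := D.dec_and hB
    exact ⟨h C e, h' E e'⟩
  · refine fun s => OkC.mk1 ?_
    simp only [D.mem_i2, D.mem_i1]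
    intro h _ B hB
    obtain ⟨C, E, rfl, e, e'⟩ := D.dec_and hB
    exact fun hh => h C e hh.1
  · refine fun s => OkC.mk1 ?_
    simp only [D.mem_i2, D.mem_i1]
    intro h _ B hB
    obtain ⟨C, E, rfl, e, e'⟩ := D.dec_and hB
    exact fun hh => h E e' hh.2
  · refine fun s => OkC.mk1 ?_
    simp only [D.mem_i2, D.mem_i1]
    intro h _ B hB
    obtain ⟨C, E, rfl, e, e'⟩ := D.dec_or hB
    exact Or.inl (h C e)
  · refine fun s => OkC.mk1 ?_
    simp only [D.mem_i2, D.mem_i1]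
    intro h _ B hB
    obtain ⟨C, E, rfl, e, e'⟩ := D.dec_or hB
    exact Or.inr (h E e')
  · refine fun s => OkC.mk1 ?_
    simp only [D.mem_i2, D.mem_i1]
    intro h h' B hB
    obtain ⟨C, E, rfl, e, e'⟩ := D.dec_or hB
    exact fun hh => hh.elim (h C e) (h' E e')
  · refine fun s => OkC.mk1 ?_
    simp only [D.mem_i2, D.mem_i1]
    intro h _ B hB
    obtain ⟨C, E, rfl, e, e'⟩ := D.dec_imp hB
    exact fun hh => absurd hh (h C e)
  · refine fun s => OkC.mk1 ?_
    simp only [D.mem_i2, D.mem_i1]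
    intro h _ B hB
    obtain ⟨C, E, rfl, e, e'⟩ := D.dec_imp hB
    exact fun _ => h E e'
  · refine fun s => OkC.mk1 ?_
    simp only [D.mem_i2, D.mem_i1]
    intro h h' B hB
    obtain ⟨C, E, rfl, e, e'⟩ := D.dec_imp hB
    exact fun hh => h' E e' (hh (h C e))
  · intro s
    split_ifs with hi
    · refine OkC.mk1 ?_
      rw [D.mem_i1]
      rintro _ _ B rfl
      exact absurd hi (D.dec_impure B)
    · exact OkC.zero
  · intro s
    split_ifs with hi
    · refine OkC.mk1 ?_
      rw [D.mem_i2]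
      rintro _ _ B rfl
      exact absurd hi (D.dec_impure B)
    · exact OkC.zero
  · refine fun s => OkC.mk1 ?_
    rw [D.mem_i2]
    intro _ _ B hB
    rw [D.dec_bot hB]
    exact id
  · refine fun s => OkC.mk1 ?_
    rw [D.mem_i0, D.mem_i1]
    exact fun h _ => h
  · refine fun s => OkC.mk ?_
    rw [D.mem_i0, D.mem_i2]
    exact fun _ _ => D.S12 v _
  · refine fun s => OkC.mk1 ?_
    rw [D.mem_i0, D.mem_i1]
    exact fun h _ => h
  · intro s
    split_ifs with hs
    · refine OkC.mk1 ?_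
      rw [D.mem_i1, D.mem_i1]
      intro h _ B hB
      obtain ⟨C, rfl, rfl⟩ := D.dec_iter m hs hB
      exact hv _ (NAProves.acc C) (h _ (D.g_iter n C).symm)
    · exact OkC.zero
  · simp

theorem Dat.complete (hext : PA ⊆ Tax) (hcons : ¬ Proves Tax botFml) (A : MFml)
    (h : Proves Tax (D.f A)) : NAProves m n A := by
  classical
  by_contra hA
  have hex : ∃ z, ∃ A, ¬ NAProves m n A ∧ D.ThD.Ev natStr (natStr.env [D.q, z, D.g A]) := by
    obtain ⟨z, hz⟩ := D.thd3 D.q _ h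
    exact ⟨z, A, hA, hz⟩
  clear h hA
  obtain ⟨A, hA, hz⟩ := Nat.find_spec hex
  have hmin := fun {z} => Nat.find_min (m := z) hex
  generalize Nat.find hex = z0 at hz hmin
  obtain ⟨v, hv, hvA⟩ := exists_valuation hA
  obtain ⟨u, hzu, hu, hS⟩ := exists_code (D.AA v) z0
  have hin : ∀ i ≤ 3 * z0 + 3, D.In natStr u i ↔ i ∈ D.AA v := fun i hi =>
    (D.ss u i).trans (hS i hi)
  have ml : ∀ j x, mlin natStr j x = 3 * x + j := fun j x => by
    have := mlin_nu natModels j x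
    rwa [nu_nat, nu_nat] at this
  refine D.no_E hext hcons u (Or.inr ⟨z0, hzu, ⟨?_, ?_, ?_, ?_⟩⟩)
  · exact (hin 0 (by omega)).2 (D.mem_zero v)
  · have hx := D.thd2' _ _ _ hz
    refine ⟨D.g A, ?_, hz, ?_⟩
    · show D.g A ≤ z0
      omega
    · rw [ml, hin _ (by omega)]
      exact fun hh => hvA ((D.mem_i1 v _).1 hh A rfl)
  · intro i hi w hw a ha b hb c hc d hd h
    have ha' : a ≤ z0 := ha
    have hb' : b ≤ z0 := hb
    have hc' : c ≤ z0 := hc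
    have hd' : d ≤ z0 := hd
    rw [hin a (by omega), hin b (by omega), hin c (by omega), hin d (by omega)]
    have e := (D.cd _ _ _ _ _ _).2 ⟨w, h⟩
    refine (?_ : OkC (D.AA v) (cl m n D.q i)) a b c d e.symm
    unfold cl selL
    rcases Nat.lt_or_ge (i % 32) (clauses m n).length with hl | hl
    · rw [List.getD_eq_getElem _ _ hl]
      exact D.clauses_ok v hv _ (List.getElem_mem hl) _
    · rw [List.getD_eq_default _ _ hl]
      exact OkC.zero
  · intro w hw x hx h
    have hw' : w ≤ u := hw
    have hx' : x ≤ z0 := hx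
    rw [ml, hin _ (by omega)]
    refine (D.mem_i0 v x).2 ?_
    intro B hB
    obtain ⟨z, h1, h2⟩ := D.dth1 _ _ _ h
    have hzz : z < z0 := by
      by_contra hc
      have := h2 z0 (by omega)
      omega
    rcases D.dec_P hB with ⟨i, rfl, rfl⟩ | ⟨C, rfl, rfl⟩
    · obtain ⟨φ, _, e⟩ := D.thd1 _ _ _ h1
      have := code_tag φ
      rw [← e] at this; simp at this
    · refine hv _ (.nec ?_)
      by_contra hC
      exact hmin hzz ⟨C, hC, h1⟩

end

theorem main_result (Tax : Set AFml) (hext : PA ⊆ Tax)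
    (hcons : ¬ Proves Tax botFml) (hpr : PrAxiomatized Tax)
    (hill : ¬ Sigma1Sound Tax)
    (m n : ℕ) (hm : 1 ≤ m) :
    ∃ P : AFml, IsSigma1 P ∧ IsProvPred Tax P ∧
      (∀ (A : MFml) (f : MFml → AFml), IsInterp P f → NAProves m n A → Proves Tax (f A)) ∧
      (∃ f : MFml → AFml, IsInterp P f ∧ ∀ A : MFml, NAProves m n A ↔ Proves Tax (f A)) := by
  obtain ⟨D⟩ := exists_dat Tax hext hpr hill m n
  exact ⟨D.P, D.P_sigma1, D.prov hext hcons, D.sound hext hcons hm, D.f, D.f_interp,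
    fun A => ⟨D.sound hext hcons hm A D.f D.f_interp, D.complete hext hcons A⟩⟩

/-- Theorem 4.3: Suppose `m ≠ n`, `T` is `Σ₁`-ill, `m ≥ 1` and `n ≥ 0`. Then
there is a `Σ₁` provability predicate `PR_T(x)` of `T` such that (1) `N⁺A_{m,n}` is sound for
every arithmetical interpretation based on `PR_T(x)`, and (2) some arithmetical interpretation
based on `PR_T(x)` is exact for `N⁺A_{m,n}`. -/
theorem statement_7 (Tax : Set AFml) (hext : PA ⊆ Tax)
    (hcons : ¬ Proves Tax botFml) (hpr : PrAxiomatized Tax)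
    (hill : ¬ Sigma1Sound Tax)
    (m n : ℕ) (hmn : m ≠ n) (hm : 1 ≤ m) (hn : 0 ≤ n) :
    ∃ P : AFml, IsSigma1 P ∧ IsProvPred Tax P ∧
      (∀ (A : MFml) (f : MFml → AFml), IsInterp P f → NAProves m n A → Proves Tax (f A)) ∧
      (∃ f : MFml → AFml, IsInterp P f ∧ ∀ A : MFml, NAProves m n A ↔ Proves Tax (f A)) := by
  exact main_result Tax hext hcons hpr hill m n hm

end PLN
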